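/- arXiv:1911.03968 — 2 statements merged into one kernel-verified Lean document; each statement's English description precedes it below -/
import Mathlib

section
/- The series identity \sum_{n=0}^{\infty} [ (1/2)_n (1/4)_n (3/4)_n / ((1)_n)^3 ] * (26390*n + 1103) * (1/99^4)^n = 9801*\sqrt{2} / (4*\pi) holds, where the series converges absolutely. -/
open scoped Real

namespace RamanujanSeries

open Filter Topology Set MeasureTheory

/-! ### Polynomials with coefficients in `ℤ[√29]`, as coefficient lists -/

/-- The real embedding of `ℤ[√29]` sending the generator to `√29`. -/
noncomputable def toReal : ℤ√29 →+* ℝ :=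
  Zsqrtd.lift ⟨√29, by norm_num⟩

theorem toReal_apply (c : ℤ√29) : toReal c = c.re + c.im * √29 := rfl

/-- The value at `x` of the polynomial with the given list of coefficients. -/
noncomputable def evalList : List (ℤ√29) → ℝ → ℝ
  | [], _ => 0
  | c :: l, x => toReal c + x * evalList l x

/-- Sum of coefficient lists. -/
def addList : List (ℤ√29) → List (ℤ√29) → List (ℤ√29)
  | [], q => q
  | p, [] => p
  | c :: p, d :: q => (c + d) :: addList p q

/-- Scalar multiple of a coefficient list. -/
def smulList (c : ℤ√29) (p : List (ℤ√29)) : List (ℤ√29) :=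
  p.map (c * ·)

/-- Product of coefficient lists. -/
def mulList : List (ℤ√29) → List (ℤ√29) → List (ℤ√29)
  | [], _ => []
  | c :: p, q => addList (smulList c q) (0 :: mulList p q)

/-- Coefficient list of the derivative. -/
def derivList : List (ℤ√29) → List (ℤ√29)
  | [] => []
  | _ :: p => addList p (0 :: derivList p)

theorem evalList_addList (p q : List (ℤ√29)) (x : ℝ) :
    evalList (addList p q) x = evalList p x + evalList q x := by
  induction p generalizing q with
  | nil => simp [addList, evalList]
  | cons c p ih =>
    cases q with
    | nil => simp [addList, evalList]
    | cons d q => simp only [addList, evalList, ih, map_add]; ring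

theorem evalList_smulList (c : ℤ√29) (p : List (ℤ√29)) (x : ℝ) :
    evalList (smulList c p) x = toReal c * evalList p x := by
  induction p with
  | nil => simp [smulList, evalList]
  | cons d p ih =>
    have h : smulList c (d :: p) = c * d :: smulList c p := rfl
    rw [h, evalList, evalList, ih, map_mul]; ring

theorem evalList_zero_cons (p : List (ℤ√29)) (x : ℝ) :
    evalList (0 :: p) x = x * evalList p x := by
  simp [evalList]

theorem evalList_mulList (p q : List (ℤ√29)) (x : ℝ) :
    evalList (mulList p q) x = evalList p x * evalList q x := by
  induction p with
  | nil => simp [mulList, evalList]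
  | cons c p ih =>
    rw [mulList, evalList_addList, evalList_smulList, evalList_zero_cons, ih, evalList]; ring

theorem hasDerivAt_evalList (p : List (ℤ√29)) (x : ℝ) :
    HasDerivAt (evalList p) (evalList (derivList p) x) x := by
  induction p with
  | nil => exact hasDerivAt_const x 0
  | cons c p ih =>
    have h := ((hasDerivAt_id x).mul ih).const_add (toReal c)
    rw [derivList, evalList_addList, evalList_zero_cons]
    convert! h using 1
    simp

theorem evalList_eq_zero {p : List (ℤ√29)} (hp : ∀ c ∈ p, c = 0) (x : ℝ) :
    evalList p x = 0 := by
  induction p with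
  | nil => rfl
  | cons c p ih =>
    simp only [List.mem_cons, forall_eq_or_imp] at hp
    simp [evalList, hp.1, ih hp.2]

theorem evalList_eq_of_sub {p q : List (ℤ√29)}
    (h : ∀ c ∈ addList p (smulList (-1) q), c = 0) (x : ℝ) : evalList p x = evalList q x := by
  have := evalList_eq_zero h x
  rw [evalList_addList, evalList_smulList, map_neg, map_one] at this
  linarith

/-- A decidable sufficient condition for the positivity of the real embedding. -/
def IsPos (c : ℤ√29) : Prop :=
  (0 < c.re ∧ 29 * c.im ^ 2 < c.re ^ 2) ∨ (0 < c.im ∧ c.re ^ 2 < 29 * c.im ^ 2)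

instance : DecidablePred IsPos := fun c => inferInstanceAs
  (Decidable ((0 < c.re ∧ 29 * c.im ^ 2 < c.re ^ 2) ∨ (0 < c.im ∧ c.re ^ 2 < 29 * c.im ^ 2)))

theorem IsPos.toReal_pos {c : ℤ√29} (hc : IsPos c) : 0 < toReal c := by
  have hs : (c.im * √29 : ℝ) ^ 2 = 29 * (c.im : ℝ) ^ 2 := by
    rw [mul_pow, Real.sq_sqrt (by norm_num)]; ring
  rw [toReal_apply]
  rcases hc with ⟨h1, h2⟩ | ⟨h1, h2⟩
  · have h1' : (0 : ℝ) < c.re := by exact_mod_cast h1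
    have h2' : 29 * (c.im : ℝ) ^ 2 < (c.re : ℝ) ^ 2 := by exact_mod_cast h2
    have h3 := abs_lt_of_sq_lt_sq (hs.trans_lt h2') h1'.le
    linarith [(abs_lt.mp h3).1]
  · have h1' : (0 : ℝ) < c.im * √29 := by
      have : (0 : ℝ) < c.im := by exact_mod_cast h1
      positivity
    have h2' : (c.re : ℝ) ^ 2 < 29 * (c.im : ℝ) ^ 2 := by exact_mod_cast h2
    have h3 := abs_lt_of_sq_lt_sq (h2'.trans_eq hs.symm) h1'.le
    linarith [(abs_lt.mp h3).1]

theorem evalList_nonneg {p : List (ℤ√29)} (hp : ∀ c ∈ p, c = 0 ∨ IsPos c) {x : ℝ} (hx : 0 ≤ x) :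
    0 ≤ evalList p x := by
  induction p with
  | nil => exact le_rfl
  | cons c p ih =>
    simp only [List.mem_cons, forall_eq_or_imp] at hp
    refine add_nonneg ?_ (mul_nonneg hx (ih hp.2))
    rcases hp.1 with rfl | h
    · simp
    · exact h.toReal_pos.le

theorem evalList_pos {p : List (ℤ√29)}
    (hp : IsPos (p.headD 0) ∧ ∀ c ∈ p, c = 0 ∨ IsPos c) {x : ℝ} (hx : 0 ≤ x) :
    0 < evalList p x := by
  obtain ⟨h0, hp⟩ := hp
  cases p with
  | nil => exact absurd h0 (by decide)
  | cons c p =>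
    simp only [List.mem_cons, forall_eq_or_imp] at hp
    exact add_pos_of_pos_of_nonneg h0.toReal_pos (mul_nonneg hx (evalList_nonneg hp.2 hx))

/-! ### The isogeny of degree 29

The substitution `v = u * N (u²) / D (u²)` transforms `dv / √(v⁴ + a' v² + 2)` into
`m * du / √(u⁴ + a u² + 2)`, where `a = 396 (13√29 - 70)`, `a' = 396 (13√29 + 70)` and
`m = 377 - 70√29`. -/

/-- The numerator `N` of the isogeny. -/
def isogNum : List (ℤ√29) :=
  [⟨48256, -8960⟩,
    ⟨1834255104, -340612608⟩,
    ⟨8704517724864, -1616388362496⟩,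
    ⟨7102733772455168, -1318944549857280⟩,
    ⟨1081362607058876448, -200803995009815616⟩,
    ⟨31389455016363514944, -5828875464456978304⟩,
    ⟨174679230636154010032, -32437118805487854976⟩,
    ⟨186596617396453314432, -34650121970128354816⟩,
    ⟨38268459917430570776, -7106274605882222416⟩,
    ⟨1505931995109976912, -279644551103588640⟩,
    ⟨11340382369677796, -2105856139194000⟩,
    ⟨16163891940176, -3001559379968⟩,
    ⟨4180506310, -776300508⟩,
    ⟨167388, -31080⟩,
    ⟨1, 0⟩]

/-- The denominator `D` of the isogeny. -/
def isogDen : List (ℤ√29) :=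
  [⟨128, 0⟩,
    ⟨10712832, -1989120⟩,
    ⟨133776201920, -24841616256⟩,
    ⟨258622271042816, -48024950079488⟩,
    ⟨90723058957422368, -16846849113552000⟩,
    ⟨6023727980439907648, -1118578204414354560⟩,
    ⟨76536919834861141552, -14212549211764444832⟩,
    ⟨186596617396453314432, -34650121970128354816⟩,
    ⟨87339615318077005016, -16218559402743927488⟩,
    ⟨7847363754090878736, -1457218866114244576⟩,
    ⟨135170325882359556, -25100499376226952⟩,
    ⟨443920860778448, -82434034366080⟩,
    ⟨272016178902, -50512136328⟩,
    ⟨28660236, -5322072⟩,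
    ⟨377, -70⟩]

/-- The polynomial `B` such that the derivative of the isogeny is `B (u²) / D (u²) ^ 2`. -/
def isogDer : List (ℤ√29) :=
  addList (mulList (addList isogNum (mulList [0, 2] (derivList isogNum))) isogDen)
    (mulList [0, -2] (mulList isogNum (derivList isogDen)))

/-- The polynomial `W` such that `u * W (u²) / (√(u⁴ + a u² + 2) * B (u²))` is the exact part
of the pullback of the differential of the second kind. -/
def isogExact : List (ℤ√29) :=
  [⟨-819875369944350720, 152247034084851712⟩,
    ⟨43041805983818212442112, -7992662717916177432576⟩,
    ⟨-785567770515491602570444800, 145876272806866884773150720⟩,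
    ⟨6200286108165872509082637762560, -1151364225650338463131610251264⟩,
    ⟨-22173107379419762100902458101006336, 4117442673257436940482039151706112⟩,
    ⟨35948323831781655593408754510535983104, -6675436150840867389031039533893910528⟩,
    ⟨-26146540957574633915253599551139263299584, 4855290765276959096496134660805861343232⟩,
    ⟨8446488784258568436073705821183538089984000, -1568473591201570521432477241453146549878784⟩,
    ⟨-1203482058961126957896495854560791478389587968, 223481007928801140110046794872555955212984320⟩,
    ⟨75310496195598564934382288081051733624183128064, -13984808059323253293728933276518953894775574528⟩,
    ⟨-2064650257586170791509245878616356366015226476544, 383395927799801224106727003547770593545343729664⟩,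
    ⟨24761495992200661009179420241786728296342604541952, -4598094372041416109638600625269345106231159717888⟩,
    ⟨-129789363461147438851995867292972826243359232524288, 24101279739702072142860021509535511787174977291264⟩,
    ⟨297119069356867256401289767070815111705980432957440, -55173626063074392604580317740735534573086227058688⟩,
    ⟨-296881707966382764316599307242698217653857547630592, 55129549159398199586731056845070641804844659920896⟩,
    ⟨129398112992291788119346068900714003599194984148992, -24028626351575991982382805104857267693062964899840⟩,
    ⟨-24585077653329427000699135509923939340917277902848, 4565334308944088576366383253410484946821000710144⟩,
    ⟨2034677951908479542742023440643502904214896445440, -377830210361036376044221609087983798173305832704⟩,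
    ⟨-73294165035157439185315063353504091675755571072, 13610384762608211029978792372804490488336891392⟩,
    ⟨1148424604658160993242644775836596108073258752, -213257095332844296036706261593330931522968064⟩,
    ⟨-7824675121175878554054199024297332734870272, 1453005692752319034262897138878616122593856⟩,
    ⟨23197849804776913544261075432995845259776, -4307732564478505504128530430910947656064⟩,
    ⟨-30006096208378126606646480816288828480, 5571992182787929891476775100438291072⟩,
    ⟨17041017146216475694691851945985152, -3164437441847607710944966619786112⟩,
    ⟨-4298330427798457151023014721344, 798179922386746507199072634528⟩,
    ⟨488961522049083188859627520, -90797875192470503831182256⟩,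
    ⟨-25273454711908067464968, 4693162719630173457728⟩,
    ⟨571320996582199824, -106091645667981888⟩,
    ⟨-4564626786720, 847629914812⟩]

/-- The quartic `w² + a w + 2` in terms of `w = u²`. -/
def quarticList : List (ℤ√29) := [2, ⟨-27720, 5148⟩, 1]

theorem isogDen_pos : IsPos (isogDen.headD 0) ∧ ∀ c ∈ isogDen, c = 0 ∨ IsPos c := by
  decide +kernel

theorem isogDer_pos : IsPos (isogDer.headD 0) ∧ ∀ c ∈ isogDer, c = 0 ∨ IsPos c := by
  decide +kernel

theorem isogNum_bound :
    ∀ c ∈ addList (smulList 1000 isogNum) (smulList (-1) isogDen), c = 0 ∨ IsPos c := by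
  decide +kernel

theorem isogExact_bound :
    (∀ c ∈ addList (smulList (10 ^ 10) isogDer) isogExact, c = 0 ∨ IsPos c) ∧
    ∀ c ∈ addList (smulList (10 ^ 10) isogDer) (smulList (-1) isogExact), c = 0 ∨ IsPos c := by
  decide +kernel

theorem isog_quartic_coeff :
    ∀ c ∈ addList
      (smulList (⟨377, -70⟩ ^ 2)
        (addList (mulList [0, 0, 1] (mulList (mulList isogNum isogNum) (mulList isogNum isogNum)))
          (addList (mulList [0, ⟨27720, 5148⟩]
              (mulList (mulList isogNum isogNum) (mulList isogDen isogDen)))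
            (smulList 2 (mulList (mulList isogDen isogDen) (mulList isogDen isogDen))))))
      (smulList (-1) (mulList quarticList (mulList isogDer isogDer))), c = 0 := by
  decide +kernel

theorem isog_exact_coeff :
    ∀ c ∈ addList
      (smulList (⟨377, -70⟩ ^ 3) (mulList (mulList isogDen isogDen) (mulList isogDen isogDen)))
      (smulList (-1)
        (addList
          (mulList (addList [⟨144850487977, -26898060350⟩]
            (smulList ⟨-6054190520, 1124234956⟩ quarticList)) (mulList isogDer isogDer))
          (addList
            (mulList (addList isogExact (mulList [0, 2] (derivList isogExact)))
              (mulList quarticList isogDer))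
            (addList
              (mulList [0, ⟨27720, -5148⟩, -2] (mulList isogExact isogDer))
              (mulList [0, -2] (mulList isogExact (mulList quarticList (derivList isogDer)))))))),
      c = 0 := by
  decide +kernel

theorem evalList_quarticList (x : ℝ) :
    evalList quarticList x = x ^ 2 + 396 * (13 * √29 - 70) * x + 2 := by
  simp only [quarticList, evalList, toReal_apply, Zsqrtd.re_ofNat, Zsqrtd.im_ofNat, Zsqrtd.re_one,
    Zsqrtd.im_one]
  push_cast
  ring

theorem isog_quartic (x : ℝ) :
    (377 - 70 * √29) ^ 2 * (x ^ 2 * evalList isogNum x ^ 4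
      + 396 * (13 * √29 + 70) * x * evalList isogNum x ^ 2 * evalList isogDen x ^ 2
      + 2 * evalList isogDen x ^ 4)
    = (x ^ 2 + 396 * (13 * √29 - 70) * x + 2) * evalList isogDer x ^ 2 := by
  have h := evalList_eq_of_sub isog_quartic_coeff x
  simp only [evalList_addList, evalList_smulList, evalList_mulList, evalList_quarticList] at h
  simp only [evalList, map_pow, toReal_apply, Zsqrtd.re_ofNat, Zsqrtd.im_ofNat, Zsqrtd.re_one,
    Zsqrtd.im_one, Zsqrtd.re_zero, Zsqrtd.im_zero] at h
  push_cast at h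
  linear_combination h

theorem evalList_isogDer (x : ℝ) :
    evalList isogDer x =
      (evalList isogNum x + 2 * x * evalList (derivList isogNum) x) * evalList isogDen x
        - 2 * x * evalList isogNum x * evalList (derivList isogDen) x := by
  rw [isogDer]
  simp only [evalList_addList, evalList_mulList]
  simp only [evalList, toReal_apply, Zsqrtd.re_ofNat, Zsqrtd.im_ofNat, Zsqrtd.re_neg,
    Zsqrtd.im_neg, Zsqrtd.re_zero, Zsqrtd.im_zero]
  push_cast
  ring

theorem isog_exact (x : ℝ) :
    (377 - 70 * √29) ^ 3 * evalList isogDen x ^ 4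
    = (144850487977 - 26898060350 * √29 + (1124234956 * √29 - 6054190520)
          * (x ^ 2 + 396 * (13 * √29 - 70) * x + 2)) * evalList isogDer x ^ 2
      + (evalList isogExact x + 2 * x * evalList (derivList isogExact) x)
        * (x ^ 2 + 396 * (13 * √29 - 70) * x + 2) * evalList isogDer x
      - x * (2 * x + 396 * (13 * √29 - 70)) * evalList isogExact x * evalList isogDer x
      - 2 * x * evalList isogExact x * (x ^ 2 + 396 * (13 * √29 - 70) * x + 2)
        * evalList (derivList isogDer) x := by
  have h := evalList_eq_of_sub isog_exact_coeff x
  simp only [evalList_addList, evalList_smulList, evalList_mulList, evalList_quarticList] at h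
  simp only [evalList, map_pow, toReal_apply, Zsqrtd.re_ofNat, Zsqrtd.im_ofNat, Zsqrtd.re_neg,
    Zsqrtd.im_neg, Zsqrtd.re_zero, Zsqrtd.im_zero] at h
  push_cast at h
  linear_combination h

theorem mem_sqrt_twentynine : √29 ∈ Ioo (5.385164 : ℝ) 5.385165 := by
  constructor
  · exact Real.lt_sqrt_of_sq_lt (by norm_num)
  · exact (Real.sqrt_lt' (by norm_num)).2 (by norm_num)

theorem isogDen_eval_pos (u : ℝ) : 0 < evalList isogDen (u ^ 2) :=
  evalList_pos isogDen_pos (sq_nonneg u)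

theorem isogDer_eval_pos (u : ℝ) : 0 < evalList isogDer (u ^ 2) :=
  evalList_pos isogDer_pos (sq_nonneg u)

/-- The isogeny of degree 29 as a map of the real line. -/
noncomputable def isogMap (u : ℝ) : ℝ :=
  u * evalList isogNum (u ^ 2) / evalList isogDen (u ^ 2)

theorem hasDerivAt_isogMap (u : ℝ) :
    HasDerivAt isogMap (evalList isogDer (u ^ 2) / evalList isogDen (u ^ 2) ^ 2) u := by
  have hsq : HasDerivAt (fun u : ℝ => u ^ 2) (2 * u) u := by simpa using hasDerivAt_pow 2 u
  have hN := (hasDerivAt_evalList isogNum (u ^ 2)).comp u hsq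
  have hD := (hasDerivAt_evalList isogDen (u ^ 2)).comp u hsq
  have h := ((hasDerivAt_id u).mul hN).div hD (isogDen_eval_pos u).ne'
  refine h.congr_deriv ?_
  simp only [id, Function.comp, Pi.mul_apply]
  rw [evalList_isogDer]
  ring

theorem continuous_isogMap : Continuous isogMap :=
  continuous_iff_continuousAt.2 fun u => (hasDerivAt_isogMap u).continuousAt

theorem isogMap_zero : isogMap 0 = 0 := by simp [isogMap]

theorem tendsto_isogMap_atTop : Tendsto isogMap atTop atTop := by
  refine tendsto_atTop_mono' atTop ?_ (tendsto_id.atTop_div_const (r := (1000 : ℝ)) (by norm_num))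
  filter_upwards [eventually_ge_atTop 0] with u hu
  have hD := isogDen_eval_pos u
  have h := evalList_nonneg isogNum_bound (sq_nonneg u)
  simp only [evalList_addList, evalList_smulList, map_neg, map_one, map_ofNat] at h
  rw [isogMap, id, mul_div_assoc, div_eq_mul_one_div]
  refine mul_le_mul_of_nonneg_left ?_ hu
  rw [div_le_div_iff₀ (by norm_num) hD]
  linarith

/-- The quartic `u⁴ + a u² + 2`. -/
def quartic (a u : ℝ) : ℝ := u ^ 4 + a * u ^ 2 + 2

theorem quartic_pos {a : ℝ} (ha : 2 ≤ a) (u : ℝ) : 0 < quartic a u := by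
  unfold quartic; positivity

theorem one_add_sq_le_sqrt_quartic {a : ℝ} (ha : 2 ≤ a) (u : ℝ) : 1 + u ^ 2 ≤ √(quartic a u) := by
  refine Real.le_sqrt_of_sq_le ?_
  unfold quartic
  nlinarith [mul_nonneg (sub_nonneg.2 ha) (sq_nonneg u)]

theorem continuous_quartic (a : ℝ) : Continuous (quartic a) := by
  unfold quartic; fun_prop

/-- The complete elliptic integral of the first kind `∫ du / √(u⁴ + a u² + 2)` over `(0, ∞)`. -/
noncomputable def firstKind (a : ℝ) : ℝ := ∫ u in Ioi 0, (√(quartic a u))⁻¹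

/-- The complete elliptic integral `∫ du / (u⁴ + a u² + 2) ^ (3 / 2)` over `(0, ∞)`. -/
noncomputable def secondKind (a : ℝ) : ℝ := ∫ u in Ioi 0, (√(quartic a u))⁻¹ ^ 3

theorem continuous_inv_sqrt_quartic {a : ℝ} (ha : 2 ≤ a) :
    Continuous fun u => (√(quartic a u))⁻¹ :=
  (Real.continuous_sqrt.comp (continuous_quartic a)).inv₀
    fun u => (Real.sqrt_pos.2 (quartic_pos ha u)).ne'

theorem integrable_firstKind {a : ℝ} (ha : 2 ≤ a) : Integrable fun u => (√(quartic a u))⁻¹ := by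
  refine integrable_inv_one_add_sq.mono' (continuous_inv_sqrt_quartic ha).aestronglyMeasurable ?_
  filter_upwards with u
  rw [Real.norm_of_nonneg (by positivity)]
  exact inv_anti₀ (by positivity) (one_add_sq_le_sqrt_quartic ha u)

theorem integrable_secondKind {a : ℝ} (ha : 2 ≤ a) :
    Integrable fun u => (√(quartic a u))⁻¹ ^ 3 := by
  refine (integrable_firstKind ha).mono'
    ((continuous_inv_sqrt_quartic ha).pow 3).aestronglyMeasurable ?_
  filter_upwards with u
  have h1 : 1 ≤ √(quartic a u) :=
    le_trans (by nlinarith [sq_nonneg u]) (one_add_sq_le_sqrt_quartic ha u)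
  rw [Real.norm_of_nonneg (by positivity)]
  exact pow_le_of_le_one (by positivity) (inv_le_one_of_one_le₀ h1) (by norm_num)

theorem two_le_quartic_source : (2 : ℝ) ≤ 396 * (13 * √29 - 70) := by
  linarith [mem_sqrt_twentynine.1]

theorem two_le_quartic_target : (2 : ℝ) ≤ 396 * (13 * √29 + 70) := by
  linarith [mem_sqrt_twentynine.1]

theorem multiplier_pos : 0 < 377 - 70 * √29 := by
  linarith [mem_sqrt_twentynine.2]

theorem sqrt_quartic_isogMap (u : ℝ) :
    (377 - 70 * √29) * √(quartic (396 * (13 * √29 + 70)) (isogMap u)) =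
      √(quartic (396 * (13 * √29 - 70)) u)
        * (evalList isogDer (u ^ 2) / evalList isogDen (u ^ 2) ^ 2) := by
  have hD := isogDen_eval_pos u
  have hB := isogDer_eval_pos u
  have hm := multiplier_pos
  refine (pow_left_inj₀ (by positivity) (by positivity) two_ne_zero).1 ?_
  rw [mul_pow, mul_pow, Real.sq_sqrt (quartic_pos two_le_quartic_target _).le,
    Real.sq_sqrt (quartic_pos two_le_quartic_source _).le]
  have h := isog_quartic (u ^ 2)
  unfold quartic isogMap
  field_simp
  linear_combination h

theorem inv_sqrt_quartic_isogMap (u : ℝ) :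
    (√(quartic (396 * (13 * √29 + 70)) (isogMap u)))⁻¹
        * (evalList isogDer (u ^ 2) / evalList isogDen (u ^ 2) ^ 2) =
      (377 - 70 * √29) * (√(quartic (396 * (13 * √29 - 70)) u))⁻¹ := by
  have h := sqrt_quartic_isogMap u
  have h1 := Real.sqrt_pos.2 (quartic_pos two_le_quartic_target (isogMap u))
  have h2 := Real.sqrt_pos.2 (quartic_pos two_le_quartic_source u)
  rw [inv_mul_eq_div, ← div_eq_mul_inv, div_eq_div_iff h1.ne' h2.ne', mul_comm, ← h]

theorem firstKind_isog :
    firstKind (396 * (13 * √29 + 70)) = (377 - 70 * √29) * firstKind (396 * (13 * √29 - 70)) := by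
  have h := integral_comp_mul_deriv_Ioi (f := isogMap)
    (f' := fun u => evalList isogDer (u ^ 2) / evalList isogDen (u ^ 2) ^ 2)
    (g := fun v => (√(quartic (396 * (13 * √29 + 70)) v))⁻¹) (a := 0)
    continuous_isogMap.continuousOn tendsto_isogMap_atTop
    (fun u _ => (hasDerivAt_isogMap u).hasDerivWithinAt)
    (continuous_inv_sqrt_quartic two_le_quartic_target).continuousOn
    (integrable_firstKind two_le_quartic_target).integrableOn
    (by
      simp only [Function.comp, inv_sqrt_quartic_isogMap]
      exact ((integrable_firstKind two_le_quartic_source).const_mul _).integrableOn)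
  rw [isogMap_zero] at h
  simp only [Function.comp, inv_sqrt_quartic_isogMap] at h
  rw [firstKind, ← h, integral_const_mul, firstKind]

/-- The exact part of the pullback of the differential of the second kind. -/
noncomputable def isogPrimitive (u : ℝ) : ℝ :=
  u * evalList isogExact (u ^ 2)
    / (√(quartic (396 * (13 * √29 - 70)) u) * evalList isogDer (u ^ 2))

theorem inv_sqrt_quartic_isogMap_pow_three (u : ℝ) :
    (√(quartic (396 * (13 * √29 + 70)) (isogMap u)))⁻¹ ^ 3
        * (evalList isogDer (u ^ 2) / evalList isogDen (u ^ 2) ^ 2) =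
      (377 - 70 * √29) ^ 3 * evalList isogDen (u ^ 2) ^ 4
        / (√(quartic (396 * (13 * √29 - 70)) u) ^ 3 * evalList isogDer (u ^ 2) ^ 2) := by
  have h := inv_sqrt_quartic_isogMap u
  have h2 := Real.sqrt_pos.2 (quartic_pos two_le_quartic_source u)
  have hD := isogDen_eval_pos u
  have hB := isogDer_eval_pos u
  rw [← eq_div_iff (by positivity)] at h
  rw [h]
  field_simp

theorem hasDerivAt_isogPrimitive (u : ℝ) :
    HasDerivAt isogPrimitive
      ((√(quartic (396 * (13 * √29 + 70)) (isogMap u)))⁻¹ ^ 3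
          * (evalList isogDer (u ^ 2) / evalList isogDen (u ^ 2) ^ 2)
        - ((144850487977 - 26898060350 * √29) * (√(quartic (396 * (13 * √29 - 70)) u))⁻¹ ^ 3
          + (1124234956 * √29 - 6054190520) * (√(quartic (396 * (13 * √29 - 70)) u))⁻¹)) u := by
  rw [inv_sqrt_quartic_isogMap_pow_three, isog_exact]
  have hsq : HasDerivAt (fun u : ℝ => u ^ 2) (2 * u) u := by simpa using hasDerivAt_pow 2 u
  have hq0 := quartic_pos two_le_quartic_source u
  have hr0 := Real.sqrt_pos.2 hq0
  have hB0 := isogDer_eval_pos u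
  have hq : HasDerivAt (quartic (396 * (13 * √29 - 70)))
      (4 * u ^ 3 + 396 * (13 * √29 - 70) * (2 * u)) u := by
    unfold quartic
    simpa using ((hasDerivAt_pow 4 u).add (hsq.const_mul (396 * (13 * √29 - 70)))).add_const 2
  have hr := hq.sqrt hq0.ne'
  have hW := (hasDerivAt_evalList isogExact (u ^ 2)).comp u hsq
  have hB := (hasDerivAt_evalList isogDer (u ^ 2)).comp u hsq
  have h := ((hasDerivAt_id u).mul hW).div (hr.mul hB) (mul_pos hr0 hB0).ne'
  refine h.congr_deriv ?_
  simp only [id, Function.comp, Pi.mul_apply]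
  have hrr := Real.sq_sqrt hq0.le
  have hx : (u ^ 2) ^ 2 + 396 * (13 * √29 - 70) * u ^ 2 + 2 =
      √(quartic (396 * (13 * √29 - 70)) u) ^ 2 := by rw [hrr, quartic]; ring
  rw [hx]
  generalize √(quartic (396 * (13 * √29 - 70)) u) = r at *
  generalize evalList isogDer (u ^ 2) = B at *
  generalize evalList isogExact (u ^ 2) = W at *
  generalize 396 * (13 * √29 - 70) = a at *
  field_simp
  ring

theorem tendsto_isogPrimitive_atTop : Tendsto isogPrimitive atTop (𝓝 0) := by
  refine squeeze_zero_norm' (a := fun u : ℝ => 10 ^ 10 * u⁻¹) ?_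
    (by simpa using tendsto_inv_atTop_zero.const_mul (10 ^ 10 : ℝ))
  filter_upwards [eventually_gt_atTop 0] with u hu
  have hB := isogDer_eval_pos u
  have h1 := evalList_nonneg isogExact_bound.1 (sq_nonneg u)
  have h2 := evalList_nonneg isogExact_bound.2 (sq_nonneg u)
  simp only [evalList_addList, evalList_smulList, map_neg, map_one, map_pow, map_ofNat] at h1 h2
  have hW : |evalList isogExact (u ^ 2)| ≤ 10 ^ 10 * evalList isogDer (u ^ 2) :=
    abs_le.2 ⟨by linarith, by linarith⟩
  have hr : u ^ 2 ≤ √(quartic (396 * (13 * √29 - 70)) u) := by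
    linarith [one_add_sq_le_sqrt_quartic two_le_quartic_source u]
  have hr0 : 0 < √(quartic (396 * (13 * √29 - 70)) u) := lt_of_lt_of_le (by positivity) hr
  rw [isogPrimitive, Real.norm_eq_abs, abs_div, abs_mul, abs_of_pos hu,
    abs_of_pos (mul_pos hr0 hB)]
  calc u * |evalList isogExact (u ^ 2)| / (√(quartic (396 * (13 * √29 - 70)) u)
        * evalList isogDer (u ^ 2))
      ≤ u * (10 ^ 10 * evalList isogDer (u ^ 2)) / (u ^ 2 * evalList isogDer (u ^ 2)) := by
        gcongr
    _ = 10 ^ 10 * u⁻¹ := by field_simp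

theorem secondKind_isog :
    secondKind (396 * (13 * √29 + 70)) =
      (144850487977 - 26898060350 * √29) * secondKind (396 * (13 * √29 - 70))
        + (1124234956 * √29 - 6054190520) * firstKind (396 * (13 * √29 - 70)) := by
  have hK := (integrable_firstKind two_le_quartic_source).integrableOn (s := Ioi 0)
  have hL := (integrable_secondKind two_le_quartic_source).integrableOn (s := Ioi 0)
  have hint : IntegrableOn (fun u => (√(quartic (396 * (13 * √29 + 70)) (isogMap u)))⁻¹ ^ 3
      * (evalList isogDer (u ^ 2) / evalList isogDen (u ^ 2) ^ 2)) (Ici 0) := by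
    refine ((integrable_firstKind two_le_quartic_source).const_mul
      (377 - 70 * √29)).integrableOn.mono' ?_ ?_
    · refine Continuous.aestronglyMeasurable ?_
      refine (((continuous_inv_sqrt_quartic two_le_quartic_target).comp
        continuous_isogMap).pow 3).mul ?_
      have hc (p : List (ℤ√29)) : Continuous fun u : ℝ => evalList p (u ^ 2) :=
        (continuous_iff_continuousAt.2 fun x => (hasDerivAt_evalList p x).continuousAt).comp
          (continuous_pow 2)
      exact (hc _).div ((hc _).pow 2) fun u => (pow_pos (isogDen_eval_pos u) 2).ne'
    · filter_upwards with u
      have hD := isogDen_eval_pos u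
      have hB := isogDer_eval_pos u
      rw [Real.norm_of_nonneg (by positivity), ← inv_sqrt_quartic_isogMap]
      have h1 : 1 ≤ √(quartic (396 * (13 * √29 + 70)) (isogMap u)) :=
        le_trans (by nlinarith [sq_nonneg (isogMap u)])
          (one_add_sq_le_sqrt_quartic two_le_quartic_target (isogMap u))
      gcongr
      exact pow_le_of_le_one (by positivity) (inv_le_one_of_one_le₀ h1) (by norm_num)
  have h := integral_comp_mul_deriv_Ioi (f := isogMap)
    (f' := fun u => evalList isogDer (u ^ 2) / evalList isogDen (u ^ 2) ^ 2)
    (g := fun v => (√(quartic (396 * (13 * √29 + 70)) v))⁻¹ ^ 3) (a := 0)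
    continuous_isogMap.continuousOn tendsto_isogMap_atTop
    (fun u _ => (hasDerivAt_isogMap u).hasDerivWithinAt)
    ((continuous_inv_sqrt_quartic two_le_quartic_target).pow 3).continuousOn
    (integrable_secondKind two_le_quartic_target).integrableOn hint
  have hint' := hint.mono_set Ioi_subset_Ici_self
  have hsum : IntegrableOn (fun u =>
      (144850487977 - 26898060350 * √29) * (√(quartic (396 * (13 * √29 - 70)) u))⁻¹ ^ 3
        + (1124234956 * √29 - 6054190520) * (√(quartic (396 * (13 * √29 - 70)) u))⁻¹) (Ioi 0) :=
    (hL.const_mul _).add (hK.const_mul _)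
  have hR := integral_Ioi_of_hasDerivAt_of_tendsto' (a := 0)
    (fun u _ => hasDerivAt_isogPrimitive u)
    (hint'.sub hsum) tendsto_isogPrimitive_atTop
  rw [integral_sub hint' hsum,
    integral_add (hL.const_mul _) (hK.const_mul _), integral_const_mul, integral_const_mul] at hR
  rw [isogMap_zero] at h
  simp only [Function.comp] at h
  rw [secondKind, ← h, secondKind, firstKind]
  simp only [isogPrimitive, zero_mul, zero_div, sub_zero] at hR
  linarith

/-! ### Power series with bounded coefficients and their Euler derivatives -/

/-- The sum `∑ nᵏ cₙ xⁿ`, the `k`-th iterate of the Euler operator `x d/dx` on `∑ cₙ xⁿ`. -/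
noncomputable def eulerSum (c : ℕ → ℝ) (k : ℕ) (x : ℝ) : ℝ := ∑' n : ℕ, (n : ℝ) ^ k * c n * x ^ n

theorem summable_eulerSum {c : ℕ → ℝ} (hc : ∀ n, |c n| ≤ 1) (k : ℕ) {x : ℝ} (hx : |x| < 1) :
    Summable fun n : ℕ => (n : ℝ) ^ k * c n * x ^ n := by
  refine Summable.of_norm_bounded (g := fun n : ℕ => (n : ℝ) ^ k * |x| ^ n)
    (summable_pow_mul_geometric_of_norm_lt_one k (by simpa using hx)) fun n => ?_
  rw [norm_mul, norm_mul, norm_pow, norm_pow, Real.norm_natCast, Real.norm_eq_abs, Real.norm_eq_abs]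
  gcongr
  exact mul_le_of_le_one_right (by positivity) (hc n)

theorem hasDerivAt_eulerSum_tsum {c : ℕ → ℝ} (hc : ∀ n, |c n| ≤ 1) (k : ℕ) {x : ℝ}
    (hx : |x| < 1) :
    HasDerivAt (eulerSum c k) (∑' n : ℕ, (n : ℝ) ^ k * c n * (n * x ^ (n - 1))) x := by
  obtain ⟨r, hxr, hr1⟩ := exists_between hx
  have hr0 : 0 < r := (abs_nonneg x).trans_lt hxr
  have hr : ‖r‖ < 1 := by rwa [Real.norm_of_nonneg hr0.le]
  have hu : Summable fun n : ℕ => (n : ℝ) ^ (k + 1) * r ^ n * r⁻¹ :=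
    Summable.mul_right r⁻¹ (summable_pow_mul_geometric_of_norm_lt_one (R := ℝ) (k + 1) hr)
  have hbound : ∀ (n : ℕ) (y : ℝ), y ∈ Metric.ball (0 : ℝ) r →
      ‖(n : ℝ) ^ k * c n * (n * y ^ (n - 1))‖ ≤ (n : ℝ) ^ (k + 1) * r ^ n * r⁻¹ := by
    intro n y hy
    rw [mem_ball_zero_iff, Real.norm_eq_abs] at hy
    rcases n with _ | n
    · simp
    rw [norm_mul, norm_mul, norm_mul, norm_pow, norm_pow, Real.norm_natCast, Real.norm_eq_abs,
      Real.norm_eq_abs, Nat.add_sub_cancel]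
    calc ((n + 1 : ℕ) : ℝ) ^ k * |c (n + 1)| * (((n + 1 : ℕ) : ℝ) * |y| ^ n)
        ≤ ((n + 1 : ℕ) : ℝ) ^ k * 1 * (((n + 1 : ℕ) : ℝ) * r ^ n) := by
          gcongr
          exact hc _
      _ = _ := by
          field_simp
          ring
  have hderiv : ∀ (n : ℕ) (y : ℝ), y ∈ Metric.ball (0 : ℝ) r →
      HasDerivAt (fun y : ℝ => (n : ℝ) ^ k * c n * y ^ n)
        ((n : ℝ) ^ k * c n * (n * y ^ (n - 1))) y :=
    fun n y _ => (hasDerivAt_pow n y).const_mul _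
  have h0 : Summable fun n : ℕ => (n : ℝ) ^ k * c n * (0 : ℝ) ^ n :=
    summable_eulerSum hc k (by simp)
  have hxm : x ∈ Metric.ball (0 : ℝ) r := by simpa using hxr
  have h0m : (0 : ℝ) ∈ Metric.ball (0 : ℝ) r := by simpa using hr0
  exact hasDerivAt_tsum_of_isPreconnected hu Metric.isOpen_ball
    (convex_ball 0 r).isPreconnected hderiv hbound h0m h0 hxm

theorem continuousAt_eulerSum {c : ℕ → ℝ} (hc : ∀ n, |c n| ≤ 1) (k : ℕ) {x : ℝ} (hx : |x| < 1) :
    ContinuousAt (eulerSum c k) x :=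
  (hasDerivAt_eulerSum_tsum hc k hx).continuousAt

theorem hasDerivAt_eulerSum {c : ℕ → ℝ} (hc : ∀ n, |c n| ≤ 1) (k : ℕ) {x : ℝ} (hx0 : x ≠ 0)
    (hx : |x| < 1) : HasDerivAt (eulerSum c k) (eulerSum c (k + 1) x / x) x := by
  refine (hasDerivAt_eulerSum_tsum hc k hx).congr_deriv ?_
  rw [eulerSum, ← tsum_div_const]
  refine tsum_congr fun n => ?_
  rcases n with _ | n
  · simp
  · rw [Nat.add_sub_cancel]
    field_simp
    ring

theorem eulerSum_zero (c : ℕ → ℝ) : eulerSum c 0 0 = c 0 := by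
  rw [eulerSum, tsum_eq_single 0 fun n hn => by simp [hn]]
  simp

theorem eulerSum_succ_zero (c : ℕ → ℝ) (k : ℕ) : eulerSum c (k + 1) 0 = 0 := by
  rw [eulerSum, tsum_eq_single 0 fun n hn => by simp [hn]]
  simp

theorem eulerSum_pos {c : ℕ → ℝ} (hc : ∀ n, |c n| ≤ 1) (hc0 : ∀ n, 0 < c n) {x : ℝ}
    (hx0 : 0 ≤ x) (hx : x < 1) : 0 < eulerSum c 0 x := by
  refine (summable_eulerSum hc 0 (by rwa [abs_of_nonneg hx0])).tsum_pos
    (fun n => by have := hc0 n; positivity) 0 ?_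
  simpa using hc0 0

theorem eulerSum_succ_eq {c : ℕ → ℝ} (hc : ∀ n, |c n| ≤ 1) (k : ℕ) {x : ℝ} (hx : |x| < 1) :
    eulerSum c (k + 1) x = x * ∑' n : ℕ, ((n + 1 : ℝ) ^ (k + 1) * c (n + 1)) * x ^ n := by
  rw [eulerSum, (summable_eulerSum hc (k + 1) hx).tsum_eq_zero_add, ← tsum_mul_left]
  simp only [Nat.cast_zero, ne_eq, Nat.add_eq_zero_iff, one_ne_zero, and_false, not_false_eq_true,
    zero_pow, zero_mul, zero_add]
  refine tsum_congr fun n => ?_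
  push_cast
  ring

theorem eq_of_hasDerivAt_zero {f : ℝ → ℝ} {b : ℝ} (hb : 0 < b) (hf : ContinuousOn f (Icc 0 b))
    (hf' : ∀ x ∈ Ioo 0 b, HasDerivAt f 0 x) : f b = f 0 := by
  obtain ⟨x, hx, h⟩ := exists_hasDerivAt_eq_slope f (fun _ => 0) hb hf hf'
  rw [eq_comm, div_eq_zero_iff] at h
  rcases h with h | h <;> linarith

/-! ### The hypergeometric series involved -/

/-- The coefficients `(1/2)ₙ / n!` of `(1 - x) ^ (-1/2)`. -/
noncomputable def binomCoeff (n : ℕ) : ℝ := (ascPochhammer ℝ n).eval (1/2) / n.factorial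

/-- The coefficients `(1/4)ₙ (3/4)ₙ / n!²`. -/
noncomputable def quarterCoeff (n : ℕ) : ℝ :=
  (ascPochhammer ℝ n).eval (1/4) * (ascPochhammer ℝ n).eval (3/4) / (n.factorial : ℝ) ^ 2

/-- The coefficients `(1/2)ₙ (1/4)ₙ (3/4)ₙ / n!³`. -/
noncomputable def clausenCoeff (n : ℕ) : ℝ :=
  (ascPochhammer ℝ n).eval (1/2) * (ascPochhammer ℝ n).eval (1/4) *
    (ascPochhammer ℝ n).eval (3/4) / (n.factorial : ℝ) ^ 3

theorem binomCoeff_zero : binomCoeff 0 = 1 := by simp [binomCoeff]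

theorem quarterCoeff_zero : quarterCoeff 0 = 1 := by simp [quarterCoeff]

theorem clausenCoeff_zero : clausenCoeff 0 = 1 := by simp [clausenCoeff]

theorem binomCoeff_succ (n : ℕ) : (n + 1) * binomCoeff (n + 1) = (n + 1/2) * binomCoeff n := by
  have : (n.factorial : ℝ) ≠ 0 := by positivity
  simp only [binomCoeff, ascPochhammer_succ_eval, Nat.factorial_succ]
  push_cast
  field_simp
  ring

theorem quarterCoeff_succ (n : ℕ) :
    (n + 1) ^ 2 * quarterCoeff (n + 1) = (n + 1/4) * (n + 3/4) * quarterCoeff n := by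
  have : (n.factorial : ℝ) ≠ 0 := by positivity
  simp only [quarterCoeff, ascPochhammer_succ_eval, Nat.factorial_succ]
  push_cast
  field_simp
  ring

theorem clausenCoeff_succ (n : ℕ) :
    (n + 1) ^ 3 * clausenCoeff (n + 1) =
      (n + 1/2) * (n + 1/4) * (n + 3/4) * clausenCoeff n := by
  have : (n.factorial : ℝ) ≠ 0 := by positivity
  simp only [clausenCoeff, ascPochhammer_succ_eval, Nat.factorial_succ]
  push_cast
  field_simp
  ring

theorem binomCoeff_pos (n : ℕ) : 0 < binomCoeff n := by
  have := ascPochhammer_pos n (1/2 : ℝ) (by norm_num)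
  unfold binomCoeff; positivity

theorem quarterCoeff_pos (n : ℕ) : 0 < quarterCoeff n := by
  have h1 := ascPochhammer_pos n (1/4 : ℝ) (by norm_num)
  have h2 := ascPochhammer_pos n (3/4 : ℝ) (by norm_num)
  unfold quarterCoeff; positivity

theorem clausenCoeff_pos (n : ℕ) : 0 < clausenCoeff n := by
  have h1 := ascPochhammer_pos n (1/4 : ℝ) (by norm_num)
  have h2 := ascPochhammer_pos n (3/4 : ℝ) (by norm_num)
  have h3 := ascPochhammer_pos n (1/2 : ℝ) (by norm_num)
  unfold clausenCoeff; positivity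

theorem abs_le_one_of_ratio_le {c p q : ℕ → ℝ} (h0 : c 0 = 1) (hc : ∀ n, 0 < c n)
    (hq : ∀ n, 0 < q n) (hpq : ∀ n, p n ≤ q n) (h : ∀ n, q n * c (n + 1) = p n * c n) (n : ℕ) :
    |c n| ≤ 1 := by
  rw [abs_of_pos (hc n)]
  refine le_trans ?_ h0.le
  refine antitone_nat_of_succ_le (fun n => ?_) (Nat.zero_le n)
  refine le_of_mul_le_mul_left ?_ (hq n)
  rw [h n]
  exact mul_le_mul_of_nonneg_right (hpq n) (hc n).le

theorem abs_binomCoeff_le (n : ℕ) : |binomCoeff n| ≤ 1 :=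
  abs_le_one_of_ratio_le (p := fun n => n + 1/2) (q := fun n => n + 1) binomCoeff_zero
    binomCoeff_pos (fun n => by positivity) (fun n => by norm_num) binomCoeff_succ n

theorem abs_quarterCoeff_le (n : ℕ) : |quarterCoeff n| ≤ 1 :=
  abs_le_one_of_ratio_le (p := fun n => (n + 1/4) * (n + 3/4)) (q := fun n => (n + 1) ^ 2)
    quarterCoeff_zero quarterCoeff_pos (fun n => by positivity)
    (fun n => by nlinarith [n.cast_nonneg (α := ℝ)]) quarterCoeff_succ n

theorem abs_clausenCoeff_le (n : ℕ) : |clausenCoeff n| ≤ 1 :=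
  abs_le_one_of_ratio_le (p := fun n => (n + 1/2) * (n + 1/4) * (n + 3/4))
    (q := fun n => (n + 1) ^ 3) clausenCoeff_zero clausenCoeff_pos (fun n => by positivity)
    (fun n => by nlinarith [n.cast_nonneg (α := ℝ), sq_nonneg (n : ℝ)]) clausenCoeff_succ n

theorem eulerSum_binomCoeff {x : ℝ} (hx : |x| < 1) :
    eulerSum binomCoeff 1 x = x * (eulerSum binomCoeff 1 x + 1/2 * eulerSum binomCoeff 0 x) := by
  have hs := summable_eulerSum abs_binomCoeff_le (x := x) (hx := hx)
  conv_lhs => rw [eulerSum_succ_eq abs_binomCoeff_le 0 hx]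
  rw [eulerSum, eulerSum, ← tsum_mul_left (a := (1/2 : ℝ)),
    ← (hs 1).tsum_add ((hs 0).mul_left _)]
  congr 1
  refine tsum_congr fun n => ?_
  linear_combination x ^ n * binomCoeff_succ n

theorem eulerSum_quarterCoeff {x : ℝ} (hx : |x| < 1) :
    eulerSum quarterCoeff 2 x = x * (eulerSum quarterCoeff 2 x + eulerSum quarterCoeff 1 x
      + 3/16 * eulerSum quarterCoeff 0 x) := by
  have hs := summable_eulerSum abs_quarterCoeff_le (x := x) (hx := hx)
  conv_lhs => rw [eulerSum_succ_eq abs_quarterCoeff_le 1 hx]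
  rw [eulerSum, eulerSum, eulerSum, ← tsum_mul_left (a := (3/16 : ℝ)), ← (hs 2).tsum_add (hs 1),
    ← ((hs 2).add (hs 1)).tsum_add ((hs 0).mul_left _)]
  congr 1
  refine tsum_congr fun n => ?_
  linear_combination x ^ n * quarterCoeff_succ n

theorem eulerSum_clausenCoeff {x : ℝ} (hx : |x| < 1) :
    eulerSum clausenCoeff 3 x = x * (eulerSum clausenCoeff 3 x + 3/2 * eulerSum clausenCoeff 2 x
      + 11/16 * eulerSum clausenCoeff 1 x + 3/32 * eulerSum clausenCoeff 0 x) := by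
  have hs := summable_eulerSum abs_clausenCoeff_le (x := x) (hx := hx)
  conv_lhs => rw [eulerSum_succ_eq abs_clausenCoeff_le 2 hx]
  rw [eulerSum, eulerSum, eulerSum, eulerSum, ← tsum_mul_left (a := (3/2 : ℝ)),
    ← tsum_mul_left (a := (11/16 : ℝ)), ← tsum_mul_left (a := (3/32 : ℝ)),
    ← (hs 3).tsum_add ((hs 2).mul_left _), ← ((hs 3).add ((hs 2).mul_left _)).tsum_add
      ((hs 1).mul_left _), ← (((hs 3).add ((hs 2).mul_left _)).add ((hs 1).mul_left _)).tsum_add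
      ((hs 0).mul_left _)]
  congr 1
  refine tsum_congr fun n => ?_
  linear_combination x ^ n * clausenCoeff_succ n

/-! ### Clausen's formula -/

theorem clausen_firstIntegral {x : ℝ} (hx0 : 0 < x) (hx1 : x < 1) :
    2 * eulerSum clausenCoeff 0 x
        * ((1 - x) * eulerSum clausenCoeff 2 x - x / 2 * eulerSum clausenCoeff 1 x)
      - (1 - x) * eulerSum clausenCoeff 1 x ^ 2
      - 3/16 * x * eulerSum clausenCoeff 0 x ^ 2 = 0 := by
  have h := eq_of_hasDerivAt_zero (f := fun x => 2 * eulerSum clausenCoeff 0 x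
        * ((1 - x) * eulerSum clausenCoeff 2 x - x / 2 * eulerSum clausenCoeff 1 x)
      - (1 - x) * eulerSum clausenCoeff 1 x ^ 2
      - 3/16 * x * eulerSum clausenCoeff 0 x ^ 2) hx0 ?_ ?_
  · simpa [eulerSum_succ_zero] using h
  · intro y hy
    have hc (k) := (continuousAt_eulerSum abs_clausenCoeff_le k (x := y)
      (by rw [abs_of_nonneg hy.1]; linarith [hy.2])).continuousWithinAt (s := Icc 0 x)
    have h0 := hc 0
    have h1 := hc 1
    have h2 := hc 2
    fun_prop
  · intro y hy
    have hy1 : |y| < 1 := by rw [abs_of_pos hy.1]; linarith [hy.2]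
    have hy0 := hy.1.ne'
    have hd (k) := hasDerivAt_eulerSum abs_clausenCoeff_le k hy0 hy1
    have hode := eulerSum_clausenCoeff hy1
    have hid := hasDerivAt_id y
    have h := ((((hd 0).const_mul 2).mul (((hid.const_sub 1).mul (hd 2)).sub
      ((hid.div_const 2).mul (hd 1)))).sub ((hid.const_sub 1).mul ((hd 1).pow 2))).sub
      ((hid.const_mul (3/16)).mul ((hd 0).pow 2))
    refine h.congr_deriv ?_
    simp only [id, Pi.mul_apply, Pi.sub_apply, Pi.pow_apply, zero_add, Nat.reduceAdd]
    field_simp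
    linear_combination 32 * eulerSum clausenCoeff 0 y * hode

theorem clausen_arg_mem {z : ℝ} (hz : z ∈ Ioo (0 : ℝ) (1/2)) : 4 * z * (1 - z) ∈ Ioo (0 : ℝ) 1 := by
  obtain ⟨h0, h1⟩ := hz
  constructor <;> nlinarith

theorem hasDerivAt_clausen_arg (z : ℝ) :
    HasDerivAt (fun z : ℝ => 4 * z * (1 - z)) (4 * (1 - 2 * z)) z := by
  refine (((hasDerivAt_id z).const_mul 4).mul ((hasDerivAt_id z).const_sub 1)).congr_deriv ?_
  simp only [id]; ring

theorem hasDerivAt_eulerSum_clausen_arg (k : ℕ) {z : ℝ} (hz : z ∈ Ioo (0 : ℝ) (1/2)) :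
    HasDerivAt (fun z => eulerSum clausenCoeff k (4 * z * (1 - z)))
      (eulerSum clausenCoeff (k + 1) (4 * z * (1 - z)) * (1 - 2 * z) / (z * (1 - z))) z := by
  have hx := clausen_arg_mem hz
  have h1 : 0 < 1 - z := by linarith [hz.2]
  have h := (hasDerivAt_eulerSum abs_clausenCoeff_le k hx.1.ne'
    (by rw [abs_of_pos hx.1]; exact hx.2)).comp z (hasDerivAt_clausen_arg z)
  refine h.congr_deriv ?_
  have := hz.1
  field_simp

theorem continuousOn_eulerSum_clausen_arg (k : ℕ) {z : ℝ} (hz : z ∈ Ioo (0 : ℝ) (1/2)) :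
    ContinuousOn (fun z => eulerSum clausenCoeff k (4 * z * (1 - z))) (Icc 0 z) := by
  intro y hy
  refine ContinuousAt.continuousWithinAt ?_
  refine ContinuousAt.comp (f := fun z : ℝ => 4 * z * (1 - z)) (continuousAt_eulerSum
    abs_clausenCoeff_le k ?_) (by fun_prop)
  obtain ⟨h0, h1⟩ := hy
  rw [abs_of_nonneg (by have := hz.2; nlinarith)]
  have := hz.2
  nlinarith

theorem continuousOn_eulerSum_quarterCoeff (k : ℕ) {z : ℝ} (hz : z < 1) :
    ContinuousOn (eulerSum quarterCoeff k) (Icc 0 z) := fun y hy =>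
  (continuousAt_eulerSum abs_quarterCoeff_le k
    (by rw [abs_of_nonneg hy.1]; linarith [hy.2])).continuousWithinAt

theorem clausen_wronskian {z : ℝ} (hz : z ∈ Ioo (0 : ℝ) (1/2)) :
    eulerSum quarterCoeff 0 z * ((1 - 2 * z) * eulerSum clausenCoeff 1 (4 * z * (1 - z)))
      = 2 * eulerSum clausenCoeff 0 (4 * z * (1 - z))
        * ((1 - z) * eulerSum quarterCoeff 1 z) := by
  have hg {y : ℝ} (hy : y ∈ Ico (0 : ℝ) (1/2)) :
      0 < eulerSum clausenCoeff 0 (4 * y * (1 - y)) := by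
    obtain ⟨h0, h1⟩ := hy
    exact eulerSum_pos abs_clausenCoeff_le clausenCoeff_pos (by nlinarith) (by nlinarith)
  have h := eq_of_hasDerivAt_zero (f := fun z =>
    (eulerSum quarterCoeff 0 z * ((1 - 2 * z) * eulerSum clausenCoeff 1 (4 * z * (1 - z)))
      - 2 * eulerSum clausenCoeff 0 (4 * z * (1 - z)) * ((1 - z) * eulerSum quarterCoeff 1 z)) ^ 2
      / eulerSum clausenCoeff 0 (4 * z * (1 - z))) hz.1 ?_ ?_
  · simp only [mul_zero, zero_mul, eulerSum_succ_zero, sub_zero, ne_eq, OfNat.ofNat_ne_zero,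
      not_false_eq_true, zero_pow, zero_div] at h
    rw [div_eq_zero_iff, or_iff_left (hg ⟨hz.1.le, hz.2⟩).ne', pow_eq_zero_iff two_ne_zero] at h
    linarith
  · have c0 := continuousOn_eulerSum_clausen_arg 0 hz
    have c1 := continuousOn_eulerSum_clausen_arg 1 hz
    have f0 := continuousOn_eulerSum_quarterCoeff 0 (z := z) (by linarith [hz.2])
    have f1 := continuousOn_eulerSum_quarterCoeff 1 (z := z) (by linarith [hz.2])
    refine ContinuousOn.div (by fun_prop) c0 fun y hy => (hg ⟨hy.1, by linarith [hy.2, hz.2]⟩).ne'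
  · intro y hy
    have hy' : y ∈ Ioo (0 : ℝ) (1/2) := ⟨hy.1, hy.2.trans hz.2⟩
    have hx := clausen_arg_mem hy'
    have hJ := clausen_firstIntegral hx.1 hx.2
    have hg0 := hg ⟨hy'.1.le, hy'.2⟩
    have habs : |y| < 1 := by rw [abs_of_pos hy.1]; linarith [hy'.2]
    have hode := eulerSum_quarterCoeff habs
    have hy0 := hy.1.ne'
    have hy1 : 1 - y ≠ 0 := by linarith [hy'.2]
    have hG (k) := hasDerivAt_eulerSum_clausen_arg k hy'
    have hF (k) := hasDerivAt_eulerSum abs_quarterCoeff_le k hy0 habs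
    have hid := hasDerivAt_id y
    have h := ((((hF 0).mul (((hid.const_mul 2).const_sub 1).mul (hG 1))).sub
      (((hG 0).const_mul 2).mul ((hid.const_sub 1).mul (hF 1)))).pow 2).div (hG 0) hg0.ne'
    refine h.congr_deriv ?_
    simp only [id, Pi.mul_apply, Pi.sub_apply, Pi.pow_apply, zero_add, Nat.reduceAdd]
    generalize eulerSum clausenCoeff 0 (4 * y * (1 - y)) = g0 at *
    generalize eulerSum clausenCoeff 1 (4 * y * (1 - y)) = g1 at *
    generalize eulerSum clausenCoeff 2 (4 * y * (1 - y)) = g2 at *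
    generalize eulerSum quarterCoeff 0 y = f0 at *
    generalize eulerSum quarterCoeff 1 y = f1 at *
    generalize eulerSum quarterCoeff 2 y = f2 at *
    have hg := hg0.ne'
    set U := f0 * ((1 - 2 * y) * g1) - 2 * g0 * ((1 - y) * f1) with hU
    have key : (f0 * (2 * g0 * ((1 - 4 * y * (1 - y)) * g2 - 4 * y * (1 - y) / 2 * g1)
        - (1 - 4 * y * (1 - y)) * g1 ^ 2 - 3/16 * (4 * y * (1 - y)) * g0 ^ 2)
        - 4 * g0 ^ 2 * (1 - y) * (f2 - y * (f2 + f1 + 3/16 * f0))) = 0 := by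
      rw [hJ]; linear_combination -4 * g0 ^ 2 * (1 - y) * hode
    trans U * 0 / (y * (1 - y) * g0 ^ 2)
    · rw [← key, hU]
      field_simp
      ring
    · simp

theorem clausen {z : ℝ} (hz : z ∈ Ioo (0 : ℝ) (1/2)) :
    eulerSum clausenCoeff 0 (4 * z * (1 - z)) = eulerSum quarterCoeff 0 z ^ 2 := by
  have hf {y : ℝ} (hy : y ∈ Ico (0 : ℝ) (1/2)) : 0 < eulerSum quarterCoeff 0 y :=
    eulerSum_pos abs_quarterCoeff_le quarterCoeff_pos hy.1 (by linarith [hy.2])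
  have h := eq_of_hasDerivAt_zero (f := fun z =>
    eulerSum clausenCoeff 0 (4 * z * (1 - z)) / eulerSum quarterCoeff 0 z ^ 2) hz.1 ?_ ?_
  · simp only [mul_zero, zero_mul, eulerSum_zero, clausenCoeff_zero, quarterCoeff_zero, one_pow,
      div_one] at h
    rwa [div_eq_one_iff_eq (pow_pos (hf ⟨hz.1.le, hz.2⟩) 2).ne'] at h
  · exact (continuousOn_eulerSum_clausen_arg 0 hz).div
      ((continuousOn_eulerSum_quarterCoeff 0 (by linarith [hz.2])).pow 2)
      fun y hy => (pow_pos (hf ⟨hy.1, by linarith [hy.2, hz.2]⟩) 2).ne'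
  · intro y hy
    have hy' : y ∈ Ioo (0 : ℝ) (1/2) := ⟨hy.1, hy.2.trans hz.2⟩
    have hf0 := hf ⟨hy'.1.le, hy'.2⟩
    have hw := clausen_wronskian hy'
    have hy0 := hy.1.ne'
    have hy1 : 1 - y ≠ 0 := by linarith [hy'.2]
    have h := (hasDerivAt_eulerSum_clausen_arg 0 hy').div ((hasDerivAt_eulerSum
      abs_quarterCoeff_le 0 hy0 (by rw [abs_of_pos hy.1]; linarith [hy'.2])).pow 2)
      (pow_pos hf0 2).ne'
    refine h.congr_deriv ?_
    simp only [Pi.pow_apply, zero_add]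
    field_simp
    linear_combination eulerSum quarterCoeff 0 y * hw

theorem clausen_deriv {z : ℝ} (hz : z ∈ Ioo (0 : ℝ) (1/2)) :
    (1 - 2 * z) * eulerSum clausenCoeff 1 (4 * z * (1 - z))
      = 2 * eulerSum quarterCoeff 0 z * ((1 - z) * eulerSum quarterCoeff 1 z) := by
  have hf : 0 < eulerSum quarterCoeff 0 z :=
    eulerSum_pos abs_quarterCoeff_le quarterCoeff_pos hz.1.le (by linarith [hz.2])
  have h := clausen_wronskian hz
  rw [clausen hz] at h
  refine mul_left_cancel₀ hf.ne' ?_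
  rw [h]; ring

/-! ### Complete elliptic integrals as hypergeometric series -/

theorem sq_eulerSum_binomCoeff_mul {x : ℝ} (hx0 : 0 ≤ x) (hx1 : x < 1) :
    eulerSum binomCoeff 0 x ^ 2 * (1 - x) = 1 := by
  rcases hx0.eq_or_lt with rfl | hx0
  · simp [eulerSum_zero, binomCoeff_zero]
  have h := eq_of_hasDerivAt_zero (f := fun x => eulerSum binomCoeff 0 x ^ 2 * (1 - x)) hx0 ?_ ?_
  · simpa [eulerSum_zero, binomCoeff_zero] using h
  · intro y hy
    have hc := (continuousAt_eulerSum abs_binomCoeff_le 0 (x := y)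
      (by rw [abs_of_nonneg hy.1]; linarith [hy.2])).continuousWithinAt (s := Icc 0 x)
    fun_prop
  · intro y hy
    have hy0 := hy.1.ne'
    have hy1 : |y| < 1 := by rw [abs_of_pos hy.1]; linarith [hy.2]
    have h := ((hasDerivAt_eulerSum abs_binomCoeff_le 0 hy0 hy1).pow 2).mul
      ((hasDerivAt_id y).const_sub 1)
    refine h.congr_deriv ?_
    have hode := eulerSum_binomCoeff hy1
    simp only [id, Pi.pow_apply, zero_add]
    field_simp
    linear_combination 2 * eulerSum binomCoeff 0 y * hode

theorem eulerSum_binomCoeff_zero_eq {x : ℝ} (hx0 : 0 ≤ x) (hx1 : x < 1) :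
    eulerSum binomCoeff 0 x = (√(1 - x))⁻¹ := by
  have hpos := eulerSum_pos abs_binomCoeff_le binomCoeff_pos hx0 hx1
  have h1 : 0 < 1 - x := by linarith
  refine (pow_left_inj₀ hpos.le (by positivity) two_ne_zero).1 ?_
  rw [inv_pow, Real.sq_sqrt h1.le]
  exact eq_inv_of_mul_eq_one_left (sq_eulerSum_binomCoeff_mul hx0 hx1)

theorem eulerSum_binomCoeff_one_eq {x : ℝ} (hx0 : 0 ≤ x) (hx1 : x < 1) :
    eulerSum binomCoeff 1 x = x / 2 * (√(1 - x))⁻¹ ^ 3 := by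
  have h1 : 0 < 1 - x := by linarith
  have hode := eulerSum_binomCoeff (x := x) (by rwa [abs_of_nonneg hx0])
  rw [eulerSum_binomCoeff_zero_eq hx0 hx1] at hode
  have hs := Real.sq_sqrt h1.le
  have hp := Real.sqrt_pos.2 h1
  generalize √(1 - x) = r at *
  have hE : eulerSum binomCoeff 1 x * r ^ 2 = x / 2 * r⁻¹ := by
    rw [hs]; linear_combination hode
  field_simp at hE ⊢
  linear_combination hE

theorem div_sq_lt_one {b d u : ℝ} (hb : 1 ≤ b) (hd : d < b ^ 2) : d / (u ^ 2 + b) ^ 2 < 1 := by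
  rw [div_lt_one (by positivity)]
  nlinarith [sq_nonneg u, mul_nonneg (sq_nonneg u) (sq_nonneg u)]

theorem tsum_binomCoeff_mul_inv {b d : ℝ} (k : ℕ) (hb : 1 ≤ b) (u : ℝ) :
    ∑' n : ℕ, (n : ℝ) ^ k * binomCoeff n * d ^ n * ((u ^ 2 + b) ^ (2 * n + 1))⁻¹
      = (u ^ 2 + b)⁻¹ * eulerSum binomCoeff k (d / (u ^ 2 + b) ^ 2) := by
  have : 0 < u ^ 2 + b := by positivity
  rw [eulerSum, ← tsum_mul_left]
  refine tsum_congr fun n => ?_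
  rw [div_pow, pow_succ (u ^ 2 + b), pow_mul, mul_inv]
  ring

theorem sqrt_one_sub_div {b d : ℝ} (hb : 1 ≤ b) (u : ℝ) :
    √(1 - d / (u ^ 2 + b) ^ 2) = √((u ^ 2 + b) ^ 2 - d) / (u ^ 2 + b) := by
  have : 0 < u ^ 2 + b := by positivity
  rw [eq_div_iff this.ne', ← Real.sqrt_sq this.le, ← Real.sqrt_mul' _ (by positivity),
    Real.sqrt_sq this.le]
  congr 1
  field_simp

theorem tsum_binomCoeff_zero {b d : ℝ} (hb : 1 ≤ b) (hd0 : 0 ≤ d) (hd : d < b ^ 2) (u : ℝ) :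
    ∑' n : ℕ, (n : ℝ) ^ 0 * binomCoeff n * d ^ n * ((u ^ 2 + b) ^ (2 * n + 1))⁻¹
      = (√((u ^ 2 + b) ^ 2 - d))⁻¹ := by
  have : 0 < u ^ 2 + b := by positivity
  rw [tsum_binomCoeff_mul_inv 0 hb, eulerSum_binomCoeff_zero_eq (by positivity)
    (div_sq_lt_one hb hd), sqrt_one_sub_div hb]
  field_simp

theorem tsum_binomCoeff_one {b d : ℝ} (hb : 1 ≤ b) (hd0 : 0 ≤ d) (hd : d < b ^ 2) (u : ℝ) :
    ∑' n : ℕ, (n : ℝ) ^ 1 * binomCoeff n * d ^ n * ((u ^ 2 + b) ^ (2 * n + 1))⁻¹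
      = d / 2 * (√((u ^ 2 + b) ^ 2 - d))⁻¹ ^ 3 := by
  have : 0 < u ^ 2 + b := by positivity
  rw [tsum_binomCoeff_mul_inv 1 hb, eulerSum_binomCoeff_one_eq (by positivity)
    (div_sq_lt_one hb hd), sqrt_one_sub_div hb]
  field_simp

/-- The integral of `1 / (u² + b) ^ (m + 1)` over `(0, ∞)`. -/
noncomputable def wallisIntegral (b : ℝ) (m : ℕ) : ℝ := ∫ u in Ioi 0, ((u ^ 2 + b) ^ (m + 1))⁻¹

theorem integrable_inv_sq_add_pow {b : ℝ} (hb : 1 ≤ b) (m : ℕ) :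
    Integrable fun u : ℝ => ((u ^ 2 + b) ^ (m + 1))⁻¹ := by
  have hpos (u : ℝ) : 0 < (u ^ 2 + b) ^ (m + 1) := by positivity
  refine integrable_inv_one_add_sq.mono' (Continuous.aestronglyMeasurable
    (Continuous.inv₀ (by fun_prop) fun u => (hpos u).ne')) ?_
  filter_upwards with u
  rw [Real.norm_of_nonneg (inv_nonneg.2 (hpos u).le)]
  refine inv_anti₀ (by positivity) ?_
  calc 1 + u ^ 2 ≤ u ^ 2 + b := by linarith
    _ ≤ (u ^ 2 + b) ^ (m + 1) := le_self_pow₀ (by nlinarith [sq_nonneg u]) (by omega)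

theorem wallisIntegral_zero {b : ℝ} (hb : 1 ≤ b) : wallisIntegral b 0 = π / (2 * √b) := by
  have hb0 : 0 < b := by linarith
  have hs := Real.sq_sqrt hb0.le
  have hp := Real.sqrt_pos.2 hb0
  have h := integral_comp_mul_left_Ioi (fun x : ℝ => (1 + x ^ 2)⁻¹) 0 (inv_pos.2 hp)
  rw [mul_zero, integral_Ioi_inv_one_add_sq, Real.arctan_zero, inv_inv, smul_eq_mul] at h
  have hcongr : (fun u : ℝ => (1 + ((√b)⁻¹ * u) ^ 2)⁻¹)
      = fun u => b * ((u ^ 2 + b) ^ (0 + 1))⁻¹ := by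
    ext u
    have : 0 < u ^ 2 + b := by positivity
    rw [mul_pow, inv_pow, hs]
    field_simp
    ring
  rw [hcongr, integral_const_mul] at h
  rw [wallisIntegral, eq_div_iff (by positivity)]
  refine mul_left_cancel₀ hb0.ne' ?_
  linear_combination 2 * √b * h + π * hs

theorem wallisIntegral_succ {b : ℝ} (hb : 1 ≤ b) (m : ℕ) :
    2 * (m + 1) * b * wallisIntegral b (m + 1) = (2 * m + 1) * wallisIntegral b m := by
  have hderiv (u : ℝ) : HasDerivAt (fun u : ℝ => u * ((u ^ 2 + b) ^ (m + 1))⁻¹)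
      (2 * (m + 1) * b * ((u ^ 2 + b) ^ (m + 1 + 1))⁻¹
        - (2 * m + 1) * ((u ^ 2 + b) ^ (m + 1))⁻¹) u := by
    have hpos : 0 < u ^ 2 + b := by positivity
    have h := (hasDerivAt_id u).mul ((((hasDerivAt_pow 2 u).add_const b).pow (m + 1)).inv
      (pow_pos hpos _).ne')
    refine h.congr_deriv ?_
    simp only [id, Pi.pow_apply, Pi.inv_apply]
    rw [Nat.add_sub_cancel]
    push_cast
    field_simp
    ring
  have hint0 := (integrable_inv_sq_add_pow hb m).integrableOn (s := Ioi 0)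
  have hint1 := (integrable_inv_sq_add_pow hb (m + 1)).integrableOn (s := Ioi 0)
  have hlim : Tendsto (fun u : ℝ => u * ((u ^ 2 + b) ^ (m + 1))⁻¹) atTop (𝓝 0) := by
    refine squeeze_zero' ?_ ?_ tendsto_inv_atTop_zero
    · filter_upwards [eventually_ge_atTop 0] with u hu
      positivity
    · filter_upwards [eventually_gt_atTop 0] with u hu
      have h1 : u ^ 2 ≤ (u ^ 2 + b) ^ (m + 1) := le_trans (by linarith)
        (le_self_pow₀ (a := u ^ 2 + b) (by nlinarith [sq_nonneg u]) (n := m + 1) (by omega))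
      calc u * ((u ^ 2 + b) ^ (m + 1))⁻¹ ≤ u * (u ^ 2)⁻¹ := by gcongr
        _ = u⁻¹ := by field_simp
  have h := integral_Ioi_of_hasDerivAt_of_tendsto' (a := 0) (fun u _ => hderiv u)
    ((hint1.const_mul _).sub (hint0.const_mul _)) hlim
  rw [integral_sub (hint1.const_mul _) (hint0.const_mul _), integral_const_mul,
    integral_const_mul] at h
  simp only [zero_mul, sub_zero] at h
  exact sub_eq_zero.1 h

theorem binomCoeff_mul_wallisIntegral {b : ℝ} (hb : 1 ≤ b) (n : ℕ) :
    binomCoeff n * wallisIntegral b (2 * n) = π / (2 * √b) * quarterCoeff n / (b ^ 2) ^ n := by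
  have hb0 : b ≠ 0 := by linarith
  induction n with
  | zero => simp [binomCoeff_zero, quarterCoeff_zero, wallisIntegral_zero hb]
  | succ n ih =>
    have h1 := wallisIntegral_succ hb (2 * n)
    have h2 := wallisIntegral_succ hb (2 * n + 1)
    have hB := binomCoeff_succ n
    have hQ := quarterCoeff_succ n
    rw [show 2 * (n + 1) = 2 * n + 1 + 1 by ring]
    push_cast at h1 h2
    have hn : (0 : ℝ) < n + 1 := by positivity
    have hn2 : (0 : ℝ) < 2 * n + 1 := by positivity
    have hB' : binomCoeff (n + 1) = (n + 1/2) * binomCoeff n / (n + 1) := by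
      rw [eq_div_iff hn.ne', ← hB]; ring
    have hQ' : quarterCoeff (n + 1) = (n + 1/4) * (n + 3/4) * quarterCoeff n / (n + 1) ^ 2 := by
      rw [eq_div_iff (by positivity), ← hQ]; ring
    have h2' : wallisIntegral b (2 * n + 1 + 1) =
        (2 * (2 * n + 1) + 1) * wallisIntegral b (2 * n + 1) / (2 * (2 * n + 1 + 1) * b) := by
      rw [eq_div_iff (by positivity), ← h2]; ring
    have h1' : wallisIntegral b (2 * n + 1) =
        (2 * (2 * n) + 1) * wallisIntegral b (2 * n) / (2 * (2 * n + 1) * b) := by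
      rw [eq_div_iff (by positivity), ← h1]; ring
    have hfac : binomCoeff (n + 1) * wallisIntegral b (2 * n + 1 + 1) =
        (n + 1/4) * (n + 3/4) / ((n + 1) ^ 2 * b ^ 2)
          * (binomCoeff n * wallisIntegral b (2 * n)) := by
      rw [hB', h2', h1']
      field_simp
      ring
    rw [hfac, ih, hQ', pow_succ]
    field_simp
    ring

theorem integral_tsum_binomCoeff {b d : ℝ} (hb : 1 ≤ b) (hd0 : 0 ≤ d) (hd : d < b ^ 2) (k : ℕ) :
    ∫ u in Ioi 0, ∑' n : ℕ, (n : ℝ) ^ k * binomCoeff n * d ^ n * ((u ^ 2 + b) ^ (2 * n + 1))⁻¹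
      = π / (2 * √b) * eulerSum quarterCoeff k (d / b ^ 2) := by
  have hval (n : ℕ) : ∫ u in Ioi 0,
      (n : ℝ) ^ k * binomCoeff n * d ^ n * ((u ^ 2 + b) ^ (2 * n + 1))⁻¹
      = π / (2 * √b) * ((n : ℝ) ^ k * quarterCoeff n * (d / b ^ 2) ^ n) := by
    rw [integral_const_mul, div_pow]
    have h := binomCoeff_mul_wallisIntegral hb n
    rw [wallisIntegral] at h
    linear_combination (n : ℝ) ^ k * d ^ n * h
  have hz : |d / b ^ 2| < 1 := by
    rw [abs_of_nonneg (by positivity), div_lt_one (by positivity)]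
    exact hd
  have hsum := (summable_eulerSum abs_quarterCoeff_le k hz).mul_left (π / (2 * √b))
  have hnorm (n : ℕ) (u : ℝ) :
      ‖(n : ℝ) ^ k * binomCoeff n * d ^ n * ((u ^ 2 + b) ^ (2 * n + 1))⁻¹‖
        = (n : ℝ) ^ k * binomCoeff n * d ^ n * ((u ^ 2 + b) ^ (2 * n + 1))⁻¹ := by
    have := binomCoeff_pos n
    exact Real.norm_of_nonneg (by positivity)
  have h := hasSum_integral_of_summable_integral_norm (μ := volume.restrict (Ioi (0 : ℝ)))
    (F := fun (n : ℕ) (u : ℝ) =>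
      (n : ℝ) ^ k * binomCoeff n * d ^ n * ((u ^ 2 + b) ^ (2 * n + 1))⁻¹)
    (fun n => ((integrable_inv_sq_add_pow hb (2 * n)).const_mul _).integrableOn)
    (by simpa only [hnorm, hval] using hsum)
  rw [← h.tsum_eq, eulerSum, ← tsum_mul_left]
  exact tsum_congr hval

theorem quartic_two_mul {b : ℝ} (u : ℝ) : quartic (2 * b) u = (u ^ 2 + b) ^ 2 - (b ^ 2 - 2) := by
  unfold quartic; ring

theorem firstKind_eq {b : ℝ} (hb : 1 ≤ b) (hb2 : 2 ≤ b ^ 2) :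
    firstKind (2 * b) = π / (2 * √b) * eulerSum quarterCoeff 0 (1 - 2 / b ^ 2) := by
  have hd : b ^ 2 - 2 < b ^ 2 := by linarith
  have h := integral_tsum_binomCoeff hb (sub_nonneg.2 hb2) hd 0
  simp only [tsum_binomCoeff_zero hb (sub_nonneg.2 hb2) hd] at h
  rw [firstKind]
  simp only [quartic_two_mul]
  rw [h, sub_div, div_self (by positivity)]

theorem secondKind_eq {b : ℝ} (hb : 1 ≤ b) (hb2 : 2 ≤ b ^ 2) :
    (b ^ 2 - 2) * secondKind (2 * b)
      = π / √b * eulerSum quarterCoeff 1 (1 - 2 / b ^ 2) := by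
  have hd : b ^ 2 - 2 < b ^ 2 := by linarith
  have h := integral_tsum_binomCoeff hb (sub_nonneg.2 hb2) hd 1
  simp only [tsum_binomCoeff_one hb (sub_nonneg.2 hb2) hd, integral_const_mul] at h
  rw [secondKind]
  simp only [quartic_two_mul]
  rw [show 1 - 2 / b ^ 2 = (b ^ 2 - 2) / b ^ 2 by field_simp]
  linear_combination 2 * h

/-! ### Legendre's relation -/

theorem tendsto_one_sub_mul_eulerSum {c : ℕ → ℝ} (hc : ∀ n, |c n| ≤ 1) {k : ℕ} {l : ℝ}
    (h : Tendsto (fun n : ℕ => (n : ℝ) ^ k * c n) atTop (𝓝 l)) :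
    Tendsto (fun x => (1 - x) * eulerSum c k x) (𝓝[<] 1) (𝓝 l) := by
  set e : ℕ → ℝ := fun n => (n : ℝ) ^ k * c n with he
  have hsum : Tendsto (fun n => ∑ i ∈ Finset.range n, (e (i + 1) - e i)) atTop (𝓝 (l - e 0)) := by
    simp only [Finset.sum_range_sub]
    exact h.sub_const _
  have habel := Real.tendsto_tsum_powerSeries_nhdsWithin_lt hsum
  have hid : Tendsto (fun x : ℝ => x) (𝓝[<] 1) (𝓝 1) := tendsto_id.mono_left nhdsWithin_le_nhds
  have hlim := (hid.mul habel).const_add (e 0)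
  rw [one_mul, add_sub_cancel] at hlim
  refine hlim.congr' ?_
  filter_upwards [Ioo_mem_nhdsLT (show (0 : ℝ) < 1 by norm_num)] with x hx
  have hs : Summable fun n => e n * x ^ n :=
    summable_eulerSum hc k (by rw [abs_of_pos hx.1]; exact hx.2)
  have hs' : Summable fun n => e (n + 1) * x ^ (n + 1) := (summable_nat_add_iff 1).2 hs
  have h1 : x * ∑' n, (e (n + 1) - e n) * x ^ n
      = ∑' n, e (n + 1) * x ^ (n + 1) - x * ∑' n, e n * x ^ n := by
    rw [← tsum_mul_left, ← tsum_mul_left, ← hs'.tsum_sub (hs.mul_left x)]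
    exact tsum_congr fun n => by ring
  have h2 := hs.tsum_eq_zero_add
  rw [pow_zero, mul_one] at h2
  rw [h1, eulerSum]
  linear_combination -h2

theorem ascPochhammer_eval_eq_prod (s : ℝ) (n : ℕ) :
    (ascPochhammer ℝ n).eval s = ∏ j ∈ Finset.range n, (s + j) := by
  induction n with
  | zero => simp
  | succ n ih => rw [ascPochhammer_succ_eval, ih, Finset.prod_range_succ]

theorem tendsto_mul_quarterCoeff :
    Tendsto (fun n : ℕ => (n : ℝ) ^ 1 * quarterCoeff n) atTop (𝓝 (√2 / 2 / π)) := by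
  have hG1 : Real.Gamma (1/4) ≠ 0 := (Real.Gamma_pos_of_pos (by norm_num)).ne'
  have hG2 : Real.Gamma (3/4) ≠ 0 := (Real.Gamma_pos_of_pos (by norm_num)).ne'
  have hrefl := Real.Gamma_mul_Gamma_one_sub (1/4)
  rw [show (1 : ℝ) - 1/4 = 3/4 by norm_num, mul_one_div, Real.sin_pi_div_four] at hrefl
  have hlim := (tendsto_natCast_div_add_atTop (1 : ℝ)).div
    ((Real.GammaSeq_tendsto_Gamma (1/4)).mul (Real.GammaSeq_tendsto_Gamma (3/4)))
    (mul_ne_zero hG1 hG2)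
  rw [hrefl, one_div_div] at hlim
  rw [← tendsto_add_atTop_iff_nat 1]
  refine hlim.congr' ?_
  filter_upwards [eventually_gt_atTop 0] with n hn
  have hn' : (0 : ℝ) < n := by exact_mod_cast hn
  have hp1 := ascPochhammer_pos (n + 1) (1/4 : ℝ) (by norm_num)
  have hp2 := ascPochhammer_pos (n + 1) (3/4 : ℝ) (by norm_num)
  have hpow : (n : ℝ) ^ (1/4 : ℝ) * (n : ℝ) ^ (3/4 : ℝ) = n := by
    rw [← Real.rpow_add hn']
    norm_num
  have hf : (0 : ℝ) < n.factorial := by positivity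
  simp only [Pi.div_apply, Real.GammaSeq, ← ascPochhammer_eval_eq_prod, quarterCoeff,
    Nat.factorial_succ]
  have h1 : (0 : ℝ) < (n : ℝ) ^ (1/4 : ℝ) := by positivity
  have h2 : (0 : ℝ) < (n : ℝ) ^ (3/4 : ℝ) := by positivity
  generalize (n : ℝ) ^ (1/4 : ℝ) = p1 at *
  generalize (n : ℝ) ^ (3/4 : ℝ) = p2 at *
  push_cast
  rw [← hpow]
  field_simp

theorem tendsto_quarterCoeff :
    Tendsto (fun n : ℕ => (n : ℝ) ^ 0 * quarterCoeff n) atTop (𝓝 0) := by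
  have h := tendsto_mul_quarterCoeff.mul (tendsto_inv_atTop_nhds_zero_nat (𝕜 := ℝ))
  rw [mul_zero] at h
  refine h.congr' ?_
  filter_upwards [eventually_gt_atTop 0] with n hn
  have hn' : (n : ℝ) ≠ 0 := by exact_mod_cast hn.ne'
  field_simp

/-- The Wronskian of `F(z)` and `F(1 - z)`, where `F = ∑ (1/4)ₙ (3/4)ₙ / n!² zⁿ`. -/
noncomputable def legendreForm (z : ℝ) : ℝ :=
  z * eulerSum quarterCoeff 0 z * eulerSum quarterCoeff 1 (1 - z)
    + (1 - z) * eulerSum quarterCoeff 1 z * eulerSum quarterCoeff 0 (1 - z)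

theorem hasDerivAt_legendreForm {z : ℝ} (hz : z ∈ Ioo (0 : ℝ) 1) : HasDerivAt legendreForm 0 z := by
  have hz0 := hz.1.ne'
  have hw0 : 1 - z ≠ 0 := by linarith [hz.2]
  have hz1 : |z| < 1 := by rw [abs_of_pos hz.1]; exact hz.2
  have hw1 : |1 - z| < 1 := by rw [abs_of_pos (by linarith [hz.2])]; linarith [hz.1]
  have hF (k) := hasDerivAt_eulerSum abs_quarterCoeff_le k hz0 hz1
  have hid := (hasDerivAt_id z).const_sub 1
  have hG (k) := (hasDerivAt_eulerSum abs_quarterCoeff_le k hw0 hw1).comp z hid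
  have hodez := eulerSum_quarterCoeff hz1
  have hodew := eulerSum_quarterCoeff hw1
  have h := (((hasDerivAt_id z).mul (hF 0)).mul (hG 1)).add ((hid.mul (hF 1)).mul (hG 0))
  refine h.congr_deriv ?_
  simp only [id, Pi.mul_apply, Function.comp, zero_add, Nat.reduceAdd]
  generalize eulerSum quarterCoeff 0 z = f0 at *
  generalize eulerSum quarterCoeff 1 z = f1 at *
  generalize eulerSum quarterCoeff 2 z = f2 at *
  generalize eulerSum quarterCoeff 0 (1 - z) = g0 at *
  generalize eulerSum quarterCoeff 1 (1 - z) = g1 at *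
  generalize eulerSum quarterCoeff 2 (1 - z) = g2 at *
  field_simp
  linear_combination (1 - z) * g0 * hodez - z * f0 * hodew

theorem tendsto_legendreForm : Tendsto legendreForm (𝓝[>] 0) (𝓝 (√2 / 2 / π)) := by
  have hw : Tendsto (fun z : ℝ => 1 - z) (𝓝[>] 0) (𝓝[<] 1) := by
    refine tendsto_nhdsWithin_iff.2 ⟨?_, ?_⟩
    · exact (Continuous.tendsto' (by fun_prop) _ _ (by norm_num)).mono_left nhdsWithin_le_nhds
    · filter_upwards [self_mem_nhdsWithin] with z hz
      simpa using hz
  have hw' : Tendsto (fun z : ℝ => 1 - z) (𝓝[>] 0) (𝓝 1) := hw.mono_right nhdsWithin_le_nhds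
  have h1 := (tendsto_one_sub_mul_eulerSum abs_quarterCoeff_le tendsto_mul_quarterCoeff).comp hw
  have h0 := (tendsto_one_sub_mul_eulerSum abs_quarterCoeff_le tendsto_quarterCoeff).comp hw
  have hF0 : Tendsto (eulerSum quarterCoeff 0) (𝓝[>] 0) (𝓝 1) := by
    have := (continuousAt_eulerSum abs_quarterCoeff_le 0 (x := 0) (by simp)).tendsto
    rw [eulerSum_zero, quarterCoeff_zero] at this
    exact this.mono_left nhdsWithin_le_nhds
  have hF1 := (hasDerivAt_eulerSum_tsum abs_quarterCoeff_le 1 (x := 0)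
    (by simp)).tendsto_slope_zero_right
  have h := (hF0.mul h1).add ((hw'.mul hF1).mul h0)
  rw [mul_zero, add_zero, one_mul] at h
  refine h.congr' ?_
  filter_upwards [self_mem_nhdsWithin] with z hz
  have hz0 : z ≠ 0 := (mem_Ioi.1 hz).ne'
  simp only [Function.comp, eulerSum_succ_zero, zero_add, sub_zero, sub_sub_cancel, smul_eq_mul,
    legendreForm]
  field_simp

theorem legendreForm_eq {z : ℝ} (hz : z ∈ Ioo (0 : ℝ) 1) : legendreForm z = √2 / 2 / π := by
  refine tendsto_nhds_unique (tendsto_const_nhds.congr' ?_) tendsto_legendreForm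
  filter_upwards [Ioo_mem_nhdsGT (show (0 : ℝ) < 1 by norm_num)] with y hy
  exact isOpen_Ioo.is_const_of_deriv_eq_zero isPreconnected_Ioo
    (fun x hx => (hasDerivAt_legendreForm hx).differentiableAt.differentiableWithinAt)
    (fun x hx => (hasDerivAt_legendreForm hx).deriv) hz hy

/-! ### The singular value -/

theorem eulerSum_quarterCoeff_singular :
    26390 * eulerSum clausenCoeff 1 (1 / 99 ^ 4) + 1103 * eulerSum clausenCoeff 0 (1 / 99 ^ 4)
      = 9801 / 2 * (√2 / 2 / π) := by
  have hs : √29 ^ 2 = 29 := Real.sq_sqrt (by norm_num)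
  have hsm := mem_sqrt_twentynine
  have hF := firstKind_isog
  have hS := secondKind_isog
  set s := √29
  set z : ℝ := (9801 - 1820 * s) / 19602 with hz
  set b : ℝ := 198 * (13 * s - 70) with hb
  set b' : ℝ := 198 * (13 * s + 70) with hb'
  obtain ⟨hs1, hs2⟩ := hsm
  have hs3 : s < 9801 / 1820 :=
    lt_of_pow_lt_pow_left₀ 2 (by norm_num) (by rw [hs]; norm_num)
  have hzm : z ∈ Ioo (0 : ℝ) (1/2) := by constructor <;> rw [hz] <;> linarith
  have hb1 : 1 ≤ b := by rw [hb]; linarith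
  have hb1' : 1 ≤ b' := by rw [hb']; linarith
  have hbz : b ^ 2 * (1 - z) = 2 := by
    rw [hb, hz]; linear_combination (-3312062 + 615160 * s) * hs
  have hbz' : b' ^ 2 * z = 2 := by
    rw [hb', hz]; linear_combination (-3312062 - 615160 * s) * hs
  have hb2 : 2 ≤ b ^ 2 := by nlinarith [hzm.1, sq_nonneg b]
  have hb2' : 2 ≤ b' ^ 2 := by nlinarith [hzm.2, sq_nonneg b']
  have hz1 : 1 - 2 / b ^ 2 = z := by field_simp; linear_combination hbz
  have hz1' : 1 - 2 / b' ^ 2 = 1 - z := by field_simp; linear_combination hbz'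
  have hx : 4 * z * (1 - z) = 1 / 99 ^ 4 := by
    rw [hz]; linear_combination (-3312400/96059601) * hs
  have hsqrt : √b' = (70 + 13 * s) * √b := by
    rw [← Real.sqrt_sq (show 0 ≤ 70 + 13 * s by linarith), ← Real.sqrt_mul (by positivity)]
    congr 1
    rw [hb, hb']
    linear_combination (-(198 * 70 * 169) - 198 * 13 ^ 3 * s) * hs
  have hp := Real.sqrt_pos.2 (show 0 < b by linarith)
  have hk : 0 < 70 + 13 * s := by linarith
  have hpi := Real.pi_pos
  rw [show 396 * (13 * s + 70) = 2 * b' by rw [hb']; ring,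
    show 396 * (13 * s - 70) = 2 * b by rw [hb]; ring] at hF hS
  have hS1 := secondKind_eq hb1 hb2
  have hS2 := secondKind_eq hb1' hb2'
  rw [hS] at hS2
  rw [firstKind_eq hb1 hb2] at hS2 hF
  rw [firstKind_eq hb1' hb2'] at hF
  rw [hz1, hsqrt] at hF
  rw [hz1', hsqrt] at hS2
  rw [hz1] at hS1 hS2
  rw [hz1'] at hF
  have hL := legendreForm_eq (z := z) ⟨hzm.1, by linarith [hzm.2]⟩
  have hC0 := clausen hzm
  have hC1 := clausen_deriv hzm
  rw [hx] at hC0 hC1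
  rw [legendreForm] at hL
  rw [← hL]
  generalize eulerSum quarterCoeff 0 z = f0 at *
  generalize eulerSum quarterCoeff 1 z = f1 at *
  generalize eulerSum quarterCoeff 0 (1 - z) = g0 at *
  generalize eulerSum quarterCoeff 1 (1 - z) = g1 at *
  generalize eulerSum clausenCoeff 0 (1 / 99 ^ 4) = c0 at *
  generalize eulerSum clausenCoeff 1 (1 / 99 ^ 4) = c1 at *
  have hg0 : g0 = s * f0 := by
    field_simp at hF
    linear_combination hF - 70 * 13 * f0 * hs
  have hg1 : (b ^ 2 - 2) * g1 = (70 + 13 * s) * (b' ^ 2 - 2)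
      * ((144850487977 - 26898060350 * s) * f1
        + (1124234956 * s - 6054190520) * (b ^ 2 - 2) / 2 * f0) := by
    rw [div_mul_eq_mul_div, eq_div_iff (by positivity)] at hS1
    rw [div_mul_eq_mul_div π ((70 + 13 * s) * √b), eq_div_iff (by positivity)] at hS2
    refine mul_left_cancel₀ hpi.ne' ?_
    have hr : √b * (π / (2 * √b)) = π / 2 := by field_simp
    linear_combination -(b ^ 2 - 2) * hS2
      + (70 + 13 * s) * (b' ^ 2 - 2) * (144850487977 - 26898060350 * s) * hS1
      + (70 + 13 * s) * (b' ^ 2 - 2) * (1124234956 * s - 6054190520) * (b ^ 2 - 2) * f0 * hr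
  have hc1 : c1 = 2 * f0 * f1 * (1 - z) * (9801 * s / (1820 * 29)) := by
    have hzs : 1 - 2 * z = 1820 * s / 9801 := by rw [hz]; ring
    rw [hzs] at hC1
    linear_combination 9801 * s / (1820 * 29) * hC1 - c1 / 29 * hs
  have hd : b ^ 2 - 2 ≠ 0 := by nlinarith [hzm.1]
  refine mul_left_cancel₀ hd ?_
  rw [hC0, hc1, hg0]
  have h1 : 26390 * 2 * 9801 / (1820 * 29) * (1 - z) * s * (b ^ 2 - 2) = 9801 / 2 * (z
      * (70 + 13 * s) * (b' ^ 2 - 2) * (144850487977 - 26898060350 * s)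
      + (1 - z) * s * (b ^ 2 - 2)) := by
    rw [hz, hb, hb']
    linear_combination (164572345436455256845545 + 30569672857803058151900 * s
      - 5674908286059013891890 * s ^ 2 - 1054126661242744089000 * s ^ 3) * hs
  have h2 : 1103 = 9801 / 4 * z * (70 + 13 * s) * (b' ^ 2 - 2)
      * (1124234956 * s - 6054190520) := by
    rw [hz, hb']
    linear_combination (-3439243966350178609207 - 638847083637884199260 * s
      + 118594615824904167234 * s ^ 2 + 22029210009945258120 * s ^ 3) * hs
  linear_combination f0 * f1 * h1 + (b ^ 2 - 2) * f0 ^ 2 * h2 - 9801 / 2 * z * f0 * hg1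

end RamanujanSeries

/-- Ramanujan's series for `1/π` with argument `1/99⁴`:
`∑ (1/2)ₙ(1/4)ₙ(3/4)ₙ/((1)ₙ)³ · (26390n + 1103) · (1/99⁴)ⁿ = 9801√2/(4π)`,
where the series converges absolutely. -/
theorem ramanujan_series_1103 :
    (Summable fun n : ℕ =>
      |(ascPochhammer ℝ n).eval (1/2) * (ascPochhammer ℝ n).eval (1/4) *
          (ascPochhammer ℝ n).eval (3/4) / ((ascPochhammer ℝ n).eval 1) ^ 3 *
        (26390 * (n : ℝ) + 1103) * (1 / 99 ^ 4) ^ n|) ∧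
    ∑' n : ℕ,
      (ascPochhammer ℝ n).eval (1/2) * (ascPochhammer ℝ n).eval (1/4) *
          (ascPochhammer ℝ n).eval (3/4) / ((ascPochhammer ℝ n).eval 1) ^ 3 *
        (26390 * (n : ℝ) + 1103) * (1 / 99 ^ 4) ^ n
      = 9801 * Real.sqrt 2 / (4 * π) := by
  have hx : |(1 / 99 ^ 4 : ℝ)| < 1 := by
    rw [abs_of_pos (by norm_num)]
    norm_num
  have hs0 := RamanujanSeries.summable_eulerSum RamanujanSeries.abs_clausenCoeff_le 0 hx
  have hs1 := RamanujanSeries.summable_eulerSum RamanujanSeries.abs_clausenCoeff_le 1 hx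
  have hterm (n : ℕ) : (ascPochhammer ℝ n).eval (1/2) * (ascPochhammer ℝ n).eval (1/4) *
          (ascPochhammer ℝ n).eval (3/4) / ((ascPochhammer ℝ n).eval 1) ^ 3 *
        (26390 * (n : ℝ) + 1103) * (1 / 99 ^ 4) ^ n
      = 26390 * ((n : ℝ) ^ 1 * RamanujanSeries.clausenCoeff n * (1 / 99 ^ 4) ^ n)
        + 1103 * ((n : ℝ) ^ 0 * RamanujanSeries.clausenCoeff n * (1 / 99 ^ 4) ^ n) := by
    rw [ascPochhammer_eval_one, RamanujanSeries.clausenCoeff]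
    ring
  simp only [hterm]
  refine ⟨((hs1.mul_left _).add (hs0.mul_left _)).abs, ?_⟩
  rw [(hs1.mul_left _).tsum_add (hs0.mul_left _), tsum_mul_left, tsum_mul_left]
  refine RamanujanSeries.eulerSum_quarterCoeff_singular.trans ?_
  ring
end

section
/- (Russell's Theorem, level 4.) Let p be an odd prime, and write (p+1)/8 = n/d in lowest terms, where n is the numerator and d the denominator of the reduced fraction, and set h = 8/d. Then there exists a nonzero polynomial P(X,Y) with real coefficients, of degree at most n in X and degree at most n in Y, such that for every real q with 0 < q < 1, P(u(q), v(q)) = 0, where beta = x_4(q), alpha = x_4(q^p), u(q) = (alpha*beta)^{1/h} and v(q) = ((1-alpha)(1-beta))^{1/h} (real h-th roots of the positive quantities alpha*beta and (1-alpha)(1-beta)). -/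
/-- The level-4 modular function `x₄(q) = 16q ∏_{n≥1} ((1+q^{2n})/(1+q^{2n-1}))^8`. -/
noncomputable def x₄ (q : ℝ) : ℝ :=
  16 * q * ∏' n : ℕ, ((1 + q ^ (2 * (n + 1))) / (1 + q ^ (2 * (n + 1) - 1))) ^ 8

namespace RussellLevelFour

open Filter Topology
open UpperHalfPlane hiding I
open scoped MatrixGroups ModularForm Manifold
open Complex (I exp)
open Function (Periodic.qParam)
open scoped Real

section EulerProduct

variable {𝕜 : Type*} [NormedField 𝕜] {q : 𝕜}

/-- The Euler product `∏_{n ≥ 1} (1 - q ^ n)`. -/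
noncomputable def eulerProd (q : 𝕜) : 𝕜 := ∏' n : ℕ, (1 - q ^ (n + 1))

lemma summable_pow_mul_add (hq : ‖q‖ < 1) {a : ℕ} (ha : 0 < a) (b : ℕ) :
    Summable fun n : ℕ ↦ ‖q ^ (a * n + b)‖ := by
  have h : Summable fun n : ℕ ↦ ‖q ^ a‖ ^ n * ‖q ^ b‖ := by
    refine (summable_geometric_of_lt_one (norm_nonneg _) ?_).mul_right _
    rw [norm_pow]
    exact pow_lt_one₀ (norm_nonneg _) hq ha.ne'
  refine h.congr fun n ↦ ?_
  rw [pow_add, pow_mul, norm_mul, norm_pow (q ^ a)]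

lemma norm_pow_lt_one (hq : ‖q‖ < 1) {n : ℕ} (hn : n ≠ 0) :
    ‖q ^ n‖ < 1 := by
  rw [norm_pow]
  exact pow_lt_one₀ (norm_nonneg _) hq hn

lemma pow_ne_one_of_norm_lt_one (hq : ‖q‖ < 1) {n : ℕ} (hn : n ≠ 0) : q ^ n ≠ 1 := by
  intro h
  have := pow_lt_one₀ (norm_nonneg q) hq hn
  rw [← norm_pow, h, norm_one] at this
  exact lt_irrefl _ this

/-- The product `∏_{n ≥ 1} (1 + q ^ (2n)) / (1 + q ^ (2n-1))`, as a quotient of Euler products. -/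
noncomputable def prodA (q : 𝕜) : 𝕜 := eulerProd (q ^ 4) / eulerProd (-q)

/-- The product `∏_{n ≥ 1} (1 - q ^ (2n-1)) / (1 + q ^ (2n-1))`, as a quotient of Euler products. -/
noncomputable def prodB (q : 𝕜) : 𝕜 := eulerProd q / eulerProd (-q)

lemma prodB_neg : prodB (-q) = (prodB q)⁻¹ := by
  rw [prodB, prodB, neg_neg, inv_div]

@[simp] lemma eulerProd_zero : eulerProd (0 : 𝕜) = 1 := by simp [eulerProd]

@[simp] lemma prodA_zero : prodA (0 : 𝕜) = 1 := by simp [prodA]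

@[simp] lemma prodB_zero : prodB (0 : 𝕜) = 1 := by simp [prodB]

variable [CompleteSpace 𝕜]

lemma multipliable_one_sub_pow_mul_add (hq : ‖q‖ < 1) {a : ℕ} (ha : 0 < a) (b : ℕ) :
    Multipliable fun n : ℕ ↦ 1 - q ^ (a * n + b) := by
  simp_rw [sub_eq_add_neg]
  exact multipliable_one_add_of_summable (by simpa using summable_pow_mul_add hq ha b)

lemma multipliable_one_add_pow_mul_add (hq : ‖q‖ < 1) {a : ℕ} (ha : 0 < a) (b : ℕ) :
    Multipliable fun n : ℕ ↦ 1 + q ^ (a * n + b) :=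
  multipliable_one_add_of_summable (summable_pow_mul_add hq ha b)

lemma eulerProd_ne_zero (hq : ‖q‖ < 1) : eulerProd q ≠ 0 := by
  simp_rw [eulerProd, sub_eq_add_neg]
  refine tprod_one_add_ne_zero_of_summable (fun n ↦ ?_) ?_
  · rw [← sub_eq_add_neg, sub_ne_zero]
    exact (pow_ne_one_of_norm_lt_one hq n.succ_ne_zero).symm
  · simpa using summable_pow_mul_add hq one_pos 1

lemma eulerProd_eq_odd_mul (hq : ‖q‖ < 1) :
    eulerProd q = (∏' n : ℕ, (1 - q ^ (2 * n + 1))) * eulerProd (q ^ 2) := by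
  have := tprod_even_mul_odd (f := fun n : ℕ ↦ 1 - q ^ (n + 1))
    (multipliable_one_sub_pow_mul_add hq two_pos 1)
    (multipliable_one_sub_pow_mul_add hq two_pos 2)
  rw [eulerProd, ← this, eulerProd]
  simp_rw [← pow_mul, mul_add]

lemma eulerProd_neg_eq (hq : ‖q‖ < 1) :
    eulerProd (-q) = (∏' n : ℕ, (1 + q ^ (2 * n + 1))) * eulerProd (q ^ 2) := by
  rw [eulerProd_eq_odd_mul (by rwa [norm_neg]), neg_sq]
  congr 2 with n
  rw [(odd_two_mul_add_one n).neg_pow, sub_neg_eq_add]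

lemma eulerProd_neg_mul (hq : ‖q‖ < 1) :
    eulerProd (-q) * eulerProd q * eulerProd (q ^ 4) = eulerProd (q ^ 2) ^ 3 := by
  have h : (∏' n : ℕ, (1 + q ^ (2 * n + 1))) * (∏' n : ℕ, (1 - q ^ (2 * n + 1)))
      = ∏' n : ℕ, (1 - (q ^ 2) ^ (2 * n + 1)) := by
    rw [← (multipliable_one_add_pow_mul_add hq two_pos 1).tprod_mul
      (multipliable_one_sub_pow_mul_add hq two_pos 1)]
    congr 1 with n
    ring
  have h2 := eulerProd_eq_odd_mul (norm_pow_lt_one hq two_ne_zero)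
  rw [← h, ← pow_mul] at h2
  rw [eulerProd_neg_eq hq, eulerProd_eq_odd_mul hq]
  linear_combination (-eulerProd (q ^ 2) ^ 2) * h2

lemma tprod_one_add_even_mul (hq : ‖q‖ < 1) :
    (∏' n : ℕ, (1 + q ^ (2 * n + 2))) * eulerProd (q ^ 2) = eulerProd (q ^ 4) := by
  simp_rw [eulerProd, ← pow_mul, mul_add, mul_one]
  rw [← (multipliable_one_add_pow_mul_add hq two_pos 2).tprod_mul
    (multipliable_one_sub_pow_mul_add hq two_pos 2)]
  congr 1 with n
  ring

lemma prodA_ne_zero (hq : ‖q‖ < 1) : prodA q ≠ 0 :=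
  div_ne_zero (eulerProd_ne_zero (norm_pow_lt_one hq four_ne_zero))
    (eulerProd_ne_zero (by rwa [norm_neg]))

lemma prodB_ne_zero (hq : ‖q‖ < 1) : prodB q ≠ 0 :=
  div_ne_zero (eulerProd_ne_zero hq) (eulerProd_ne_zero (by rwa [norm_neg]))

lemma prodA_neg (hq : ‖q‖ < 1) : prodA (-q) = prodA q / prodB q := by
  have := eulerProd_ne_zero hq
  have : eulerProd (-q) ≠ 0 := eulerProd_ne_zero (by rwa [norm_neg])
  rw [prodA, prodA, prodB, neg_neg, Even.neg_pow (by decide)]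
  field_simp

lemma tprod_ratio_eq (hq : ‖q‖ < 1) :
    ∏' n : ℕ, ((1 + q ^ (2 * (n + 1))) / (1 + q ^ (2 * (n + 1) - 1))) ^ 8 = prodA q ^ 8 := by
  have h1 := (multipliable_one_add_pow_mul_add hq two_pos 1).hasProd
  have h2 := (multipliable_one_add_pow_mul_add hq two_pos 2).hasProd
  have hE : eulerProd (-q) ≠ 0 := eulerProd_ne_zero (by rwa [norm_neg])
  have hne : (∏' n : ℕ, (1 + q ^ (2 * n + 1))) ≠ 0 := by
    rw [eulerProd_neg_eq hq] at hE
    exact left_ne_zero_of_mul hE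
  have h := h2.mul (h1.inv₀ hne)
  have hA : (∏' n : ℕ, (1 + q ^ (2 * n + 2))) * (∏' n : ℕ, (1 + q ^ (2 * n + 1)))⁻¹ = prodA q := by
    have := eulerProd_ne_zero (norm_pow_lt_one hq two_ne_zero)
    rw [prodA, eulerProd_neg_eq hq, ← tprod_one_add_even_mul hq]
    field_simp
  rw [hA] at h
  rw [← (h.multipliable.tprod_pow 8).trans (congrArg (· ^ 8) h.tprod_eq)]
  simp_rw [div_eq_mul_inv]
  rfl

end EulerProduct

lemma ofReal_eulerProd {q : ℝ} (hq : ‖q‖ < 1) :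
    ((eulerProd q : ℝ) : ℂ) = eulerProd (q : ℂ) := by
  have h := multipliable_one_sub_pow_mul_add hq one_pos 1
  simp only [one_mul] at h
  have := h.map_tprod Complex.ofRealHom Complex.continuous_ofReal
  simpa [eulerProd] using this

lemma ofReal_prodA {q : ℝ} (hq : ‖q‖ < 1) : ((prodA q : ℝ) : ℂ) = prodA (q : ℂ) := by
  rw [prodA, Complex.ofReal_div, ofReal_eulerProd (norm_pow_lt_one hq four_ne_zero),
    ofReal_eulerProd (by rwa [norm_neg]), prodA]
  simp

lemma ofReal_prodB {q : ℝ} (hq : ‖q‖ < 1) : ((prodB q : ℝ) : ℂ) = prodB (q : ℂ) := by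
  rw [prodB, Complex.ofReal_div, ofReal_eulerProd hq, ofReal_eulerProd (by rwa [norm_neg]), prodB]
  simp

lemma eulerProd_nonneg {q : ℝ} (hq : ‖q‖ < 1) : 0 ≤ eulerProd q := by
  have h := (multipliable_one_sub_pow_mul_add hq one_pos 1).hasProd
  simp only [one_mul] at h
  refine ge_of_tendsto' h fun s ↦ Finset.prod_nonneg fun n _ ↦ ?_
  have := norm_pow_lt_one hq n.succ_ne_zero
  rw [Real.norm_eq_abs] at this
  linarith [le_abs_self (q ^ (n + 1))]

lemma prodA_pos {q : ℝ} (hq : ‖q‖ < 1) : 0 < prodA q :=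
  (div_nonneg (eulerProd_nonneg (norm_pow_lt_one hq four_ne_zero))
    (eulerProd_nonneg (by rwa [norm_neg]))).lt_of_ne (prodA_ne_zero hq).symm

lemma prodB_pos {q : ℝ} (hq : ‖q‖ < 1) : 0 < prodB q :=
  (div_nonneg (eulerProd_nonneg hq)
    (eulerProd_nonneg (by rwa [norm_neg]))).lt_of_ne (prodB_ne_zero hq).symm

lemma x₄_eq {q : ℝ} (hq : ‖q‖ < 1) : x₄ q = 16 * q * prodA q ^ 8 := by
  rw [x₄, tprod_ratio_eq hq]

lemma differentiableOn_eulerProd :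
    DifferentiableOn ℂ (eulerProd : ℂ → ℂ) (Metric.ball 0 1) :=
  ModularForm.differentiableOn_tprod_one_sub_pow

lemma differentiableOn_eulerProd_comp {f : ℂ → ℂ} (hf : Differentiable ℂ f)
    (hm : Set.MapsTo f (Metric.ball 0 1) (Metric.ball 0 1)) :
    DifferentiableOn ℂ (fun q ↦ eulerProd (f q)) (Metric.ball 0 1) :=
  differentiableOn_eulerProd.comp hf.differentiableOn hm

lemma mapsTo_pow_ball {n : ℕ} (hn : n ≠ 0) :
    Set.MapsTo (fun q : ℂ ↦ q ^ n) (Metric.ball 0 1) (Metric.ball 0 1) := fun q hq ↦ by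
  simp only [mem_ball_zero_iff] at *
  exact norm_pow_lt_one hq hn

lemma mapsTo_neg_ball : Set.MapsTo (fun q : ℂ ↦ -q) (Metric.ball 0 1) (Metric.ball 0 1) :=
  fun q hq ↦ by simpa using hq

lemma differentiableOn_prodA : DifferentiableOn ℂ (prodA : ℂ → ℂ) (Metric.ball 0 1) :=
  (differentiableOn_eulerProd_comp (by fun_prop) (mapsTo_pow_ball four_ne_zero)).div
    (differentiableOn_eulerProd_comp (by fun_prop) mapsTo_neg_ball)
    fun q hq ↦ eulerProd_ne_zero (by simpa using hq)

lemma differentiableOn_prodB : DifferentiableOn ℂ (prodB : ℂ → ℂ) (Metric.ball 0 1) :=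
  differentiableOn_eulerProd.div
    (differentiableOn_eulerProd_comp (by fun_prop) mapsTo_neg_ball)
    fun q hq ↦ eulerProd_ne_zero (by simpa using hq)

/-- A weight-zero modular form on a finite-index subgroup is constant. -/
lemma exists_forall_eq_of_invariant (Γ : Subgroup SL(2, ℤ)) [Γ.FiniteIndex] {f : ℂ → ℂ}
    (hf : DifferentiableOn ℂ f upperHalfPlaneSet)
    (hΓ : ∀ γ ∈ Γ, ∀ τ : ℍ, f (γ • τ : ℍ) = f τ)
    (hb : ∀ γ : SL(2, ℤ), IsBoundedAtImInfty fun τ ↦ f (γ • τ : ℍ)) :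
    ∃ c, ∀ τ : ℍ, f τ = c := by
  have hslash (γ : SL(2, ℤ)) :
      ((fun τ : ℍ ↦ f τ) ∣[(0 : ℤ)] γ) = fun τ ↦ f (γ • τ : ℍ) := by
    ext τ; simp only [ModularForm.SL_slash_apply, neg_zero, zpow_zero, mul_one]
  let F : ModularForm (Γ : Subgroup (GL (Fin 2) ℝ)) 0 :=
    { toFun := fun τ ↦ f τ
      slash_action_eq' := by
        rintro - ⟨γ, hγ, rfl⟩
        exact (hslash γ).trans (funext (hΓ γ hγ))
      holo' := by
        rw [UpperHalfPlane.mdifferentiable_iff]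
        exact hf.congr fun z hz ↦ by
          simp [UpperHalfPlane.ofComplex_apply_of_im_pos hz]
      bdd_at_cusps' := by
        intro c hc
        rw [Subgroup.IsArithmetic.isCusp_iff_isCusp_SL2Z] at hc
        rw [OnePoint.isBoundedAt_iff_forall_SL2Z hc]
        intro γ _
        rw [hslash]
        exact hb γ }
  obtain ⟨c, hc⟩ := ModularForm.eq_const_of_weight_zero F
  exact ⟨c, fun τ ↦ congrFun hc τ⟩

/-- The eighth root of `x₄` as a function of `τ`, with `q = exp (π i τ)`. -/
noncomputable def phi (z : ℂ) : ℂ := √2 * Periodic.qParam 16 z * prodA (Periodic.qParam 2 z)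

/-- The eighth root of `1 - x₄` as a function of `τ`, with `q = exp (π i τ)`. -/
noncomputable def psi (z : ℂ) : ℂ := prodB (Periodic.qParam 2 z)

lemma qParam_two_norm (τ : ℍ) : ‖Periodic.qParam 2 (τ : ℂ)‖ < 1 :=
  Function.Periodic.norm_qParam_lt_one two_pos τ.im_pos

lemma phi_ne_zero (τ : ℍ) : phi τ ≠ 0 :=
  mul_ne_zero (mul_ne_zero (by simp) (Function.Periodic.qParam_ne_zero _))
    (prodA_ne_zero (qParam_two_norm τ))

lemma psi_ne_zero (τ : ℍ) : psi τ ≠ 0 := prodB_ne_zero (qParam_two_norm τ)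

lemma mapsTo_qParam :
    Set.MapsTo (Periodic.qParam 2) upperHalfPlaneSet (Metric.ball 0 1) := fun z hz ↦ by
  simpa using Function.Periodic.norm_qParam_lt_one two_pos hz

lemma differentiableOn_phi : DifferentiableOn ℂ phi upperHalfPlaneSet :=
  ((differentiableOn_const _).mul Function.Periodic.differentiable_qParam.differentiableOn).mul
    (differentiableOn_prodA.comp Function.Periodic.differentiable_qParam.differentiableOn
      mapsTo_qParam)

lemma differentiableOn_psi : DifferentiableOn ℂ psi upperHalfPlaneSet :=
  differentiableOn_prodB.comp Function.Periodic.differentiable_qParam.differentiableOn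
    mapsTo_qParam

lemma qParam_pow_eq (n : ℕ) (h h' : ℝ) (z w : ℂ) (hz : n * z / h = w / h') :
    Periodic.qParam h z ^ n = Periodic.qParam h' w := by
  simp only [Periodic.qParam]
  rw [← Complex.exp_nat_mul]
  congr 1
  linear_combination 2 * π * I * hz

lemma eulerProd_mul_eq_eta (z : ℂ) :
    Periodic.qParam 24 z * eulerProd (Periodic.qParam 1 z) = ModularForm.eta z := rfl

lemma eta_zoom (τ : ℍ) : eulerProd (Periodic.qParam 2 (τ : ℂ)) ≠ 0 ∧
    eulerProd (Periodic.qParam 2 (τ : ℂ) ^ 2) ≠ 0 ∧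
    eulerProd (Periodic.qParam 2 (τ : ℂ) ^ 4) ≠ 0 ∧ eulerProd (-Periodic.qParam 2 (τ : ℂ)) ≠ 0 := by
  have h := qParam_two_norm τ
  refine ⟨eulerProd_ne_zero h, eulerProd_ne_zero (norm_pow_lt_one h two_ne_zero),
    eulerProd_ne_zero (norm_pow_lt_one h four_ne_zero), eulerProd_ne_zero (by simpa)⟩

lemma eta_eq (τ : ℍ) : ModularForm.eta (τ / 2) =
      Periodic.qParam 48 τ * eulerProd (Periodic.qParam 2 (τ : ℂ)) ∧
    ModularForm.eta τ =
      Periodic.qParam 48 τ ^ 2 * eulerProd (Periodic.qParam 2 (τ : ℂ) ^ 2) ∧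
    ModularForm.eta (2 * τ) =
      Periodic.qParam 48 τ ^ 4 * eulerProd (Periodic.qParam 2 (τ : ℂ) ^ 4) := by
  simp only [← eulerProd_mul_eq_eta]
  refine ⟨?_, ?_, ?_⟩
  · rw [← pow_one (Periodic.qParam 48 _), ← pow_one (Periodic.qParam 2 _),
      qParam_pow_eq 1 48 24 τ (τ / 2) (by push_cast; ring),
      qParam_pow_eq 1 2 1 τ (τ / 2) (by push_cast; ring)]
  · rw [qParam_pow_eq 2 48 24 τ τ (by push_cast; ring),
      qParam_pow_eq 2 2 1 τ τ (by push_cast; ring)]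
  · rw [qParam_pow_eq 4 48 24 τ (2 * τ) (by push_cast; ring),
      qParam_pow_eq 4 2 1 τ (2 * τ) (by push_cast; ring)]

lemma psi_eq_eta (τ : ℍ) : psi τ =
    ModularForm.eta (τ / 2) ^ 2 * ModularForm.eta (2 * τ) / ModularForm.eta τ ^ 3 := by
  obtain ⟨h1, h2, h3⟩ := eta_eq τ
  obtain ⟨g1, g2, g3, g4⟩ := eta_zoom τ
  have hq := Function.Periodic.qParam_ne_zero (h := 48) (τ : ℂ)
  have key := eulerProd_neg_mul (qParam_two_norm τ)
  rw [h1, h2, h3, psi, prodB, mul_pow, mul_pow, ← key]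
  field_simp

lemma phi_eq_eta (τ : ℍ) : phi τ = √2 *
    (ModularForm.eta (2 * τ) ^ 2 * ModularForm.eta (τ / 2)) / ModularForm.eta τ ^ 3 := by
  obtain ⟨h1, h2, h3⟩ := eta_eq τ
  obtain ⟨g1, g2, g3, g4⟩ := eta_zoom τ
  have hq := Function.Periodic.qParam_ne_zero (h := 48) (τ : ℂ)
  have key := eulerProd_neg_mul (qParam_two_norm τ)
  rw [h1, h2, h3, phi, prodA, mul_pow, mul_pow, ← key,
    ← qParam_pow_eq 3 48 16 τ τ (by push_cast; ring)]
  field_simp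

lemma eta_neg_inv (τ : ℍ) : ModularForm.eta (-1 / τ) =
    (Complex.sqrt I)⁻¹ * (Complex.sqrt τ * ModularForm.eta τ) :=
  ModularForm.eta_comp_eq_csqrt_I_inv τ.2

lemma phi_neg_inv (τ : ℍ) : phi (-1 / τ) = psi τ := by
  have hS := modular_S_smul τ
  have h0 := phi_eq_eta (ModularGroup.S • τ)
  have hτ := τ.ne_zero
  have e0 : ((ModularGroup.S • τ : ℍ) : ℂ) = -1 / τ := by
    rw [hS]; simp [neg_div]
  let τ' : ℍ := ⟨τ / 2, by have := τ.im_pos; simpa using this⟩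
  let τ'' : ℍ := ⟨2 * τ, by have := τ.im_pos; simpa using this⟩
  have e1 : 2 * (-1 / (τ : ℂ)) = -1 / (τ' : ℍ) := by simp [τ']; field_simp
  have e2 : (-1 / (τ : ℂ)) / 2 = -1 / (τ'' : ℍ) := by simp [τ'']; field_simp
  rw [e0, e1, e2, eta_neg_inv, eta_neg_inv, eta_neg_inv] at h0
  rw [h0, psi_eq_eta]
  have hs {z : ℂ} : Complex.sqrt z ^ 2 = z := by
    rw [Complex.sqrt, ← Complex.cpow_nat_mul]; simp
  have hsI : Complex.sqrt I ≠ 0 := by simp [Complex.sqrt]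
  have hsτ : Complex.sqrt τ ≠ 0 := by simp [Complex.sqrt, hτ]
  have h2 : Complex.sqrt τ'' = √2 * Complex.sqrt τ := by
    have e : (τ'' : ℂ) = ((2 : ℝ) : ℂ) * τ := by simp [τ'']
    have r : (√2 : ℂ) = exp ((Real.log 2 : ℝ) / 2) := by
      rw [Real.sqrt_eq_rpow, Real.rpow_def_of_pos two_pos, Complex.ofReal_exp]
      congr 1; push_cast; ring
    rw [sqrt_eq_exp τ''.ne_zero, sqrt_eq_exp hτ, e, Complex.log_ofReal_mul two_pos hτ, r,
      ← Complex.exp_add]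
    congr 1; ring
  have hη := ModularForm.eta_ne_zero τ.2
  have h22 : (√2 : ℂ) ^ 2 = 2 := by
    rw [← Complex.ofReal_pow, Real.sq_sqrt zero_le_two]; simp
  have h3 : (Complex.sqrt τ') ^ 2 = τ / 2 := hs
  have h4 : (Complex.sqrt τ) ^ 2 = τ := hs
  have e3 : (τ' : ℂ) = τ / 2 := rfl
  have e4 : (τ'' : ℂ) = 2 * τ := rfl
  rw [h2, e3, e4, ← e3]
  simp only [mul_pow, h3, inv_pow]
  rw [pow_succ (Complex.sqrt τ) 2, h4]
  field_simp
  rw [h22]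

lemma psi_neg_inv (τ : ℍ) : psi (-1 / τ) = phi τ := by
  have e0 : ((ModularGroup.S • τ : ℍ) : ℂ) = -1 / τ := by
    rw [modular_S_smul]; simp [neg_div]
  have hτ := τ.ne_zero
  rw [← e0, ← phi_neg_inv, e0]
  congr 1; field_simp

lemma qParam_add_int_mul (h : ℝ) (z w : ℂ) :
    Periodic.qParam h (z + w) = exp (2 * π * I * w / h) * Periodic.qParam h z := by
  simp only [Periodic.qParam]
  rw [← Complex.exp_add]
  congr 1; ring

lemma psi_add_even (z : ℂ) (k : ℤ) : psi (z + 2 * k) = psi z := by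
  rw [psi, qParam_add_int_mul, psi]
  have : exp (2 * π * I * (2 * k) / (2 : ℝ)) = 1 :=
    Complex.exp_eq_one_iff.2 ⟨k, by push_cast; ring⟩
  rw [this, one_mul]

lemma phi_add_even (z : ℂ) (k : ℤ) :
    phi (z + 2 * k) = exp (2 * π * I / 8) ^ k * phi z := by
  rw [phi, qParam_add_int_mul, qParam_add_int_mul, phi]
  have : exp (2 * π * I * (2 * k) / (2 : ℝ)) = 1 :=
    Complex.exp_eq_one_iff.2 ⟨k, by push_cast; ring⟩
  have h : exp (2 * π * I * (2 * k) / (16 : ℝ)) = exp (2 * π * I / 8) ^ k := by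
    rw [← Complex.exp_int_mul]; congr 1; push_cast; ring
  rw [this, one_mul, h]
  ring

lemma psi_add_one (z : ℂ) : psi (z + 1) = (psi z)⁻¹ := by
  rw [psi, qParam_add_int_mul, psi, ← prodB_neg]
  have : exp (2 * π * I * 1 / (2 : ℝ)) = -1 := by
    rw [← Complex.exp_pi_mul_I]; congr 1; push_cast; ring
  rw [this, neg_one_mul]

lemma phi_add_one (τ : ℍ) :
    phi (τ + 1) = exp (2 * π * I / 16) * phi τ / psi τ := by
  rw [phi, qParam_add_int_mul, qParam_add_int_mul, phi, psi]
  have : exp (2 * π * I * 1 / (2 : ℝ)) = -1 := by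
    rw [← Complex.exp_pi_mul_I]; congr 1; push_cast; ring
  rw [this, neg_one_mul, prodA_neg (qParam_two_norm τ)]
  have h : exp (2 * π * I * 1 / (16 : ℝ)) = exp (2 * π * I / 16) := by
    congr 1; push_cast; ring
  rw [h]; ring

lemma phi_pow_eight (z : ℂ) :
    phi z ^ 8 = 16 * Periodic.qParam 2 z * prodA (Periodic.qParam 2 z) ^ 8 := by
  have h22 : (√2 : ℂ) ^ 2 = 2 := by
    rw [← Complex.ofReal_pow, Real.sq_sqrt zero_le_two]; simp
  rw [phi, mul_pow, mul_pow, qParam_pow_eq 8 16 2 z z (by push_cast; ring),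
    show (√2 : ℂ) ^ 8 = ((√2 : ℂ) ^ 2) ^ 4 by ring, h22]
  norm_num

lemma tendsto_comp_qParam {g : ℂ → ℂ} {c : ℂ} {h : ℝ} (hh : 0 < h)
    (hg : Tendsto g (𝓝[≠] 0) (𝓝 c)) :
    Tendsto (fun τ : ℍ ↦ g (Periodic.qParam h τ)) atImInfty (𝓝 c) :=
  hg.comp (tendsto_nhdsWithin_iff.2 ⟨qParam_tendsto_atImInfty hh,
    .of_forall fun τ ↦ Function.Periodic.qParam_ne_zero (τ : ℂ)⟩)

lemma differentiableAt_of_ball {g : ℂ → ℂ} (hg : DifferentiableOn ℂ g (Metric.ball 0 1)) :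
    DifferentiableAt ℂ g 0 :=
  hg.differentiableAt (Metric.isOpen_ball.mem_nhds (by simp))

lemma tendsto_prodA : Tendsto (prodA : ℂ → ℂ) (𝓝 0) (𝓝 1) := by
  simpa using (differentiableAt_of_ball differentiableOn_prodA).continuousAt.tendsto

lemma tendsto_prodB : Tendsto (prodB : ℂ → ℂ) (𝓝 0) (𝓝 1) := by
  simpa using (differentiableAt_of_ball differentiableOn_prodB).continuousAt.tendsto

/-- The level-one invariant whose vanishing expresses `φ ^ 8 + ψ ^ 8 = 1`. -/
noncomputable def quarticDefect (z : ℂ) : ℂ :=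
  (phi z ^ 8 + psi z ^ 8 - 1) ^ 6 / (phi z * psi z) ^ 16

lemma quarticDefect_smul (γ : SL(2, ℤ)) (τ : ℍ) :
    quarticDefect (γ • τ : ℍ) = quarticDefect τ := by
  have slash_eq (γ : SL(2, ℤ)) : ((fun τ : ℍ ↦ quarticDefect τ) ∣[(0 : ℤ)] γ) =
      fun τ ↦ quarticDefect (γ • τ : ℍ) := by
    ext τ; simp only [ModularForm.SL_slash_apply, neg_zero, zpow_zero, mul_one]
  have hS : ((fun τ : ℍ ↦ quarticDefect τ) ∣[(0 : ℤ)] ModularGroup.S) =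
      fun τ : ℍ ↦ quarticDefect τ := by
    rw [slash_eq]
    ext τ
    have e0 : ((ModularGroup.S • τ : ℍ) : ℂ) = -1 / τ := by
      rw [modular_S_smul]; simp [neg_div]
    rw [e0, quarticDefect, phi_neg_inv, psi_neg_inv, quarticDefect]
    ring
  have hT : ((fun τ : ℍ ↦ quarticDefect τ) ∣[(0 : ℤ)] ModularGroup.T) =
      fun τ : ℍ ↦ quarticDefect τ := by
    rw [slash_eq]
    ext τ
    have e0 : ((ModularGroup.T • τ : ℍ) : ℂ) = τ + 1 := by
      rw [modular_T_smul]; simp [add_comm]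
    have hξ : exp (2 * π * I / 16) ^ 8 = -1 := by
      rw [← Complex.exp_nat_mul, ← Complex.exp_pi_mul_I]; congr 1; push_cast; ring
    have h1 := psi_ne_zero τ
    have h2 := phi_ne_zero τ
    rw [e0, quarticDefect, phi_add_one, psi_add_one, quarticDefect]
    set ξ := exp (2 * π * I / 16)
    have e1 : (ξ * phi τ / psi τ) ^ 8 = - phi τ ^ 8 / psi τ ^ 8 := by
      rw [div_pow, mul_pow, hξ]; ring
    have e2 : (ξ * phi τ / psi τ * (psi τ)⁻¹) ^ 16 = phi τ ^ 16 / psi τ ^ 32 := by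
      rw [show (ξ * phi τ / psi τ * (psi τ)⁻¹) ^ 16
        = (ξ ^ 8) ^ 2 * phi τ ^ 16 / psi τ ^ 32 by field_simp, hξ]; ring
    rw [e1, e2]
    field_simp
    ring
  have := congrFun (SlashInvariantForm.slash_action_generators_SL2Z hS hT γ) τ
  rwa [slash_eq] at this

lemma tendsto_quarticDefect :
    Tendsto (fun τ : ℍ ↦ quarticDefect τ) atImInfty (𝓝 0) := by
  let D : ℂ → ℂ := fun q ↦ 16 * q * prodA q ^ 8 + prodB q ^ 8 - 1
  have hD : DifferentiableAt ℂ D 0 :=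
    (((differentiableAt_id.const_mul 16).mul
      ((differentiableAt_of_ball differentiableOn_prodA).pow 8)).add
      ((differentiableAt_of_ball differentiableOn_prodB).pow 8)).sub_const 1
  have hD0 : D 0 = 0 := by simp [D]
  have hs : Tendsto (fun q ↦ D q / q) (𝓝[≠] 0) (𝓝 (deriv D 0)) := by
    have := hasDerivAt_iff_tendsto_slope.1 hD.hasDerivAt
    refine this.congr fun q ↦ ?_
    simp [slope, hD0, div_eq_inv_mul]
  have hq : Tendsto (fun q : ℂ ↦ q) (𝓝[≠] 0) (𝓝 0) := tendsto_id.mono_left nhdsWithin_le_nhds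
  have hlim : Tendsto (fun q ↦ (D q / q) ^ 6 * q ^ 4 / (256 * (prodA q * prodB q) ^ 16))
      (𝓝[≠] 0) (𝓝 ((deriv D 0) ^ 6 * 0 ^ 4 / (256 * (1 * 1) ^ 16))) :=
    ((hs.pow 6).mul (hq.pow 4)).div
      ((((tendsto_prodA.mono_left nhdsWithin_le_nhds).mul
        (tendsto_prodB.mono_left nhdsWithin_le_nhds)).pow 16).const_mul 256) (by norm_num)
  rw [zero_pow four_ne_zero, mul_zero, zero_div] at hlim
  refine (tendsto_comp_qParam two_pos hlim).congr fun τ ↦ ?_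
  have hq := Function.Periodic.qParam_ne_zero (h := 2) (τ : ℂ)
  have e : phi τ ^ 16 = (phi τ ^ 8) ^ 2 := by ring
  rw [quarticDefect, mul_pow (phi τ), e, phi_pow_eight, psi]
  set q := Periodic.qParam 2 (τ : ℂ)
  have hA : prodA q ≠ 0 := prodA_ne_zero (qParam_two_norm τ)
  have hB : prodB q ≠ 0 := prodB_ne_zero (qParam_two_norm τ)
  simp only [D]
  field_simp
  ring

/-- Jacobi's quartic identity. -/
lemma phi_pow_add_psi_pow (τ : ℍ) : phi τ ^ 8 + psi τ ^ 8 = 1 := by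
  have hd : DifferentiableOn ℂ quarticDefect upperHalfPlaneSet :=
    ((((differentiableOn_phi.pow 8).add (differentiableOn_psi.pow 8)).sub_const 1).pow 6).div
      ((differentiableOn_phi.mul differentiableOn_psi).pow 16) fun z hz ↦
        pow_ne_zero _ (mul_ne_zero (phi_ne_zero ⟨z, hz⟩) (psi_ne_zero ⟨z, hz⟩))
  obtain ⟨c, hc⟩ := exists_forall_eq_of_invariant ⊤ hd (fun γ _ τ ↦ quarticDefect_smul γ τ)
    fun γ ↦ by
      simp only [quarticDefect_smul]
      exact tendsto_quarticDefect.isBigO_one ℝ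
  have h0 : c = 0 := by
    have := tendsto_quarticDefect
    simp only [hc] at this
    exact tendsto_const_nhds_iff.1 this
  have h1 := hc τ
  rw [h0, quarticDefect, div_eq_zero_iff, or_iff_left
    (pow_ne_zero _ (mul_ne_zero (phi_ne_zero τ) (psi_ne_zero τ)))] at h1
  exact sub_eq_zero.1 (pow_eq_zero_iff (by norm_num) |>.1 h1)

lemma exists_nome {q : ℝ} (h0 : 0 < q) (h1 : q < 1) :
    ∃ t : ℝ, 0 < t ∧ ∀ τ : ℍ, (τ : ℂ) = t * I → Periodic.qParam 2 (τ : ℂ) = q := by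
  refine ⟨-Real.log q / π, div_pos (neg_pos.2 (Real.log_neg h0 h1)) Real.pi_pos, fun τ hτ ↦ ?_⟩
  have hπ : (π : ℂ) ≠ 0 := by simp [Real.pi_ne_zero]
  have e : 2 * π * I * (((-Real.log q / π : ℝ) : ℂ) * I) / (2 : ℝ) = (Real.log q : ℝ) := by
    push_cast
    field_simp
    simp
  rw [hτ, Periodic.qParam, e, ← Complex.ofReal_exp, Real.exp_log h0]

lemma one_sub_x₄_eq {q : ℝ} (h0 : 0 < q) (h1 : q < 1) : 1 - x₄ q = prodB q ^ 8 := by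
  have hq : ‖q‖ < 1 := by rwa [Real.norm_of_nonneg h0.le]
  obtain ⟨t, ht, h⟩ := exists_nome h0 h1
  let τ : ℍ := ⟨t * I, by simpa using ht⟩
  have := phi_pow_add_psi_pow τ
  rw [phi_pow_eight, psi, h τ rfl, ← ofReal_prodA hq, ← ofReal_prodB hq] at this
  rw [x₄_eq hq, sub_eq_iff_eq_add']
  exact_mod_cast this.symm

/-- A primitive sixteenth root of unity. -/
noncomputable def rootSixteen : ℂ := exp (2 * π * I / 16)

lemma rootSixteen_ne_zero : rootSixteen ≠ 0 := Complex.exp_ne_zero _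

lemma rootSixteen_zpow_eq {m n : ℤ} (h : (16 : ℤ) ∣ m - n) :
    rootSixteen ^ m = rootSixteen ^ n := by
  obtain ⟨k, hk⟩ := h
  have h16 : rootSixteen ^ (16 : ℤ) = 1 := by
    rw [rootSixteen, ← Complex.exp_int_mul, Complex.exp_eq_one_iff]
    exact ⟨1, by push_cast; ring⟩
  rw [show m = n + 16 * k by linarith, zpow_add₀ rootSixteen_ne_zero, zpow_mul, h16, one_zpow,
    mul_one]

lemma phi_add_even' (z : ℂ) (k : ℤ) : phi (z + 2 * k) = rootSixteen ^ (2 * k) * phi z := by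
  rw [phi_add_even, zpow_mul, rootSixteen]
  congr 2
  rw [← Complex.exp_int_mul]
  congr 1; push_cast; ring

/-- The matrix `(a b; c d)` of determinant one. -/
def slMk (a b c d : ℤ) (h : a * d - b * c = 1) : SL(2, ℤ) :=
  ⟨!![a, b; c, d], by rw [Matrix.det_fin_two_of]; exact h⟩

@[simp] lemma slMk_zero_zero {a b c d : ℤ} (h) : slMk a b c d h 0 0 = a := rfl
@[simp] lemma slMk_zero_one {a b c d : ℤ} (h) : slMk a b c d h 0 1 = b := rfl
@[simp] lemma slMk_one_zero {a b c d : ℤ} (h) : slMk a b c d h 1 0 = c := rfl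
@[simp] lemma slMk_one_one {a b c d : ℤ} (h) : slMk a b c d h 1 1 = d := rfl

lemma sl_mul_apply (γ δ : SL(2, ℤ)) (i j : Fin 2) :
    (γ * δ) i j = γ i 0 * δ 0 j + γ i 1 * δ 1 j := by
  rw [Matrix.SpecialLinearGroup.coe_mul, Matrix.mul_apply, Fin.sum_univ_two]

lemma coe_smul_eq (γ : SL(2, ℤ)) (τ : ℍ) :
    ((γ • τ : ℍ) : ℂ) = (γ 0 0 * τ + γ 0 1) / (γ 1 0 * τ + γ 1 1) := by
  rw [UpperHalfPlane.coe_specialLinearGroup_apply]; simp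

lemma denom_ne (γ : SL(2, ℤ)) (τ : ℍ) : (γ 1 0 * τ + γ 1 1 : ℂ) ≠ 0 := by
  simpa [UpperHalfPlane.denom] using UpperHalfPlane.denom_ne_zero γ τ

lemma det_eq (γ : SL(2, ℤ)) : γ 0 0 * γ 1 1 - γ 0 1 * γ 1 0 = 1 := by
  rw [← Matrix.det_fin_two]; exact γ.2

lemma phi_smul_of_lower (γ : SL(2, ℤ)) (h0 : γ 0 1 = 0) (hc : Even (γ 1 0)) (τ : ℍ) :
    phi (γ • τ : ℍ) = phi τ := by
  have hdet := det_eq γ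
  have hτ := τ.ne_zero
  rw [← psi_neg_inv (γ • τ), ← psi_neg_inv τ]
  obtain ⟨k, hk⟩ := hc
  rw [← psi_add_even (-1 / (τ : ℂ)) (-(γ 0 0 * k))]
  congr 1
  have hden := denom_ne γ τ
  rw [coe_smul_eq]
  rw [h0, zero_mul, sub_zero] at hdet
  have hd : (γ 0 0 : ℂ) * γ 1 1 = 1 := by exact_mod_cast hdet
  have ha : (γ 0 0 : ℂ) ≠ 0 := left_ne_zero_of_mul_eq_one hd
  have ha2 : (γ 0 0 : ℂ) * γ 0 0 = 1 := by
    rcases Int.eq_one_or_neg_one_of_mul_eq_one hdet with h | h <;> rw [h] <;> norm_num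
  rw [h0, hk] at *
  push_cast at *
  rw [add_zero]
  field_simp
  linear_combination (2 * k * τ + γ 1 1) * ha2 - γ 0 0 * hd

lemma phi_smul (γ : SL(2, ℤ)) (hb : Even (γ 0 1)) (hc : Even (γ 1 0)) (τ : ℍ) :
    phi (γ • τ : ℍ) = rootSixteen ^ (γ 0 0 * γ 0 1 + γ 0 0 ^ 2 - 1) * phi τ := by
  induction hn : (γ 0 0).natAbs + (γ 0 1).natAbs using Nat.strong_induction_on generalizing γ τ with
  | _ n ih =>
  have hdet := det_eq γ
  have ha : Odd (γ 0 0) := by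
    by_contra h
    rw [Int.not_odd_iff_even] at h
    have : Even (1 : ℤ) := hdet ▸ (h.mul_right _).sub (hb.mul_right _)
    exact absurd this (by decide)
  by_cases h0 : γ 0 1 = 0
  · rw [phi_smul_of_lower γ h0 hc]
    rw [h0, zero_mul, sub_zero] at hdet
    rcases Int.eq_one_or_neg_one_of_mul_eq_one hdet with h | h <;> simp [h, h0]
  rcases lt_or_ge (γ 0 0).natAbs (γ 0 1).natAbs with hlt | hge
  · obtain ⟨ε, hε⟩ : ∃ ε : ℤ, (γ 0 1 - 2 * ε * γ 0 0).natAbs < (γ 0 1).natAbs := by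
      rcases le_total 0 (γ 0 0 * γ 0 1) with hs | hs
      · refine ⟨1, ?_⟩
        rcases mul_nonneg_iff.1 hs with h | h <;> grind
      · refine ⟨-1, ?_⟩
        rcases mul_nonpos_iff.1 hs with h | h <;> grind
    let t (k : ℤ) : SL(2, ℤ) := slMk 1 (2 * k) 0 1 (by ring)
    have e : γ = (γ * t (-ε)) * t ε := by
      rw [mul_assoc, show t (-ε) * t ε = 1 by
        ext i j; fin_cases i <;> fin_cases j <;> simp [t, sl_mul_apply], mul_one]
    have e00 : (γ * t (-ε)) 0 0 = γ 0 0 := by simp [t, sl_mul_apply]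
    have e01 : (γ * t (-ε)) 0 1 = γ 0 1 - 2 * ε * γ 0 0 := by
      simp [t, sl_mul_apply]; ring
    have e10 : (γ * t (-ε)) 1 0 = γ 1 0 := by simp [t, sl_mul_apply]
    have et : ((t ε • τ : ℍ) : ℂ) = τ + 2 * ε := by
      rw [coe_smul_eq]; simp [t]
    have := ih (((γ * t (-ε)) 0 0).natAbs + ((γ * t (-ε)) 0 1).natAbs)
      (by rw [← hn, e00, e01]; omega) (γ * t (-ε)) (by rw [e01]; grind) (by rwa [e10]) (t ε • τ) rfl
    rw [← mul_smul, ← e, et, phi_add_even', e00, e01, ← mul_assoc,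
      ← zpow_add₀ rootSixteen_ne_zero] at this
    rw [this]
    congr 1
    apply rootSixteen_zpow_eq
    obtain ⟨k, hk⟩ := ha
    obtain ⟨m, hm⟩ := Int.even_mul_succ_self k
    exact ⟨-(ε * m), by rw [hk]; linear_combination (-8 * ε) * hm⟩
  · obtain ⟨ε, hε⟩ : ∃ ε : ℤ, (γ 0 0 - 2 * ε * γ 0 1).natAbs < (γ 0 0).natAbs := by
      rcases le_total 0 (γ 0 0 * γ 0 1) with hs | hs
      · refine ⟨1, ?_⟩
        rcases mul_nonneg_iff.1 hs with h | h <;> grind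
      · refine ⟨-1, ?_⟩
        rcases mul_nonpos_iff.1 hs with h | h <;> grind
    let t (k : ℤ) : SL(2, ℤ) := slMk 1 0 (2 * k) 1 (by ring)
    have e : γ = (γ * t (-ε)) * t ε := by
      rw [mul_assoc, show t (-ε) * t ε = 1 by
        ext i j; fin_cases i <;> fin_cases j <;> simp [t, sl_mul_apply], mul_one]
    have e00 : (γ * t (-ε)) 0 0 = γ 0 0 - 2 * ε * γ 0 1 := by
      simp [t, sl_mul_apply]; ring
    have e01 : (γ * t (-ε)) 0 1 = γ 0 1 := by simp [t, sl_mul_apply]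
    have e10 : (γ * t (-ε)) 1 0 = γ 1 0 - 2 * ε * γ 1 1 := by
      simp [t, sl_mul_apply]; ring
    have := ih (((γ * t (-ε)) 0 0).natAbs + ((γ * t (-ε)) 0 1).natAbs)
      (by rw [← hn, e00, e01]; omega) (γ * t (-ε)) (by rwa [e01]) (by rw [e10]; grind) (t ε • τ) rfl
    rw [← mul_smul, ← e, e00, e01, phi_smul_of_lower (t ε) (by simp [t])
      (by simp [t])] at this
    rw [this]
    congr 1
    apply rootSixteen_zpow_eq
    obtain ⟨β, hβ⟩ := hb
    obtain ⟨m, hm⟩ : Even (β * (β + γ 0 0)) := by grind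
    exact ⟨ε ^ 2 * β ^ 2 - ε * m, by rw [hβ]; linear_combination (-8 * ε) * hm⟩

lemma psi_smul (γ : SL(2, ℤ)) (hb : Even (γ 0 1)) (hc : Even (γ 1 0)) (τ : ℍ) :
    psi (γ • τ : ℍ) = rootSixteen ^ (γ 1 1 ^ 2 - 1 - γ 1 0 * γ 1 1) * psi τ := by
  have hdet := det_eq γ
  have hτ := τ.ne_zero
  let δ := slMk (γ 1 1) (-γ 1 0) (-γ 0 1) (γ 0 0) (by linear_combination hdet)
  have hS (σ : ℍ) : ((ModularGroup.S • σ : ℍ) : ℂ) = -1 / σ := by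
    rw [modular_S_smul]; simp [neg_div]
  have e : ModularGroup.S * γ = δ * ModularGroup.S := by
    ext i j
    rw [sl_mul_apply, sl_mul_apply]
    fin_cases i <;> fin_cases j <;> simp [δ, ModularGroup.S]
  rw [← phi_neg_inv, ← phi_neg_inv τ, ← hS, ← hS, ← mul_smul, e, mul_smul,
    phi_smul δ (by simpa [δ] using hc) (by simpa [δ] using hb)]
  congr 2
  simp only [δ, slMk_zero_zero, slMk_zero_one]
  ring

/-- Multiplication by a positive real on the upper half plane. -/
def scale (r : ℝ) (hr : 0 < r) (τ : ℍ) : ℍ :=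
  ⟨r * τ, by rw [Complex.im_ofReal_mul]; exact mul_pos hr τ.im_pos⟩

@[simp] lemma coe_scale (r : ℝ) (hr : 0 < r) (τ : ℍ) : (scale r hr τ : ℂ) = r * τ := rfl

lemma im_scale (r : ℝ) (hr : 0 < r) (τ : ℍ) : (scale r hr τ).im = r * τ.im := by
  simp [← coe_im]

lemma tendsto_scale (r : ℝ) (hr : 0 < r) : Tendsto (scale r hr) atImInfty atImInfty := by
  rw [atImInfty, tendsto_comap_iff]
  exact (tendsto_comap.const_mul_atTop hr).congr fun τ ↦ (im_scale r hr τ).symm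

lemma tendsto_vadd (r : ℝ) : Tendsto (fun τ : ℍ ↦ r +ᵥ τ) atImInfty atImInfty := by
  rw [atImInfty, tendsto_comap_iff]
  exact tendsto_comap.congr fun τ ↦ (vadd_im r τ).symm

section Decomposition

variable {p : ℕ} (hp : (0 : ℝ) < p)

lemma scale_smul_of_dvd (γ : SL(2, ℤ)) {c : ℤ} (hc : γ 1 0 = p * c) (τ : ℍ) :
    scale p hp (γ • τ) = slMk (γ 0 0) (p * γ 0 1) c (γ 1 1)
      (by linear_combination det_eq γ + γ 0 1 * hc) • scale p hp τ := by
  ext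
  rw [coe_scale, coe_smul_eq, coe_smul_eq]
  simp only [slMk_zero_zero, slMk_zero_one, slMk_one_zero, slMk_one_one, coe_scale, hc]
  push_cast
  ring

lemma scale_smul_of_eq (γ : SL(2, ℤ)) {k d : ℤ} (hd : γ 1 1 = p * d + k * γ 1 0) (τ : ℍ) :
    scale p hp (γ • τ) = slMk (p * γ 0 0) (γ 0 1 - k * γ 0 0) (γ 1 0) d
      (by linear_combination det_eq γ - γ 0 0 * hd) •
        scale (p : ℝ)⁻¹ (inv_pos.2 hp) ((k : ℝ) +ᵥ τ) := by
  have hp' : (p : ℂ) ≠ 0 := by exact_mod_cast hp.ne'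
  have h1 := denom_ne γ τ
  ext
  rw [coe_scale, coe_smul_eq, coe_smul_eq]
  simp only [slMk_zero_zero, slMk_zero_one, slMk_one_zero, slMk_one_one, coe_scale, coe_vadd]
  have e : (γ 1 0 : ℂ) * (((p : ℝ)⁻¹ : ℝ) * ((k : ℝ) + τ)) + d =
      (γ 1 0 * τ + γ 1 1) / p := by
    rw [hd]; push_cast; field_simp; ring
  rw [e]
  push_cast
  field_simp
  ring

end Decomposition

lemma exists_eq_of_not_dvd {p : ℕ} (hp : p.Prime) (hodd : Odd p) {c d : ℤ}
    (hc : ¬ (p : ℤ) ∣ c) : ∃ k e : ℤ, d = p * e + 16 * k * c := by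
  have hco : IsCoprime (p : ℤ) (16 * c) := by
    refine IsCoprime.mul_right ?_ ((Nat.prime_iff_prime_int.1 hp).coprime_iff_not_dvd.2 hc)
    have := Nat.Coprime.pow_right 4 (Nat.coprime_two_right.2 hodd)
    exact_mod_cast Nat.isCoprime_iff_coprime.2 this
  obtain ⟨x, y, h⟩ := hco
  exact ⟨y * d, x * d, by linear_combination (-d) * h⟩

/-- The modular function `u = (αβ)^{d/8}`. -/
noncomputable def modU (p d : ℕ) (z : ℂ) : ℂ := (phi z * phi (p * z)) ^ d

/-- The modular function `v = ((1-α)(1-β))^{d/8}`. -/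
noncomputable def modV (p d : ℕ) (z : ℂ) : ℂ := (psi z * psi (p * z)) ^ d

lemma rootSixteen_mul_pow_eq {m n : ℤ} {d : ℕ} (h : (16 : ℤ) ∣ d * (m + n)) (x y : ℂ) :
    (rootSixteen ^ m * x * (rootSixteen ^ n * y)) ^ d = (x * y) ^ d := by
  rw [mul_mul_mul_comm, mul_pow, ← zpow_add₀ rootSixteen_ne_zero, ← zpow_natCast (_ ^ _ : ℂ),
    ← zpow_mul, rootSixteen_zpow_eq (n := 0) (by rwa [sub_zero, mul_comm]), zpow_zero, one_mul]

lemma odd_of_det {a b c d : ℤ} (h : a * d - b * c = 1) (hbc : Even b ∨ Even c) :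
    Odd a ∧ Odd d := by
  have h1 : Odd (a * d) := by
    rw [show a * d = b * c + 1 by linarith]
    exact (hbc.elim (fun h ↦ h.mul_right _) fun h ↦ h.mul_left _).add_one
  exact Int.odd_mul.1 h1

lemma eight_dvd_sq_sub_one {a : ℤ} (ha : Odd a) : ∃ m, a ^ 2 - 1 = 8 * m := by
  obtain ⟨k, rfl⟩ := ha
  obtain ⟨m, hm⟩ := Int.even_mul_succ_self k
  exact ⟨m, by linear_combination 4 * hm⟩

lemma modUV_smul_of_dvd {p d n : ℕ} (hodd : Odd p) (h8 : 8 * n = d * (p + 1))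
    (hp : (0 : ℝ) < p) (γ : SL(2, ℤ)) (hb : Even (γ 0 1)) (hc : Even (γ 1 0))
    (hpc : (p : ℤ) ∣ γ 1 0) (τ : ℍ) :
    modU p d (γ • τ : ℍ) = modU p d τ ∧ modV p d (γ • τ : ℍ) = modV p d τ := by
  obtain ⟨c, hpc⟩ := hpc
  have hc' : Even c := by
    rw [hpc, Int.even_mul] at hc
    exact hc.resolve_left (by simpa using hodd)
  have key := scale_smul_of_dvd hp γ hpc τ
  have hcoe (σ : ℍ) : (p : ℂ) * σ = scale p hp σ := rfl
  obtain ⟨ha, hd⟩ := odd_of_det (det_eq γ) (.inl hb)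
  obtain ⟨m, hm⟩ := eight_dvd_sq_sub_one ha
  obtain ⟨m', hm'⟩ := eight_dvd_sq_sub_one hd
  have h8' : (8 : ℤ) * n = d * (p + 1) := by exact_mod_cast h8
  have kphi := phi_smul (slMk _ _ _ _ _) (by rw [slMk_zero_one]; exact hb.mul_left _)
    (by rwa [slMk_one_zero]) (scale p hp τ) |> (congrArg (fun z : ℍ ↦ phi z) key).trans
  have kpsi := psi_smul (slMk _ _ _ _ _) (by rw [slMk_zero_one]; exact hb.mul_left _)
    (by rwa [slMk_one_zero]) (scale p hp τ) |> (congrArg (fun z : ℍ ↦ psi z) key).trans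
  simp only [slMk_zero_zero, slMk_zero_one, slMk_one_zero, slMk_one_one] at kphi kpsi
  rw [modU, modV, hcoe, kphi, kpsi, phi_smul γ hb hc, psi_smul γ hb hc, modU, modV]
  obtain ⟨b', hb'⟩ := hb
  obtain ⟨c', rfl⟩ := hc'
  constructor
  · refine rootSixteen_mul_pow_eq ?_ _ _
    exact ⟨n * γ 0 0 * b' + d * m, by
      rw [hb']; linear_combination 2 * d * hm - 2 * γ 0 0 * b' * h8'⟩
  · refine rootSixteen_mul_pow_eq ?_ _ _
    exact ⟨-(n * γ 1 1 * c') + d * m', by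
      rw [hpc]; linear_combination 2 * d * hm' + 2 * γ 1 1 * c' * h8'⟩

lemma modUV_smul_of_eq {p d n : ℕ} (hodd : Odd p) (h8 : 8 * n = d * (p + 1))
    (hp : (0 : ℝ) < p) (γ : SL(2, ℤ)) (hb : Even (γ 0 1)) (hc : Even (γ 1 0))
    {k e : ℤ} (hd : γ 1 1 = p * e + 16 * k * γ 1 0) (τ : ℍ) :
    modU p d (γ • τ : ℍ) =
        modU p d (scale (p : ℝ)⁻¹ (inv_pos.2 hp) (((16 * k : ℤ) : ℝ) +ᵥ τ)) ∧
      modV p d (γ • τ : ℍ) =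
        modV p d (scale (p : ℝ)⁻¹ (inv_pos.2 hp) (((16 * k : ℤ) : ℝ) +ᵥ τ)) := by
  have hp' : (p : ℂ) ≠ 0 := by exact_mod_cast hp.ne'
  have key := scale_smul_of_eq hp γ hd τ
  set σ := scale (p : ℝ)⁻¹ (inv_pos.2 hp) (((16 * k : ℤ) : ℝ) +ᵥ τ) with hσ
  have hστ : (p : ℂ) * σ = τ + 2 * (8 * k : ℤ) := by
    rw [hσ]; simp only [coe_scale, coe_vadd]; push_cast; field_simp; ring
  have hphi : phi (p * σ) = phi τ := by
    rw [hστ, phi_add_even', rootSixteen_zpow_eq (n := 0) ⟨k, by ring⟩, zpow_zero, one_mul]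
  have hpsi : psi (p * σ) = psi τ := by rw [hστ, psi_add_even]
  have hcoe : (p : ℂ) * (γ • τ : ℍ) = scale p hp (γ • τ) := rfl
  obtain ⟨ha, hd'⟩ := odd_of_det (det_eq γ) (.inl hb)
  have he : Odd e := by
    have h1 : Odd ((p : ℤ) * e) := by rw [hd] at hd'; grind
    exact (Int.odd_mul.1 h1).2
  obtain ⟨m, hm⟩ := eight_dvd_sq_sub_one ha
  obtain ⟨m', hm'⟩ := eight_dvd_sq_sub_one he
  have hpodd : Odd (p : ℤ) := by exact_mod_cast hodd
  have h8' : (8 : ℤ) * n = d * (p + 1) := by exact_mod_cast h8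
  have hb2 : Even (γ 0 1 - 16 * k * γ 0 0) := hb.sub ⟨8 * k * γ 0 0, by ring⟩
  have kphi := phi_smul (slMk _ _ _ _ _) (by rwa [slMk_zero_one])
    (by rwa [slMk_one_zero]) σ |> (congrArg (fun z : ℍ ↦ phi z) key).trans
  have kpsi := psi_smul (slMk _ _ _ _ _) (by rwa [slMk_zero_one])
    (by rwa [slMk_one_zero]) σ |> (congrArg (fun z : ℍ ↦ psi z) key).trans
  simp only [slMk_zero_zero, slMk_zero_one, slMk_one_zero, slMk_one_one] at kphi kpsi
  rw [modU, modV, hcoe, kphi, kpsi, phi_smul γ hb hc, psi_smul γ hb hc, ← hphi, ← hpsi,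
    modU, modV, mul_comm (phi σ),
    mul_comm (psi σ)]
  obtain ⟨b', hb'⟩ := hb
  obtain ⟨c', hc'⟩ := hc
  obtain ⟨r, hr⟩ := hpodd
  constructor
  · refine rootSixteen_mul_pow_eq ?_ _ _
    exact ⟨n * γ 0 0 * b' - d * k * p * γ 0 0 ^ 2 + d * m * (2 * r ^ 2 + 2 * r + 1) + n * r, by
      have hp2 : (p : ℤ) ^ 2 = 4 * r ^ 2 + 4 * r + 1 := by rw [hr]; ring
      linear_combination d * γ 0 0 * (p + 1) * hb' + d * (1 + p ^ 2) * hm + 8 * d * m * hp2 -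
        (2 * γ 0 0 * b' + (p - 1)) * h8' + 8 * n * hr⟩
  · refine rootSixteen_mul_pow_eq ?_ _ _
    exact ⟨d * m' * (2 * r ^ 2 + 2 * r + 1) + n * r - n * e * c' +
        d * (2 * k * p * e * γ 1 0 + 16 * k ^ 2 * γ 1 0 ^ 2 - k * γ 1 0 ^ 2), by
      have hp2 : (p : ℤ) ^ 2 = 4 * r ^ 2 + 4 * r + 1 := by rw [hr]; ring
      rw [hd]
      linear_combination d * (1 + p ^ 2) * hm' + 8 * d * m' * hp2 - d * e * (p + 1) * hc' +
        (2 * e * c' - (p - 1)) * h8' + 8 * n * hr⟩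

lemma norm_rootSixteen_zpow (k : ℤ) : ‖rootSixteen ^ k‖ = 1 := by
  have : (2 * π * I / 16 : ℂ) = ((2 * π / 16 : ℝ) : ℂ) * I := by push_cast; ring
  rw [norm_zpow, rootSixteen, this, Complex.norm_exp_ofReal_mul_I, one_zpow]

lemma exists_eq_mul_of_even (γ : SL(2, ℤ)) (hc : Even (γ 1 0)) :
    ∃ (γ' : SL(2, ℤ)) (b : ℤ), Even (γ' 0 1) ∧ Even (γ' 1 0) ∧
      ∀ τ : ℍ, γ • τ = γ' • ((b : ℝ) +ᵥ τ) := by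
  have hdet := det_eq γ
  obtain ⟨ha, -⟩ := odd_of_det hdet (.inr hc)
  refine ⟨γ * slMk 1 (-γ 0 1) 0 1 (by ring), γ 0 1, ?_, ?_, fun τ ↦ ?_⟩
  · rw [sl_mul_apply, slMk_zero_one, slMk_one_one,
      show γ 0 0 * -γ 0 1 + γ 0 1 * 1 = γ 0 1 * (1 - γ 0 0) by ring]
    exact (odd_one.sub_odd ha).mul_left _
  · rw [sl_mul_apply]; simpa using hc
  · rw [mul_smul]
    congr 1
    ext
    rw [coe_smul_eq]; simp

lemma exists_eq_mul_of_odd (γ : SL(2, ℤ)) (hc : Odd (γ 1 0)) :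
    ∃ (γ' δ : SL(2, ℤ)) (j k : ℤ), Even (γ' 0 1) ∧ Even (γ' 1 0) ∧ γ = γ' * δ ∧
      ∀ τ : ℍ, ((δ • τ : ℍ) : ℂ) = -1 / ((k : ℝ) +ᵥ τ : ℍ) + j := by
  have hdet := det_eq γ
  set a := γ 0 0
  set b := γ 0 1
  set c := γ 1 0
  set d := γ 1 1
  let δ := slMk a (a * d - 1) 1 d (by ring)
  let δ' := slMk d (1 - a * d) (-1) a (by ring)
  have hδ : δ' * δ = 1 := by
    ext i j
    rw [sl_mul_apply]
    fin_cases i <;> fin_cases j <;> simp [δ, δ'] <;> ring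
  have h1c : Even (1 - c) := odd_one.sub_odd hc
  refine ⟨γ * δ', δ, a, d, ?_, ?_, by rw [mul_assoc, hδ, mul_one], fun τ ↦ ?_⟩
  · rw [sl_mul_apply]
    change Even (a * (1 - a * d) + b * a)
    rw [show a * (1 - a * d) + b * a = a * b * (1 - c) by linear_combination -a * hdet]
    exact h1c.mul_left _
  · rw [sl_mul_apply]
    change Even (c * d + d * (-1))
    rw [show c * d + d * (-1) = -d * (1 - c) by ring]
    exact h1c.mul_left _
  · have hne := denom_ne δ τ
    rw [coe_smul_eq]
    simp only [δ, slMk_zero_zero, slMk_zero_one, slMk_one_zero, slMk_one_one, coe_vadd] at hne ⊢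
    push_cast at hne ⊢
    rw [one_mul] at hne
    rw [one_mul, add_comm (d : ℂ)]
    field_simp
    ring

lemma tendsto_psi : Tendsto (fun τ : ℍ ↦ psi τ) atImInfty (𝓝 1) :=
  tendsto_comp_qParam two_pos (tendsto_prodB.mono_left nhdsWithin_le_nhds)

lemma tendsto_phi_pow : Tendsto (fun τ : ℍ ↦ phi τ ^ 8) atImInfty (𝓝 0) := by
  have := (tendsto_psi.pow 8).const_sub 1
  rw [one_pow, sub_self] at this
  exact this.congr fun τ ↦ by linear_combination -phi_pow_add_psi_pow τ

lemma eventually_norm_le_of_odd (γ : SL(2, ℤ)) (hc : Odd (γ 1 0)) :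
    ∀ᶠ τ in atImInfty, ‖(phi (γ • τ : ℍ))⁻¹‖ ≤ 2 ∧
      ‖psi (γ • τ : ℍ) / phi (γ • τ : ℍ)‖ ≤ 3 := by
  obtain ⟨γ', δ, j, k, hb', hc', rfl, hδ⟩ := exists_eq_mul_of_odd γ hc
  have h1 : ∀ᶠ τ : ℍ in atImInfty, 1 / 2 < ‖psi τ‖ :=
    tendsto_psi.norm.eventually (lt_mem_nhds (by norm_num))
  have h2 : ∀ᶠ τ : ℍ in atImInfty, ‖phi τ ^ 8‖ < 1 :=
    tendsto_phi_pow.norm.eventually (gt_mem_nhds (by simp))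
  filter_upwards [(tendsto_vadd k).eventually h1, (tendsto_vadd k).eventually h2] with τ h1 h2
  have h2' : ‖phi ((k : ℝ) +ᵥ τ : ℍ)‖ ≤ 1 := by
    rw [norm_pow] at h2
    exact ((pow_lt_one_iff_of_nonneg (norm_nonneg _) (by norm_num)).1 h2).le
  set σ := (k : ℝ) +ᵥ τ with hσ
  have key : 1 / 2 ≤ ‖phi ((γ' * δ) • τ : ℍ)‖ := by
    have hS : (-1 / σ : ℂ) = (ModularGroup.S • σ : ℍ) := by
      rw [modular_S_smul]; simp [neg_div]
    rw [mul_smul, phi_smul γ' hb' hc', norm_mul, norm_rootSixteen_zpow, one_mul, hδ]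
    rcases Int.even_or_odd' j with ⟨i, rfl | rfl⟩
    · push_cast
      rw [phi_add_even', norm_mul, norm_rootSixteen_zpow, one_mul, phi_neg_inv]
      exact h1.le
    · push_cast
      have h16 : ‖exp (2 * π * I / 16)‖ = 1 := by
        simpa [rootSixteen] using norm_rootSixteen_zpow 1
      rw [add_comm (2 * (i : ℂ)), ← add_assoc, phi_add_even', norm_mul, norm_rootSixteen_zpow,
        one_mul, hS, phi_add_one, ← hS, phi_neg_inv, psi_neg_inv, norm_div, norm_mul, h16, one_mul,
        le_div_iff₀ (norm_pos_iff.2 (phi_ne_zero σ))]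
      linarith
  set ρ := (γ' * δ) • τ
  have hpos : 0 < ‖phi ρ‖ := by linarith
  have hinv : ‖(phi ρ)⁻¹‖ ≤ 2 := by
    rw [norm_inv]
    exact inv_le_of_inv_le₀ two_pos (by linarith)
  refine ⟨hinv, ?_⟩
  have e : (psi ρ / phi ρ) ^ 8 = (phi ρ)⁻¹ ^ 8 - 1 := by
    have := phi_ne_zero ρ
    field_simp
    linear_combination phi_pow_add_psi_pow ρ
  refine (pow_le_pow_iff_left₀ (norm_nonneg _) (by norm_num) (show 8 ≠ 0 by norm_num)).1 ?_
  rw [← norm_pow, e]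
  calc _ ≤ ‖(phi ρ)⁻¹ ^ 8‖ + ‖(1 : ℂ)‖ := norm_sub_le _ _
    _ ≤ 2 ^ 8 + 1 := by
      rw [norm_pow, norm_one]; gcongr
    _ ≤ 3 ^ 8 := by norm_num

lemma eventually_norm_modU_le {p : ℕ} (hp : p.Prime) (hodd : Odd p) (d : ℕ) (γ : SL(2, ℤ))
    (hc : Odd (γ 1 0)) :
    ∀ᶠ τ in atImInfty, ‖(modU p d (γ • τ : ℍ))⁻¹‖ ≤ 4 ^ d ∧
      ‖modV p d (γ • τ : ℍ) / modU p d (γ • τ : ℍ)‖ ≤ 9 ^ d := by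
  have hp0 : (0 : ℝ) < p := by exact_mod_cast hp.pos
  have key : ∃ (γ' : SL(2, ℤ)) (w : ℍ → ℍ), Odd (γ' 1 0) ∧ Tendsto w atImInfty atImInfty ∧
      ∀ τ, scale p hp0 (γ • τ) = γ' • w τ := by
    by_cases h : (p : ℤ) ∣ γ 1 0
    · obtain ⟨c, h⟩ := h
      rw [h] at hc
      exact ⟨_, _, (Int.odd_mul.1 hc).2, tendsto_scale _ hp0, scale_smul_of_dvd hp0 γ h⟩
    · obtain ⟨k, e, h⟩ := exists_eq_of_not_dvd (d := γ 1 1) hp hodd h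
      refine ⟨_, _, ?_, (tendsto_scale _ _).comp (tendsto_vadd _), scale_smul_of_eq hp0 γ h⟩
      exact hc
  obtain ⟨γ', w, hc', hw, h⟩ := key
  filter_upwards [eventually_norm_le_of_odd γ hc, hw.eventually (eventually_norm_le_of_odd γ' hc')]
    with τ h1 h2
  rw [← h τ] at h2
  have hcoe : (p : ℂ) * (γ • τ : ℍ) = scale p hp0 (γ • τ) := rfl
  rw [modU, modV, hcoe, ← div_pow, ← inv_pow, norm_pow, norm_pow, mul_inv, mul_div_mul_comm,
    norm_mul, norm_mul]
  constructor
  · gcongr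
    calc _ ≤ (2 * 2 : ℝ) := by gcongr <;> tauto
      _ = 4 := by norm_num
  · gcongr
    calc _ ≤ (3 * 3 : ℝ) := by gcongr <;> tauto
      _ = 9 := by norm_num

lemma exists_linear_combination_eq_pow_mul {ι : Type*} [Fintype ι] (f : ι → ℂ → ℂ)
    (hf : ∀ i, AnalyticAt ℂ (f i) 0) {K : ℕ} (hK : K < Fintype.card ι) :
    ∃ c : ι → ℂ, c ≠ 0 ∧ ∃ g, AnalyticAt ℂ g 0 ∧
      ∀ᶠ z in 𝓝 0, ∑ i, c i * f i z = z ^ K * g z := by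
  let L : (ι → ℂ) →ₗ[ℂ] (Fin K → ℂ) :=
    LinearMap.pi fun k ↦ ∑ i, (iteratedDeriv k (f i) 0) • LinearMap.proj i
  have hL : LinearMap.ker L ≠ ⊥ := L.ker_ne_bot_of_finrank_lt (by simpa)
  obtain ⟨c, hc, hc0⟩ := (Submodule.ne_bot_iff _).1 hL
  have hF : AnalyticAt ℂ (fun z ↦ ∑ i, c i * f i z) 0 :=
    Finset.analyticAt_fun_sum _ fun i _ ↦ analyticAt_const.mul (hf i)
  refine ⟨c, hc0, ?_⟩
  have := (natCast_le_analyticOrderAt hF (n := K)).1 <|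
    (natCast_le_analyticOrderAt_iff_iteratedDeriv_eq_zero hF).2 fun k hk ↦ by
      have h := congrFun (LinearMap.mem_ker.1 hc) ⟨k, hk⟩
      rw [iteratedDeriv_fun_sum (f := fun i z ↦ c i * f i z)
        fun i _ ↦ (analyticAt_const.mul (hf i)).contDiffAt]
      simpa [L, mul_comm] using h
  simpa using this

section Disc

variable {𝕜 : Type*} [NormedField 𝕜]

/-- The unit part of the `q`-expansion of `modU`. -/
noncomputable def discW (p d : ℕ) (q : 𝕜) : 𝕜 := (2 * (prodA q * prodA (q ^ p))) ^ d

/-- The `q`-expansion of `modV`. -/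
noncomputable def discV (p d : ℕ) (q : 𝕜) : 𝕜 := (prodB q * prodB (q ^ p)) ^ d

end Disc

variable {p d n : ℕ}

lemma differentiableOn_comp_pow {g : ℂ → ℂ} (hg : DifferentiableOn ℂ g (Metric.ball 0 1))
    (hp : p ≠ 0) : DifferentiableOn ℂ (fun q ↦ g (q ^ p)) (Metric.ball 0 1) :=
  hg.comp (differentiableOn_pow p) (mapsTo_pow_ball hp)

lemma differentiableOn_discW (hp : p ≠ 0) :
    DifferentiableOn ℂ (discW p d : ℂ → ℂ) (Metric.ball 0 1) :=
  ((differentiableOn_prodA.mul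
    (differentiableOn_comp_pow differentiableOn_prodA hp)).const_mul 2).pow d

lemma differentiableOn_discV (hp : p ≠ 0) :
    DifferentiableOn ℂ (discV p d : ℂ → ℂ) (Metric.ball 0 1) :=
  (differentiableOn_prodB.mul (differentiableOn_comp_pow differentiableOn_prodB hp)).pow d

lemma qParam_two_natCast_mul (p : ℕ) (z : ℂ) :
    Periodic.qParam 2 (p * z) = Periodic.qParam 2 z ^ p :=
  (qParam_pow_eq p 2 2 z (p * z) rfl).symm

lemma modV_eq (z : ℂ) : modV p d z = discV p d (Periodic.qParam 2 z) := by
  rw [modV, discV, psi, psi, qParam_two_natCast_mul]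

lemma modU_eq (h8 : 8 * n = d * (p + 1)) (z : ℂ) :
    modU p d z = Periodic.qParam 2 z ^ n * discW p d (Periodic.qParam 2 z) := by
  have h22 : (√2 : ℂ) ^ 2 = 2 := by
    rw [← Complex.ofReal_pow, Real.sq_sqrt zero_le_two]; simp
  have h1 : Periodic.qParam 16 (p * z) = Periodic.qParam 16 z ^ p :=
    (qParam_pow_eq p 16 16 z (p * z) rfl).symm
  have h2 : Periodic.qParam 16 z ^ 8 = Periodic.qParam 2 z :=
    qParam_pow_eq 8 16 2 z z (by push_cast; ring)
  have h3 : Periodic.qParam 2 z ^ n = (Periodic.qParam 16 z ^ (p + 1)) ^ d := by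
    rw [← h2, ← pow_mul, h8, mul_comm d, pow_mul]
  rw [modU, discW, phi, phi, qParam_two_natCast_mul, h1, h3, ← mul_pow, ← h22]
  ring

lemma modU_ne_zero (hp : 0 < p) (τ : ℍ) : modU p d τ ≠ 0 :=
  pow_ne_zero _ (mul_ne_zero (phi_ne_zero τ)
    (phi_ne_zero (scale p (by exact_mod_cast hp) τ)))

lemma differentiableOn_modU (hp : p ≠ 0) (h8 : 8 * n = d * (p + 1)) :
    DifferentiableOn ℂ (modU p d) upperHalfPlaneSet := by
  simp_rw [funext (modU_eq h8)]
  exact (Function.Periodic.differentiable_qParam.differentiableOn.pow n).mul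
    ((differentiableOn_discW hp).comp Function.Periodic.differentiable_qParam.differentiableOn
      mapsTo_qParam)

lemma differentiableOn_modV (hp : p ≠ 0) :
    DifferentiableOn ℂ (modV p d) upperHalfPlaneSet := by
  simp_rw [funext modV_eq]
  exact (differentiableOn_discV hp).comp
    Function.Periodic.differentiable_qParam.differentiableOn mapsTo_qParam

lemma exists_relation_tendsto (hp : p ≠ 0) (h8 : 8 * n = d * (p + 1)) (hn : 0 < n) :
    ∃ c : Fin (n ^ 2 + 1) × Fin (n + 1) → ℂ, c ≠ 0 ∧ Tendsto (fun τ : ℍ ↦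
      (∑ x, c x * (modU p d τ ^ (x.1 : ℕ) * modV p d τ ^ (x.2 : ℕ))) / modU p d τ ^ (n ^ 2 + n))
      atImInfty (𝓝 0) := by
  have hW : AnalyticAt ℂ (discW p d : ℂ → ℂ) 0 :=
    (differentiableOn_discW hp).analyticAt (Metric.ball_mem_nhds _ one_pos)
  have hV : AnalyticAt ℂ (discV p d : ℂ → ℂ) 0 :=
    (differentiableOn_discV hp).analyticAt (Metric.ball_mem_nhds _ one_pos)
  have hW0 : discW p d (0 : ℂ) ≠ 0 := by simp [discW, hp]
  obtain ⟨c, hc, g, hg, hgc⟩ := exists_linear_combination_eq_pow_mul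
    (fun (x : Fin (n ^ 2 + 1) × Fin (n + 1)) (q : ℂ) ↦
      (q ^ n * discW p d q) ^ (x.1 : ℕ) * discV p d q ^ (x.2 : ℕ))
    (fun x ↦ (((analyticAt_id.pow n).mul hW).pow _).mul (hV.pow _))
    (K := n * (n ^ 2 + n) + 1) (by simp; nlinarith)
  refine ⟨c, hc, ?_⟩
  have hlim : Tendsto (fun q : ℂ ↦ q * g q / discW p d q ^ (n ^ 2 + n)) (𝓝[≠] 0) (𝓝 0) := by
    have h : ContinuousAt (fun q : ℂ ↦ q * g q / discW p d q ^ (n ^ 2 + n)) 0 :=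
      (continuousAt_id.mul hg.continuousAt).div (hW.continuousAt.pow _) (pow_ne_zero _ hW0)
    simpa using h.tendsto.mono_left nhdsWithin_le_nhds
  refine (tendsto_comp_qParam two_pos (hlim.congr' (f₂ := fun q ↦
    (∑ x, c x * ((q ^ n * discW p d q) ^ (x.1 : ℕ) * discV p d q ^ (x.2 : ℕ))) /
      (q ^ n * discW p d q) ^ (n ^ 2 + n)) ?_)).congr fun τ ↦ ?_
  · filter_upwards [nhdsWithin_le_nhds hgc, self_mem_nhdsWithin,
      nhdsWithin_le_nhds (hW.continuousAt.eventually_ne hW0)] with q h1 h2 h3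
    have h2' : q ≠ 0 := h2
    rw [h1, mul_pow, ← pow_mul]
    field_simp
    ring
  · simp_rw [modU_eq h8, modV_eq]

/-- The polynomial relation between `modU` and `modV`. -/
lemma exists_relation (hp : p.Prime) (hodd : Odd p) (h8 : 8 * n = d * (p + 1)) (hn : 0 < n) :
    ∃ c : Fin (n ^ 2 + 1) × Fin (n + 1) → ℂ, c ≠ 0 ∧ ∀ τ : ℍ,
      ∑ x, c x * (modU p d τ ^ (x.1 : ℕ) * modV p d τ ^ (x.2 : ℕ)) = 0 := by
  obtain ⟨c, hc, hlim⟩ := exists_relation_tendsto hp.ne_zero h8 hn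
  refine ⟨c, hc, ?_⟩
  set N := n ^ 2 + n with hN
  let G : ℂ → ℂ := fun z ↦
    (∑ x, c x * (modU p d z ^ (x.1 : ℕ) * modV p d z ^ (x.2 : ℕ))) / modU p d z ^ N
  have hG {z w : ℂ} (h : modU p d z = modU p d w ∧ modV p d z = modV p d w) : G z = G w := by
    simp only [G, h.1, h.2]
  have hp0 : (0 : ℝ) < p := by exact_mod_cast hp.pos
  have hU := modU_ne_zero (d := d) hp.pos
  have hd : DifferentiableOn ℂ G upperHalfPlaneSet := by
    have hdU := differentiableOn_modU hp.ne_zero h8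
    have hdV := differentiableOn_modV (d := d) hp.ne_zero
    exact (DifferentiableOn.fun_sum fun x _ ↦ ((hdU.pow _).mul (hdV.pow _)).const_mul (c x)).div
      (hdU.pow N) fun z hz ↦ pow_ne_zero _ (hU ⟨z, hz⟩)
  have : NeZero (2 * p) := ⟨mul_ne_zero two_ne_zero hp.ne_zero⟩
  have hinv : ∀ γ ∈ CongruenceSubgroup.Gamma (2 * p), ∀ τ : ℍ, G (γ • τ : ℍ) = G τ := by
    intro γ hγ τ
    obtain ⟨-, hb, hc, -⟩ := CongruenceSubgroup.Gamma_mem.1 hγ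
    rw [ZMod.intCast_zmod_eq_zero_iff_dvd] at hb hc
    push_cast at hb hc
    exact hG (modUV_smul_of_dvd hodd h8 hp0 γ (even_iff_two_dvd.2 (dvd_of_mul_right_dvd hb))
      (even_iff_two_dvd.2 (dvd_of_mul_right_dvd hc)) (dvd_of_mul_left_dvd hc) τ)
  have hbdd (γ : SL(2, ℤ)) : IsBoundedAtImInfty fun τ ↦ G (γ • τ : ℍ) := by
    rcases Int.even_or_odd (γ 1 0) with hc | hc
    · obtain ⟨γ', b, hb', hc', h⟩ := exists_eq_mul_of_even γ hc
      by_cases hpc : (p : ℤ) ∣ γ' 1 0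
      · refine ((hlim.comp (tendsto_vadd b)).congr fun τ ↦ ?_).isBigO_one ℝ
        rw [h]
        exact (hG (modUV_smul_of_dvd hodd h8 hp0 γ' hb' hc' hpc _)).symm
      · obtain ⟨k, e, hke⟩ := exists_eq_of_not_dvd (d := γ' 1 1) hp hodd hpc
        refine ((hlim.comp ((tendsto_scale (p : ℝ)⁻¹ (inv_pos.2 hp0)).comp
          ((tendsto_vadd ((16 * k : ℤ) : ℝ)).comp (tendsto_vadd b)))).congr fun τ ↦ ?_).isBigO_one ℝ
        rw [h]
        exact (hG (modUV_smul_of_eq hodd h8 hp0 γ' hb' hc' hke _)).symm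
    · refine Asymptotics.IsBigO.of_bound
        (∑ x, ‖c x‖ * ((4 ^ d) ^ (N - x.1 - x.2) * (9 ^ d) ^ (x.2 : ℕ))) ?_
      filter_upwards [eventually_norm_modU_le hp hodd d γ hc] with τ ⟨h1, h2⟩
      have hUτ := hU (γ • τ)
      set u := modU p d (γ • τ : ℍ) with hu
      set v := modV p d (γ • τ : ℍ) with hv
      have e : G (γ • τ : ℍ) =
          ∑ x, c x * (u⁻¹ ^ (N - x.1 - x.2) * (v / u) ^ (x.2 : ℕ)) := by
        simp only [G, ← hu, ← hv, Finset.sum_div]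
        refine Finset.sum_congr rfl fun x _ ↦ ?_
        obtain ⟨m, hm⟩ : ∃ m, N = m + x.2 + x.1 :=
          ⟨N - x.1 - x.2, by have := x.1.2; have := x.2.2; omega⟩
        rw [show N - x.1 - x.2 = m by omega, hm, pow_add, pow_add, div_pow, inv_pow]
        field_simp
      rw [e, Pi.one_apply, norm_one, mul_one]
      refine (norm_sum_le _ _).trans (Finset.sum_le_sum fun x _ ↦ ?_)
      rw [norm_mul, norm_mul, norm_pow, norm_pow]
      gcongr
  obtain ⟨C, hC⟩ := exists_forall_eq_of_invariant (CongruenceSubgroup.Gamma (2 * p)) hd hinv hbdd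
  have hC0 : C = 0 := tendsto_nhds_unique (tendsto_const_nhds.congr fun τ ↦ (hC τ).symm) hlim
  intro τ
  have := hC τ
  rw [hC0] at this
  exact (div_eq_zero_iff.1 this).resolve_right (pow_ne_zero _ (hU τ))

open Polynomial Polynomial.Bivariate

section Bivariate

variable {R K : Type*} [CommRing R] [Field K]

lemma exists_prime_mem_dvd [IsDomain R] [UniqueFactorizationMonoid R] {I : Ideal R}
    (hI : I.IsPrime) {f : R} (hf : f ∈ I) (hf0 : f ≠ 0) : ∃ a ∈ I, Prime a ∧ a ∣ f := by
  have h : (UniqueFactorizationMonoid.factors f).prod ∈ I := by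
    obtain ⟨u, hu⟩ := UniqueFactorizationMonoid.factors_prod hf0
    rwa [← hu, Ideal.mul_unit_mem_iff_mem _ u.isUnit] at hf
  obtain ⟨a, ha, haI⟩ := (hI.multiset_prod_mem_iff_exists_mem _).1 h
  exact ⟨a, haI, UniqueFactorizationMonoid.prime_of_factor a ha,
    UniqueFactorizationMonoid.dvd_of_mem_factors ha⟩

/-- Two irreducible polynomials over `K[X]`, one of positive degree and not dividing the other,
have a nonzero resultant, so an ideal containing both meets `K[X]`. -/
lemma exists_C_mem {I : Ideal K[X][Y]} {a b : K[X][Y]} (haI : a ∈ I) (hbI : b ∈ I)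
    (ha : Irreducible a) (ha0 : a.natDegree ≠ 0) (hab : ¬ a ∣ b) :
    ∃ r : K[X], r ≠ 0 ∧ C r ∈ I := by
  obtain ⟨_⟩ : Nonempty (NormalizedGCDMonoid K[X]) := inferInstance
  have hap := ha.isPrimitive ha0
  let φ := algebraMap K[X] (FractionRing K[X])
  have hφ : Function.Injective φ := IsFractionRing.injective _ _
  have hcop : IsCoprime (a.map φ) (b.map φ) :=
    ((hap.irreducible_iff_irreducible_map_fraction_map (K := FractionRing K[X])).1
      ha).coprime_iff_not_dvd.2 fun h ↦ hab (hap.dvd_of_fraction_map_dvd_fraction_map h)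
  have hres := resultant_ne_zero _ _ hcop
  rw [natDegree_map_eq_of_injective hφ, natDegree_map_eq_of_injective hφ, resultant_map_map] at hres
  obtain ⟨u, v, -, -, h⟩ := exists_mul_add_mul_eq_C_resultant a b le_rfl le_rfl (.inl ha0)
  refine ⟨a.resultant b, fun h0 ↦ hres (by rw [h0, map_zero]), ?_⟩
  rw [← h]
  exact I.add_mem (I.mul_mem_right _ haI) (I.mul_mem_right _ hbI)

/-- A prime ideal of `K[X][Y]` that is stable under `swap`, meets `K[X]` trivially and contains a
nonzero polynomial of `Y`-degree at most `n` contains one of degree at most `n` in both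
variables. -/
lemma exists_mem_natDegree_le {I : Ideal K[X][Y]} (hI : I.IsPrime)
    (hswap : ∀ f ∈ I, swap f ∈ I) (hC : ∀ r : K[X], C r ∈ I → r = 0) {f : K[X][Y]} {n : ℕ}
    (hf : f ∈ I) (hf0 : f ≠ 0) (hn : f.natDegree ≤ n) :
    ∃ P ∈ I, P ≠ 0 ∧ P.natDegree ≤ n ∧ (swap P).natDegree ≤ n := by
  obtain ⟨a, haI, ha, haf⟩ := exists_prime_mem_dvd hI hf hf0
  have han := (natDegree_le_of_dvd haf hf0).trans hn
  have ha0 : a.natDegree ≠ 0 := fun h ↦ by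
    rw [eq_C_of_natDegree_eq_zero h] at haI ha
    exact ha.ne_zero (by rw [hC _ haI, C_0])
  have hdvd : a ∣ swap a := by
    by_contra h
    obtain ⟨r, hr, hrI⟩ := exists_C_mem haI (hswap a haI) ha.irreducible ha0 h
    exact hr (hC r hrI)
  have hsa : Irreducible (swap a) := (MulEquiv.irreducible_iff (swap (R := K))).2 ha.irreducible
  refine ⟨a, haI, ha.ne_zero, han, ?_⟩
  exact (natDegree_le_of_dvd (ha.irreducible.associated_of_dvd hsa hdvd).symm.dvd
    ha.ne_zero).trans han

lemma coeff_coeff_swap (f : R[X][Y]) (i j : ℕ) :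
    ((swap f).coeff i).coeff j = (f.coeff j).coeff i := by
  induction f using Polynomial.induction_on' with
  | add f g hf hg => simp [hf, hg]
  | monomial n a =>
    induction a using Polynomial.induction_on' with
    | add f g hf hg => simp_all
    | monomial m r =>
      rw [swap_monomial_monomial]
      simp only [coeff_monomial]
      split_ifs <;> simp_all [coeff_monomial]

lemma evalEval_swap (x y : R) (f : R[X][Y]) : (swap f).evalEval x y = f.evalEval y x := by
  simpa only [coe_aevalAeval_eq_evalEval] using aevalAeval_swap x y f

lemma evalEval_eq_sum_fin {f : R[X][Y]} {n : ℕ} (hY : f.natDegree ≤ n)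
    (hX : (swap f).natDegree ≤ n) (x y : R) :
    f.evalEval x y =
      ∑ k : Fin (n + 1) × Fin (n + 1),
        (f.coeff k.2).coeff k.1 * (x ^ (k.1 : ℕ) * y ^ (k.2 : ℕ)) := by
  have hcoeff (j : ℕ) : (f.coeff j).natDegree ≤ n := natDegree_le_iff_coeff_eq_zero.2 fun i hi ↦ by
    rw [← coeff_coeff_swap, coeff_eq_zero_of_natDegree_lt (hX.trans_lt hi), coeff_zero]
  rw [evalEval, eval_eq_sum_range' (Nat.lt_succ_of_le hY), eval_finsetSum,
    Fintype.sum_prod_type_right, Finset.sum_range]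
  refine Finset.sum_congr rfl fun j _ ↦ ?_
  rw [← C_pow, eval_mul, eval_C, eval_eq_sum_range' (Nat.lt_succ_of_le (hcoeff j)),
    Finset.sum_range, Finset.sum_mul]
  exact Finset.sum_congr rfl fun i _ ↦ mul_assoc _ _ _

lemma exists_coeff_coeff_ne_zero {f : R[X][Y]} {n : ℕ} (hf : f ≠ 0) (hY : f.natDegree ≤ n)
    (hX : (swap f).natDegree ≤ n) :
    ∃ k : Fin (n + 1) × Fin (n + 1), (f.coeff k.2).coeff k.1 ≠ 0 := by
  obtain ⟨j, hj⟩ : ∃ j, f.coeff j ≠ 0 := by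
    by_contra! h
    exact hf (Polynomial.ext h)
  obtain ⟨i, hi⟩ : ∃ i, (f.coeff j).coeff i ≠ 0 := by
    by_contra! h
    exact hj (Polynomial.ext h)
  have hi' : (swap f).coeff i ≠ 0 := fun h ↦ hi (by rw [← coeff_coeff_swap, h, coeff_zero])
  exact ⟨(⟨i, Nat.lt_succ_of_le ((le_natDegree_of_ne_zero hi').trans hX)⟩,
    ⟨j, Nat.lt_succ_of_le ((le_natDegree_of_ne_zero hj).trans hY)⟩), hi⟩

/-- The polynomial with prescribed coefficients indexed by a product of finite intervals. -/
noncomputable def ofCoeff {m n : ℕ} (c : Fin m × Fin n → R) : R[X][Y] :=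
  ∑ k, monomial k.2 (monomial k.1 (c k))

lemma evalEval_ofCoeff {m n : ℕ} (c : Fin m × Fin n → R) (x y : R) :
    (ofCoeff c).evalEval x y = ∑ k, c k * (x ^ (k.1 : ℕ) * y ^ (k.2 : ℕ)) := by
  simp [ofCoeff, evalEval, eval_finsetSum, eval_monomial, mul_assoc]

lemma coeff_coeff_ofCoeff {m n : ℕ} (c : Fin m × Fin n → R) (k : Fin m × Fin n) :
    ((ofCoeff c).coeff k.2).coeff k.1 = c k := by
  rw [ofCoeff, finsetSum_coeff, finsetSum_coeff, Finset.sum_eq_single k]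
  · simp
  · intro l _ hl
    simp only [coeff_monomial]
    split_ifs with h
    · rw [coeff_monomial, if_neg fun h' ↦ hl (Prod.ext (Fin.ext h') (Fin.ext h))]
    · simp
  · simp

lemma natDegree_ofCoeff_le {m n : ℕ} (c : Fin m × Fin (n + 1) → R) :
    (ofCoeff c).natDegree ≤ n :=
  natDegree_sum_le_of_forall_le _ _ fun k _ ↦
    (natDegree_monomial_le _).trans (Nat.le_of_lt_succ k.2.2)

end Bivariate

lemma modUV_neg_inv (hp : 0 < p) (τ : ℍ) : ∃ σ : ℍ,
    modU p d σ = modV p d τ ∧ modV p d σ = modU p d τ := by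
  have hp' : (0 : ℝ) < p := by exact_mod_cast hp
  have hp0 : (p : ℂ) ≠ 0 := by exact_mod_cast hp.ne'
  have hτ := τ.ne_zero
  let σ : ℍ := ModularGroup.S • scale p hp' τ
  have h1 : (σ : ℂ) = -1 / (scale p hp' τ : ℂ) := by
    simp only [σ]
    rw [modular_S_smul]
    simp [neg_div]
  have h2 : (p : ℂ) * σ = -1 / τ := by
    rw [h1, coe_scale, Complex.ofReal_natCast]
    field_simp
  refine ⟨σ, ?_, ?_⟩
  · rw [modU, modV, h2, h1, phi_neg_inv, phi_neg_inv, mul_comm, coe_scale, Complex.ofReal_natCast]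
  · rw [modU, modV, h2, h1, psi_neg_inv, psi_neg_inv, mul_comm, coe_scale, Complex.ofReal_natCast]

lemma tendsto_modU (hp : p ≠ 0) (h8 : 8 * n = d * (p + 1)) (hn : 0 < n) :
    Tendsto (fun τ : ℍ ↦ modU p d τ) atImInfty (𝓝 0) := by
  have h : ContinuousAt (fun q : ℂ ↦ q ^ n * discW p d q) 0 :=
    (continuousAt_id.pow n).mul (differentiableAt_of_ball (differentiableOn_discW hp)).continuousAt
  have h' := h.tendsto.mono_left (nhdsWithin_le_nhds (s := {0}ᶜ))
  simp only [zero_pow hn.ne', zero_mul] at h'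
  exact (tendsto_comp_qParam two_pos h').congr fun τ ↦ (modU_eq h8 _).symm

/-- The ideal of polynomial relations between `modU` and `modV`. -/
noncomputable def relIdeal (p d : ℕ) : Ideal ℂ[X][Y] :=
  RingHom.ker (RingHom.pi fun τ : ℍ ↦ evalEvalRingHom (modU p d τ) (modV p d τ))

lemma mem_relIdeal {f : ℂ[X][Y]} :
    f ∈ relIdeal p d ↔ ∀ τ : ℍ, f.evalEval (modU p d τ) (modV p d τ) = 0 := by
  rw [relIdeal, RingHom.mem_ker]
  exact funext_iff

lemma differentiableOn_evalEval {u v : ℂ → ℂ} {s : Set ℂ} (hu : DifferentiableOn ℂ u s)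
    (hv : DifferentiableOn ℂ v s) (f : ℂ[X][Y]) :
    DifferentiableOn ℂ (fun z ↦ f.evalEval (u z) (v z)) s := by
  induction f using Polynomial.induction_on' with
  | add f g hf hg => simpa only [evalEval_add] using hf.fun_add hg
  | monomial k a =>
    simp only [evalEval, eval_monomial, eval_mul, eval_pow, eval_C]
    exact (a.differentiable.comp_differentiableOn hu).mul (hv.pow k)

lemma isPrime_relIdeal (hp : p ≠ 0) (h8 : 8 * n = d * (p + 1)) : (relIdeal p d).IsPrime := by
  have han (f : ℂ[X][Y]) :
      AnalyticOnNhd ℂ (fun z ↦ f.evalEval (modU p d z) (modV p d z)) upperHalfPlaneSet :=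
    (differentiableOn_evalEval (differentiableOn_modU hp h8) (differentiableOn_modV hp)
      f).analyticOnNhd isOpen_upperHalfPlaneSet
  refine ⟨fun h ↦ ?_, fun {f g} hfg ↦ ?_⟩
  · have := mem_relIdeal.1 ((Ideal.eq_top_iff_one _).1 h) UpperHalfPlane.I
    simp at this
  · simp only [mem_relIdeal, evalEval_mul] at hfg ⊢
    exact ((han f).eq_zero_or_eq_zero_of_mul_eq_zero (han g) (fun z hz ↦ hfg ⟨z, hz⟩)
      (convex_halfSpace_im_gt 0).isPreconnected).imp (fun h τ ↦ h τ τ.im_pos)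
      fun h τ ↦ h τ τ.im_pos

lemma swap_mem_relIdeal (hp : 0 < p) {f : ℂ[X][Y]} (hf : f ∈ relIdeal p d) :
    swap f ∈ relIdeal p d := by
  refine mem_relIdeal.2 fun τ ↦ ?_
  obtain ⟨σ, h1, h2⟩ := modUV_neg_inv (d := d) hp τ
  rw [evalEval_swap, ← h1, ← h2]
  exact mem_relIdeal.1 hf σ

lemma eq_zero_of_C_mem_relIdeal (hp : 0 < p) (h8 : 8 * n = d * (p + 1)) (hn : 0 < n) {r : ℂ[X]}
    (hr : C r ∈ relIdeal p d) : r = 0 := by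
  by_contra h0
  have hlim : Tendsto (fun τ : ℍ ↦ modU p d τ) atImInfty (𝓝[≠] 0) :=
    tendsto_nhdsWithin_iff.2 ⟨tendsto_modU hp.ne' h8 hn, .of_forall fun τ ↦ modU_ne_zero hp τ⟩
  have hne : ∀ᶠ z in 𝓝[≠] (0 : ℂ), z ∉ (r.roots.toFinset : Set ℂ) :=
    nhdsNE_le_cofinite 0 r.roots.toFinset.finite_toSet.compl_mem_cofinite
  obtain ⟨τ, hτ⟩ := (hlim.eventually hne).exists
  have := mem_relIdeal.1 hr τ
  rw [evalEval_C] at this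
  exact hτ (by simpa [h0] using this)

/-- The polynomial relation of degree at most `n` in each of `modU` and `modV`. -/
lemma exists_relation_natDegree_le (hp : p.Prime) (hodd : Odd p) (h8 : 8 * n = d * (p + 1))
    (hn : 0 < n) : ∃ c : Fin (n + 1) × Fin (n + 1) → ℂ, c ≠ 0 ∧ ∀ τ : ℍ,
      ∑ k, c k * (modU p d τ ^ (k.1 : ℕ) * modV p d τ ^ (k.2 : ℕ)) = 0 := by
  obtain ⟨c, hc, hrel⟩ := exists_relation hp hodd h8 hn
  have hf : ofCoeff c ∈ relIdeal p d := mem_relIdeal.2 fun τ ↦ by rw [evalEval_ofCoeff, hrel]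
  have hf0 : ofCoeff c ≠ 0 := fun h ↦ hc <| funext fun k ↦ by
    rw [← coeff_coeff_ofCoeff c k, h]; simp
  obtain ⟨P, hP, hP0, hY, hX⟩ := exists_mem_natDegree_le (isPrime_relIdeal hp.ne_zero h8)
    (fun f ↦ swap_mem_relIdeal hp.pos) (fun r ↦ eq_zero_of_C_mem_relIdeal hp.pos h8 hn) hf hf0
    (natDegree_ofCoeff_le c)
  refine ⟨fun k ↦ (P.coeff k.2).coeff k.1, fun h ↦ ?_, fun τ ↦ ?_⟩
  · obtain ⟨k, hk⟩ := exists_coeff_coeff_ne_zero hP0 hY hX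
    exact hk (congrFun h k)
  · rw [← evalEval_eq_sum_fin hY hX]
    exact mem_relIdeal.1 hP τ

lemma exists_real_relation {ι : Type*} [Fintype ι] {c : ι → ℂ} (hc : c ≠ 0) :
    ∃ r : ι → ℝ, r ≠ 0 ∧ ∀ a : ι → ℝ, ∑ i, c i * (a i : ℂ) = 0 → ∑ i, r i * a i = 0 := by
  by_cases h : ∀ i, (c i).re = 0
  · refine ⟨fun i ↦ (c i).im, fun h' ↦ hc <| funext fun i ↦
      Complex.ext (h i) (congrFun h' i), fun a ha ↦ ?_⟩
    simpa using congrArg Complex.im ha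
  · refine ⟨fun i ↦ (c i).re, fun h' ↦ h fun i ↦ congrFun h' i, fun a ha ↦ ?_⟩
    simpa using congrArg Complex.re ha

lemma exists_disc_relation (hp : p.Prime) (hodd : Odd p) (h8 : 8 * n = d * (p + 1))
    (hn : 0 < n) : ∃ r : Fin (n + 1) × Fin (n + 1) → ℝ, r ≠ 0 ∧ ∀ q : ℝ, 0 < q → q < 1 →
      ∑ k, r k * ((q ^ n * discW p d q) ^ (k.1 : ℕ) * discV p d q ^ (k.2 : ℕ)) = 0 := by
  obtain ⟨c, hc, hrel⟩ := exists_relation_natDegree_le hp hodd h8 hn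
  obtain ⟨r, hr, hcr⟩ := exists_real_relation hc
  refine ⟨r, hr, fun q h0 h1 ↦ hcr _ ?_⟩
  have hq : ‖q‖ < 1 := by rwa [Real.norm_of_nonneg h0.le]
  have hqp := norm_pow_lt_one hq hp.ne_zero
  obtain ⟨t, ht, h⟩ := exists_nome h0 h1
  let τ : ℍ := ⟨t * I, by simpa using ht⟩
  have := hrel τ
  simp_rw [modU_eq h8, modV_eq, h τ rfl] at this
  simpa [discW, discV, ofReal_prodA hq, ofReal_prodB hq, ofReal_prodA hqp, ofReal_prodB hqp]
    using this

lemma mul_x₄_rpow (hp : p ≠ 0) (h8 : 8 * n = d * (p + 1)) {h : ℕ} (hhd : h * d = 8) {q : ℝ}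
    (h0 : 0 < q) (h1 : q < 1) :
    (x₄ (q ^ p) * x₄ q) ^ ((1 : ℝ) / h) = q ^ n * discW p d q := by
  have hq : ‖q‖ < 1 := by rwa [Real.norm_of_nonneg h0.le]
  have hqp := norm_pow_lt_one hq hp
  have hA := prodA_pos hq
  have hAp := prodA_pos hqp
  have hh : h ≠ 0 := by rintro rfl; simp at hhd
  have hn : n * h = p + 1 := by
    have : 8 * (n * h) = 8 * (p + 1) := by linear_combination h * h8 + (p + 1) * hhd
    omega
  have key : x₄ (q ^ p) * x₄ q = (q ^ n * discW p d q) ^ h := by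
    rw [x₄_eq hq, x₄_eq hqp, discW, mul_pow, ← pow_mul, ← pow_mul, hn, mul_comm d, hhd]
    ring
  rw [key, one_div, Real.pow_rpow_inv_natCast _ hh]
  unfold discW
  positivity

lemma mul_one_sub_x₄_rpow (hp : p ≠ 0) {h : ℕ} (hhd : h * d = 8) {q : ℝ}
    (h0 : 0 < q) (h1 : q < 1) :
    ((1 - x₄ (q ^ p)) * (1 - x₄ q)) ^ ((1 : ℝ) / h) = discV p d q := by
  have hq : ‖q‖ < 1 := by rwa [Real.norm_of_nonneg h0.le]
  have hB := prodB_pos hq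
  have hBp := prodB_pos (norm_pow_lt_one hq hp)
  have hh : h ≠ 0 := by rintro rfl; simp at hhd
  have key : (1 - x₄ (q ^ p)) * (1 - x₄ q) = discV p d q ^ h := by
    rw [one_sub_x₄_eq h0 h1, one_sub_x₄_eq (pow_pos h0 p) (pow_lt_one₀ h0.le h1 hp), discV,
      ← pow_mul, mul_comm d, hhd]
    ring
  rw [key, one_div, Real.pow_rpow_inv_natCast _ hh]
  unfold discV
  positivity

lemma num_den_eq {h : ℕ} (hn : (n : ℤ) = (((p : ℚ) + 1) / 8).num)
    (hd : d = (((p : ℚ) + 1) / 8).den) (hh : h = 8 / d) :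
    8 * n = d * (p + 1) ∧ 0 < n ∧ h * d = 8 := by
  have hd0 : d ≠ 0 := hd ▸ Rat.den_ne_zero _
  have e : ((p : ℚ) + 1) / 8 = n / d := by
    rw [← Rat.num_div_den (((p : ℚ) + 1) / 8), ← hn, ← hd]
    simp
  have h8 : 8 * n = d * (p + 1) := by
    rw [div_eq_div_iff (by norm_num) (by exact_mod_cast hd0)] at e
    have : (p + 1) * d = n * 8 := by exact_mod_cast e
    linarith
  have hcop : d.Coprime n := by
    have := (((p : ℚ) + 1) / 8).reduced
    rw [← hn, ← hd] at this
    exact this.symm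
  have hd8 : d ∣ 8 := hcop.dvd_of_dvd_mul_right ⟨p + 1, h8⟩
  refine ⟨h8, Nat.pos_of_ne_zero ?_, hh ▸ Nat.div_mul_cancel hd8⟩
  rintro rfl
  simp [hd0] at h8

/-- The bivariate polynomial with prescribed coefficients. -/
noncomputable def mvOfCoeff {m n : ℕ} (r : Fin m × Fin n → ℝ) : MvPolynomial (Fin 2) ℝ :=
  ∑ k, MvPolynomial.monomial (Finsupp.single 0 (k.1 : ℕ) + Finsupp.single 1 (k.2 : ℕ)) (r k)

lemma eval_mvOfCoeff {m n : ℕ} (r : Fin m × Fin n → ℝ) (x : Fin 2 → ℝ) :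
    MvPolynomial.eval x (mvOfCoeff r) =
      ∑ k, r k * (x 0 ^ (k.1 : ℕ) * x 1 ^ (k.2 : ℕ)) := by
  simp [mvOfCoeff, MvPolynomial.eval_monomial, Finsupp.prod_fintype]

lemma mvOfCoeff_ne_zero {m n : ℕ} {r : Fin m × Fin n → ℝ} (hr : r ≠ 0) : mvOfCoeff r ≠ 0 := by
  classical
  obtain ⟨k, hk⟩ := Function.ne_iff.1 hr
  refine MvPolynomial.ne_zero_iff.2
    ⟨Finsupp.single 0 (k.1 : ℕ) + Finsupp.single 1 (k.2 : ℕ), ?_⟩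
  rw [mvOfCoeff, MvPolynomial.coeff_sum, Finset.sum_eq_single k]
  · simpa using hk
  · intro l _ hl
    rw [MvPolynomial.coeff_monomial, if_neg]
    intro h
    refine hl (Prod.ext (Fin.ext ?_) (Fin.ext ?_))
    · simpa using DFunLike.congr_fun h 0
    · simpa using DFunLike.congr_fun h 1
  · simp

lemma degreeOf_mvOfCoeff_le {n : ℕ} (r : Fin (n + 1) × Fin (n + 1) → ℝ) (i : Fin 2) :
    (mvOfCoeff r).degreeOf i ≤ n := by
  classical
  refine MvPolynomial.degreeOf_sum_le i _ _ |>.trans (Finset.sup_le fun k _ ↦ ?_)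
  obtain h0 | h0 := eq_or_ne (r k) 0
  · simp [h0]
  rw [MvPolynomial.degreeOf_monomial_eq _ _ h0]
  have h1 := k.1.2
  have h2 := k.2.2
  fin_cases i <;> simp <;> omega

end RussellLevelFour

/-- Russell's theorem for level 4: if `p` is an odd prime and `(p+1)/8 = n/d` in lowest
terms, `h = 8/d`, then there is a nonzero modular equation `P(u,v) = 0` of degree at most
`n` in each variable, where `u = (αβ)^{1/h}`, `v = ((1-α)(1-β))^{1/h}`, `β = x₄(q)`,
`α = x₄(q^p)`. -/
theorem russell_level_four (p : ℕ) (hp : p.Prime) (hodd : Odd p)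
    (n d h : ℕ)
    (hn : (n : ℤ) = (((p : ℚ) + 1) / 8).num) (hd : d = (((p : ℚ) + 1) / 8).den)
    (hh : h = 8 / d) :
    ∃ P : MvPolynomial (Fin 2) ℝ, P ≠ 0 ∧
      P.degreeOf 0 ≤ n ∧ P.degreeOf 1 ≤ n ∧
      ∀ q : ℝ, 0 < q → q < 1 →
        MvPolynomial.eval
          ![(x₄ (q ^ p) * x₄ q) ^ ((1 : ℝ) / h),
            ((1 - x₄ (q ^ p)) * (1 - x₄ q)) ^ ((1 : ℝ) / h)] P = 0 := by
  open RussellLevelFour in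
  obtain ⟨h8, hn0, hhd⟩ := num_den_eq hn hd hh
  obtain ⟨r, hr, hrel⟩ := exists_disc_relation hp hodd h8 hn0
  refine ⟨mvOfCoeff r, mvOfCoeff_ne_zero hr, degreeOf_mvOfCoeff_le r 0,
    degreeOf_mvOfCoeff_le r 1, fun q h0 h1 ↦ ?_⟩
  rw [eval_mvOfCoeff, Matrix.cons_val_zero, Matrix.cons_val_one, Matrix.cons_val_fin_one,
    mul_x₄_rpow hp.ne_zero h8 hhd h0 h1, mul_one_sub_x₄_rpow hp.ne_zero hhd h0 h1]
  exact hrel q h0 h1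
end
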